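/- For every integer n ≥ 1, the theory PA⁻ + IΣn + PΣn + WPHP(Σ_{n+1}) + FRT(Σ_{n+1}) does not prove BΣ_{n+1}: there exists a model of PA⁻ + IΣn satisfying PΣn, WPHP(Σ_{n+1}) and FRT(Σ_{n+1}) in which BΣ_{n+1} fails. -/

import Mathlib

/- Shared development: first-order arithmetic in the language {0,1,+,·,<},
   the arithmetic hierarchy, fragments of arithmetic, and coded finite
   combinatorics inside models. -/

open FirstOrder Language

namespace ArithFC

/-- Function symbols of the language of arithmetic: 0, 1, +, ·. -/
inductive Func : ℕ → Type
  | zero : Func 0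
  | one : Func 0
  | add : Func 2
  | mul : Func 2

/-- Relation symbols of the language of arithmetic: <. -/
inductive Rel : ℕ → Type
  | lt : Rel 2

/-- The first-order language {0, 1, +, ·, <}. -/
def lang : Language :=
  { Functions := Func, Relations := Rel }

section Instances

variable (M : Type) [lang.Structure M]

instance : Zero M := ⟨Structure.funMap (L := lang) Func.zero ![]⟩
instance : One M := ⟨Structure.funMap (L := lang) Func.one ![]⟩
instance : Add M := ⟨fun x y => Structure.funMap (L := lang) Func.add ![x, y]⟩
instance : Mul M := ⟨fun x y => Structure.funMap (L := lang) Func.mul ![x, y]⟩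
instance : LT M := ⟨fun x y => Structure.RelMap (L := lang) Rel.lt ![x, y]⟩
instance : LE M := ⟨fun x y => x < y ∨ x = y⟩

end Instances

/-- The numeral `n` in a model. -/
def numM (M : Type) [lang.Structure M] : ℕ → M
  | 0 => 0
  | n + 1 => numM M n + 1

/-- `b` is nonstandard (greater than every numeral). -/
def Nonstd {M : Type} [lang.Structure M] (b : M) : Prop := ∀ n : ℕ, numM M n < b

/-- The atomic formula `t < u`. -/
def ltFm {α : Type} {n : ℕ} (t u : lang.Term (α ⊕ Fin n)) : lang.BoundedFormula α n :=
  BoundedFormula.rel (Rel.lt : lang.Relations 2) ![t, u]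

/-- Δ₀ formulas: built from atomic formulas by boolean connectives and
bounded universal quantification (this generates, up to logical equivalence,
the usual class of bounded formulas). -/
inductive IsDelta0 {α : Type} : ∀ n : ℕ, lang.BoundedFormula α n → Prop
  | falsum (n : ℕ) : IsDelta0 n BoundedFormula.falsum
  | equal (n : ℕ) (t u : lang.Term (α ⊕ Fin n)) : IsDelta0 n (BoundedFormula.equal t u)
  | rel (n l : ℕ) (R : lang.Relations l) (ts : Fin l → lang.Term (α ⊕ Fin n)) :
      IsDelta0 n (BoundedFormula.rel R ts)
  | imp (n : ℕ) {φ ψ : lang.BoundedFormula α n} :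
      IsDelta0 n φ → IsDelta0 n ψ → IsDelta0 n (φ.imp ψ)
  | bdAll (n : ℕ) (t : lang.Term (α ⊕ Fin n)) {φ : lang.BoundedFormula α (n + 1)} :
      IsDelta0 (n + 1) φ →
      IsDelta0 n
        (BoundedFormula.all ((ltFm (Term.var (Sum.inr (Fin.last n))) (t.liftAt 1 n)).imp φ))

mutual
  /-- Σ_m formulas. -/
  inductive SigmaFm {α : Type} : ℕ → ∀ n : ℕ, lang.BoundedFormula α n → Prop
    | delta0 (m n : ℕ) {φ : lang.BoundedFormula α n} : IsDelta0 n φ → SigmaFm m n φ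
    | ofPi (m n : ℕ) {φ : lang.BoundedFormula α n} : PiFm m n φ → SigmaFm (m + 1) n φ
    | ex (m n : ℕ) {φ : lang.BoundedFormula α (n + 1)} :
        SigmaFm (m + 1) (n + 1) φ → SigmaFm (m + 1) n φ.ex
  /-- Π_m formulas. -/
  inductive PiFm {α : Type} : ℕ → ∀ n : ℕ, lang.BoundedFormula α n → Prop
    | delta0 (m n : ℕ) {φ : lang.BoundedFormula α n} : IsDelta0 n φ → PiFm m n φ
    | ofSigma (m n : ℕ) {φ : lang.BoundedFormula α n} : SigmaFm m n φ → PiFm (m + 1) n φ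
    | all (m n : ℕ) {φ : lang.BoundedFormula α (n + 1)} :
        PiFm (m + 1) (n + 1) φ → PiFm (m + 1) n φ.all
end

/-- A `k`-ary relation on `M` is Σ_m-definable (with parameters from `M`). -/
def IsSigmaDef (m : ℕ) (M : Type) [lang.Structure M] {k : ℕ} (R : (Fin k → M) → Prop) : Prop :=
  ∃ (p : ℕ) (φ : lang.BoundedFormula (Fin k ⊕ Fin p) 0) (w : Fin p → M),
    SigmaFm m 0 φ ∧ ∀ v : Fin k → M, R v ↔ φ.Realize (Sum.elim v w) finZeroElim

/-- A subset of `M` is Σ_m-definable with parameters. -/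
def SigmaDef1 (m : ℕ) (M : Type) [lang.Structure M] (A : Set M) : Prop :=
  IsSigmaDef m M (k := 1) fun v => v 0 ∈ A

/-- A binary relation on `M` is Σ_m-definable with parameters. -/
def SigmaDef2 (m : ℕ) (M : Type) [lang.Structure M] (R : M → M → Prop) : Prop :=
  IsSigmaDef m M (k := 2) fun v => R (v 0) (v 1)

/-- A ternary relation on `M` is Σ_m-definable with parameters. -/
def SigmaDef3 (m : ℕ) (M : Type) [lang.Structure M] (R : M → M → M → Prop) : Prop :=
  IsSigmaDef m M (k := 3) fun v => R (v 0) (v 1) (v 2)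

/-- `M` is a model of PA⁻ (the nonnegative part of a discretely ordered
commutative semiring). -/
structure PAm (M : Type) [lang.Structure M] : Prop where
  add_assoc : ∀ x y z : M, x + y + z = x + (y + z)
  add_comm : ∀ x y : M, x + y = y + x
  mul_assoc : ∀ x y z : M, x * y * z = x * (y * z)
  mul_comm : ∀ x y : M, x * y = y * x
  ldistrib : ∀ x y z : M, x * (y + z) = x * y + x * z
  add_zero : ∀ x : M, x + 0 = x
  mul_zero : ∀ x : M, x * 0 = 0
  mul_one : ∀ x : M, x * 1 = x
  lt_trans : ∀ x y z : M, x < y → y < z → x < z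
  lt_irrefl : ∀ x : M, ¬x < x
  lt_total : ∀ x y : M, x < y ∨ x = y ∨ y < x
  add_lt_add : ∀ x y z : M, x < y → x + z < y + z
  mul_lt_mul : ∀ x y z : M, x < y → 0 < z → x * z < y * z
  sub_exists : ∀ x y : M, x < y → ∃ z, x + z = y
  zero_lt_one : (0 : M) < 1
  discrete : ∀ x : M, 0 < x → (1 : M) ≤ x
  zero_le : ∀ x : M, (0 : M) ≤ x

/-- `M` satisfies the Σ_m-induction scheme (with parameters). -/
def ISig (m : ℕ) (M : Type) [lang.Structure M] : Prop :=
  ∀ A : Set M, SigmaDef1 m M A → (0 : M) ∈ A → (∀ x, x ∈ A → x + 1 ∈ A) → ∀ x, x ∈ A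

/-- `M` satisfies the Σ_m-collection (bounding) scheme (with parameters). -/
def BSig (m : ℕ) (M : Type) [lang.Structure M] : Prop :=
  ∀ R : M → M → Prop, SigmaDef2 m M R → ∀ a : M,
    (∀ x, x < a → ∃ y, R x y) → ∃ b, ∀ x, x < a → ∃ y, y < b ∧ R x y

section Coding

variable {M : Type} [lang.Structure M]

/-- `z` is the Cantor pair `⟨x, y⟩`: `2z = (x+y)(x+y+1) + 2y`. -/
def IsPairC (z x y : M) : Prop := z + z = (x + y) * (x + y + 1) + (y + y)

/-- Gödel's β-function: `x = a mod ((i+1)·b + 1)`. -/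
def BetaC (a b i x : M) : Prop :=
  x < (i + 1) * b + 1 ∧ ∃ q, a = q * ((i + 1) * b + 1) + x

/-- The sequence coded by `s` (via a Cantor pair of β-function data) has value `x`
at place `i`. -/
def SeqAt (s i x : M) : Prop := ∃ a b, IsPairC s a b ∧ BetaC a b i x

/-- `c` codes the M-finite set `X` of cardinality `card`: `c = ⟨card, s⟩` where `s`
codes the strictly increasing enumeration of `X` of length `card`. -/
def CodesFinset (c : M) (X : Set M) (card : M) : Prop :=
  ∃ s, IsPairC c card s ∧
    (∀ i, i < card → ∃ x, x ∈ X ∧ SeqAt s i x) ∧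
    (∀ i j x y, i < j → j < card → SeqAt s i x → SeqAt s j y → x < y) ∧
    (∀ x, x ∈ X ↔ ∃ i, i < card ∧ SeqAt s i x)

/-- `X` is an M-finite (coded) set. -/
def MFinite (X : Set M) : Prop := ∃ c card : M, CodesFinset c X card

/-- `d` codes an `e`-element subset `D` of `[0, y)`, i.e. an element of `[y]^e`. -/
def CodesTupleIn (d e y : M) (D : Set M) : Prop :=
  CodesFinset d D e ∧ ∀ z ∈ D, z < y

/-- `f` codes a (finite) function defined on all of `[0, a)`. -/
def CodesFunOn (f a : M) : Prop :=
  ∀ x, x < a → (∃ y, SeqAt f x y) ∧ ∀ y y', SeqAt f x y → SeqAt f x y' → y = y'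

/-- `X` is an M-coded subset of `[0, a)`. -/
def MCodedSubset (a : M) (X : Set M) : Prop :=
  MFinite X ∧ ∀ x ∈ X, x < a

end Coding

/-- An `M`-ultrafilter on `a`: an ultrafilter of the Boolean algebra of
M-finite subsets of `[0, a)`. -/
structure MUltra (M : Type) [lang.Structure M] (a : M) where
  sets : Set (Set M)
  mem_coded : ∀ X ∈ sets, MCodedSubset a X
  univ_mem : {x : M | x < a} ∈ sets
  superset_mem : ∀ X Y : Set M, X ∈ sets → MCodedSubset a Y → X ⊆ Y → Y ∈ sets
  inter_mem : ∀ X Y : Set M, X ∈ sets → Y ∈ sets → X ∩ Y ∈ sets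
  empty_not_mem : (∅ : Set M) ∉ sets
  ultra : ∀ X : Set M, MCodedSubset a X → X ∈ sets ∨ {x : M | x < a ∧ x ∉ X} ∈ sets

section Principles

variable (M : Type) [lang.Structure M]

/-- `F` is (the graph of) a Σ_m-definable injection from `[0, y)` into `[0, x)`. -/
def SigmaInjRel (m : ℕ) (F : M → M → Prop) (y x : M) : Prop :=
  SigmaDef2 m M F ∧
    (∀ u, u < y → ∃ v, v < x ∧ F u v) ∧
    (∀ u v v', u < y → F u v → F u v' → v = v') ∧
    (∀ u u' v, u < y → u' < y → F u v → F u' v → u = u')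

/-- There exists a Σ_m-definable injection from `[0, y)` into `[0, x)`. -/
def ExSigmaInj (m : ℕ) (y x : M) : Prop := ∃ F : M → M → Prop, SigmaInjRel M m F y x

/-- There exists a Σ_m-definable injection from all of `M` into `[0, a)`. -/
def SigmaInjWhole (m : ℕ) (a : M) : Prop :=
  ∃ F : M → M → Prop, SigmaDef2 m M F ∧
    (∀ u, ∃ v, v < a ∧ F u v) ∧
    (∀ u v v', F u v → F u v' → v = v') ∧
    (∀ u u' v, F u v → F u' v → u = u')

/-- CARD(Σ_m): no Σ_m-definable multivalued map sends `M` injectively below `a`. -/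
def CARD (m : ℕ) : Prop :=
  ∀ F : M → M → Prop, SigmaDef2 m M F → ∀ a : M,
    (∀ x, ∃ y, y < a ∧ F x y) →
      ∃ x0 x1 y, x0 ≠ x1 ∧ y < a ∧ F x0 y ∧ F x1 y

/-- GPHP(Σ_m): for every `x` there is `y` with no Σ_m-definable injection of
`[0,y)` into `[0,x)`. -/
def GPHP (m : ℕ) : Prop := ∀ x : M, ∃ y : M, ¬ExSigmaInj M m y x

/-- WPHP(Σ_m): for `x > 0` there is no Σ_m-definable injection of `[0,2x)` into `[0,x)`. -/
def WPHP (m : ℕ) : Prop := ∀ x : M, 0 < x → ¬ExSigmaInj M m (x + x) x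

/-- `C` is a Σ_m-definable `k`-coloring of `[y]^e` (acting on codes of
`e`-element subsets of `[0,y)`, independently of the chosen code). -/
def IsColoring (m : ℕ) (e y k : M) (C : M → M → Prop) : Prop :=
  SigmaDef2 m M C ∧
    (∀ d D, CodesTupleIn d e y D → ∃ i, i < k ∧ C d i) ∧
    (∀ d d' D i i', CodesTupleIn d e y D → CodesTupleIn d' e y D → C d i → C d' i' → i = i')

/-- FRT^e_k(Σ_m): every Σ_m-definable `k`-coloring of some `[y]^e` has an
M-finite homogeneous set of cardinality `x`, for every `x`. -/
def FRT (m : ℕ) (e k : M) : Prop :=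
  ∀ x : M, ∃ y : M, ∀ C : M → M → Prop, IsColoring M m e y k C →
    ∃ (c : M) (H : Set M), CodesFinset c H x ∧ (∀ z ∈ H, z < y) ∧
      ∃ i, ∀ d D, CodesFinset d D e → D ⊆ H → C d i

/-- fairFRT^e_k(Σ_m): the homogeneous set is required to be given as the range of a
Σ_m-definable injection from `[0,x)` into `[0,y)`. -/
def FairFRT (m : ℕ) (e k : M) : Prop :=
  ∀ x : M, ∃ y : M, ∀ C : M → M → Prop, IsColoring M m e y k C →
    ∃ H : M → M → Prop, SigmaInjRel M m H x y ∧
      ∃ i, ∀ d D, CodesFinset d D e → (∀ z ∈ D, ∃ u, u < x ∧ H u z) → C d i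

/-- `C` is a Σ_m-definable `k`-coloring of `[0, y)`. -/
def IsColoring1 (m : ℕ) (y k : M) (C : M → M → Prop) : Prop :=
  SigmaDef2 m M C ∧
    (∀ z, z < y → ∃ i, i < k ∧ C z i) ∧
    (∀ z i i', z < y → C z i → C z i' → i = i')

/-- FRT¹_k(Σ_m): every Σ_m-definable `k`-coloring of some `[0,y)` has an M-finite
homogeneous set of cardinality `x`, for every `x`. -/
def FRT1 (m : ℕ) (k : M) : Prop :=
  ∀ x : M, ∃ y : M, ∀ C : M → M → Prop, IsColoring1 M m y k C →
    ∃ (c : M) (H : Set M), CodesFinset c H x ∧ (∀ z ∈ H, z < y) ∧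
      ∃ i, ∀ z ∈ H, C z i

/-- fairFRT¹_k(Σ_m). -/
def FairFRT1 (m : ℕ) (k : M) : Prop :=
  ∀ x : M, ∃ y : M, ∀ C : M → M → Prop, IsColoring1 M m y k C →
    ∃ H : M → M → Prop, SigmaInjRel M m H x y ∧
      ∃ i, ∀ u v, u < x → H u v → C v i

end Principles

section Approx

variable {M : Type} [lang.Structure M]

/-- `f` is (the graph of) a partial function. -/
def IsPartialFun (f : M → M → Prop) : Prop := ∀ x y y', f x y → f x y' → y = y'

/-- `s` codes an approximation to the partial function `f` of length `b`. -/
def IsApprox (f : M → M → Prop) (s b : M) : Prop :=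
  (∀ i, i < b → ∃ v, SeqAt s i v) ∧
    (∀ i u v x y, i + 1 < b → SeqAt s i u → SeqAt s (i + 1) v → x ≤ u → f x y → y ≤ v)

/-- `s` codes a `g`-stretched approximation to the partial function `f` of length `b`. -/
def IsStretchedApprox (f g : M → M → Prop) (s b : M) : Prop :=
  (∀ i, i < b → ∃ v, SeqAt s i v) ∧
    (∀ i u w v x y, i + 1 < b → SeqAt s i u → g u w → SeqAt s (i + 1) v →
      x ≤ w → f x y → y ≤ v)

/-- The eventual (limit) value of `fun s => h s ·` is `x`. -/
def EvLim (h : M → M → Prop) (x : M) : Prop := ∃ s : M, ∀ t, s < t → h t x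

end Approx

/-- PΣ_m: every partial Σ_m-definable function admits approximations of every length. -/
def PSig (m : ℕ) (M : Type) [lang.Structure M] : Prop :=
  ∀ f : M → M → Prop, SigmaDef2 m M f → IsPartialFun f → ∀ b : M, ∃ s, IsApprox f s b

section Extensions

variable (M N : Type) [lang.Structure M] [lang.Structure N]

/-- `g : M → N` is Σ_m-elementary: Σ_m formulas with parameters from `M` transfer. -/
def SigmaElem (m : ℕ) (g : M → N) : Prop :=
  ∀ (p : ℕ) (φ : lang.BoundedFormula (Fin p) 0), SigmaFm m 0 φ →
    ∀ v : Fin p → M, (φ.Realize v finZeroElim ↔ φ.Realize (g ∘ v) finZeroElim)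

/-- The extension `g : M → N` is cofinal. -/
def Cofinal (g : M → N) : Prop := ∀ z : N, ∃ x : M, z ≤ g x

/-- `[0,a]^M = [0,a]^N`: every element of `N` below `g a` comes from `M`. -/
def SameBelow (g : M → N) (a : M) : Prop := ∀ z : N, z ≤ g a → ∃ x : M, g x = z

end Extensions

section Ramsey

variable {M : Type} [lang.Structure M]

/-- `f` is an M-coded `k`-coloring of `[y]^e` (assigning colors to codes of
`e`-subsets of `[0,y)`, independently of the code). -/
def CodedColoring (f e y k : M) : Prop :=
  (∀ d D, CodesTupleIn d e y D → ∃ i, i < k ∧ SeqAt f d i) ∧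
    (∀ d d' D i i', CodesTupleIn d e y D → CodesTupleIn d' e y D →
      SeqAt f d i → SeqAt f d' i' → i = i')

/-- The coded coloring `f` of `[y]^e` has an M-coded homogeneous set of cardinality `x`. -/
def CodedHomog (f e y x : M) : Prop :=
  ∃ (c : M) (H : Set M), CodesFinset c H x ∧ (∀ z ∈ H, z < y) ∧
    ∃ i, ∀ d D, CodesFinset d D e → D ⊆ H → SeqAt f d i

/-- `y = r(x, e, k)`: `y` is the least size guaranteeing coded homogeneous sets of
cardinality `x` for all coded `k`-colorings of `e`-subsets. -/
def IsRamsey (x e k y : M) : Prop :=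
  (∀ f, CodedColoring f e y k → CodedHomog f e y x) ∧
    (∀ y', y' < y → ∃ f, CodedColoring f e y' k ∧ ¬CodedHomog f e y' x)

/-- `y = r^(b)(x, e, k)`: the `b`-th iterate of the Ramsey function inside `M`. -/
def IterRamsey (x e k b y : M) : Prop :=
  ∃ s : M, SeqAt s 0 x ∧ SeqAt s b y ∧ (∀ i, i ≤ b → ∃ u, SeqAt s i u) ∧
    (∀ i u v, i < b → SeqAt s i u → SeqAt s (i + 1) v → IsRamsey u e k v)

end Ramsey

end ArithFC

set_option linter.all false

namespace ArithFC
section Calc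

/-- The arithmetical hierarchy over computable predicates. -/
def Sg : ℕ → ∀ {α : Type} [Primcodable α], (α → Prop) → Prop
  | 0, α, _, P => ∃ f : α → Bool, Computable f ∧ ∀ a, P a ↔ f a = true
  | m + 1, α, _, P => ∃ Q : α × ℕ → Prop, Sg m Q ∧ ∀ a, P a ↔ ∃ y, ¬ Q (a, y)

variable {α β γ δ : Type} [Primcodable α] [Primcodable β] [Primcodable γ] [Primcodable δ]

theorem Sg.congr {m : ℕ} {P Q : α → Prop} (h : Sg m P) (e : ∀ a, P a ↔ Q a) : Sg m Q := by
  have : P = Q := funext fun a => propext (e a)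
  exact this ▸ h

theorem Sg.comp {m : ℕ} : ∀ {α β : Type} [Primcodable α] [Primcodable β] {P : β → Prop}
    {f : α → β}, Sg m P → Computable f → Sg m (fun a => P (f a)) := by
  induction m with
  | zero =>
    intro α β _ _ P f ⟨g, hg, h⟩ hf
    exact ⟨_, hg.comp hf, fun a => h _⟩
  | succ m ih =>
    intro α β _ _ P f ⟨Q, hQ, h⟩ hf
    exact ⟨_, ih hQ (Computable.pair (hf.comp Computable.fst) Computable.snd), fun a => h _⟩

theorem Sg.lift_not {m : ℕ} {P : α → Prop} (h : Sg m P) : Sg (m+1) (fun a => ¬ P a) :=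
  ⟨fun p => P p.1, h.comp Computable.fst, fun a => by simp⟩

theorem Sg.not0 {P : α → Prop} (h : Sg 0 P) : Sg 0 (fun a => ¬ P a) := by
  obtain ⟨f, hf, h⟩ := h
  exact ⟨fun a => !f a, Primrec.not.to_comp.comp hf, fun a => by simp [h]⟩

theorem Sg.lift {m : ℕ} : ∀ {α : Type} [Primcodable α] {P : α → Prop}, Sg m P → Sg (m+1) P := by
  induction m with
  | zero =>
    intro α _ P h
    exact h.not0.lift_not.congr (fun a => by simp)
  | succ m ih =>
    intro α _ P ⟨Q, hQ, h⟩
    exact ⟨Q, ih hQ, h⟩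

theorem Sg.mono {m k : ℕ} {P : α → Prop} (h : Sg m P) (hk : m ≤ k) : Sg k P := by
  induction hk with
  | refl => exact h
  | step _ ih => exact ih.lift

theorem Sg.lift_not' {m k : ℕ} {P : α → Prop} (h : Sg m P) (hk : m < k) :
    Sg k (fun a => ¬ P a) := h.lift_not.mono hk

theorem Sg.exN {m : ℕ} {P : α × ℕ → Prop} (h : Sg (m+1) P) : Sg (m+1) (fun a => ∃ y, P (a, y)) := by
  obtain ⟨Q, hQ, h⟩ := h
  refine ⟨fun p => Q ((p.1, p.2.unpair.1), p.2.unpair.2), hQ.comp ?_, fun a => ?_⟩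
  · exact Computable.pair (Computable.pair Computable.fst
      (Computable.fst.comp (Computable.unpair.comp Computable.snd)))
      (Computable.snd.comp (Computable.unpair.comp Computable.snd))
  · simp only [h]
    constructor
    · rintro ⟨y, z, hz⟩
      exact ⟨Nat.pair y z, by simpa using hz⟩
    · rintro ⟨y, hy⟩
      exact ⟨_, _, hy⟩

/-- a computable surjection from the naturals -/
def dec (β : Type) [Primcodable β] [Inhabited β] (k : ℕ) : β := (Encodable.decode k : Option β).getD default

theorem dec_encode [Inhabited β] (b : β) : dec β (Encodable.encode b) = b := by simp [dec]

theorem dec_comp [Inhabited β] : Computable (dec β) :=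
  (Primrec.option_getD.comp Primrec.decode (Primrec.const default)).to_comp

theorem Sg.ex [Inhabited β] {m : ℕ} {P : α × β → Prop} (h : Sg (m+1) P) :
    Sg (m+1) (fun a => ∃ y, P (a, y)) := by
  have := (h.comp (f := fun p : α × ℕ => (p.1, dec β p.2))
    (Computable.pair Computable.fst (dec_comp.comp Computable.snd))).exN
  refine this.congr fun a => ?_
  constructor
  · rintro ⟨y, hy⟩; exact ⟨_, hy⟩
  · rintro ⟨y, hy⟩; exact ⟨Encodable.encode y, by simpa [dec_encode] using hy⟩

theorem Sg.and_or (m : ℕ) : ∀ {α : Type} [Primcodable α] {P Q : α → Prop}, Sg m P → Sg m Q →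
    Sg m (fun a => P a ∧ Q a) ∧ Sg m (fun a => P a ∨ Q a) := by
  induction m with
  | zero =>
    intro α _ P Q ⟨f, hf, h⟩ ⟨g, hg, h'⟩
    refine ⟨⟨fun a => f a && g a, Primrec.and.to_comp.comp hf hg, fun a => by simp [h, h']⟩,
      ⟨fun a => f a || g a, Primrec.or.to_comp.comp hf hg, fun a => by simp [h, h']⟩⟩
  | succ m ih =>
    intro α _ P Q ⟨P', hP, h⟩ ⟨Q', hQ, h'⟩
    constructor
    · refine ⟨fun p => P' (p.1, p.2.unpair.1) ∨ Q' (p.1, p.2.unpair.2), (ih (hP.comp ?_) (hQ.comp ?_)).2, ?_⟩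
      · exact Computable.pair Computable.fst
          (Computable.fst.comp (Computable.unpair.comp Computable.snd))
      · exact Computable.pair Computable.fst
          (Computable.snd.comp (Computable.unpair.comp Computable.snd))
      · intro a
        simp only [h, h']
        constructor
        · rintro ⟨⟨y, hy⟩, ⟨z, hz⟩⟩
          exact ⟨Nat.pair y z, by simp [hy, hz]⟩
        · rintro ⟨y, hy⟩
          push Not at hy
          exact ⟨⟨_, hy.1⟩, ⟨_, hy.2⟩⟩
    · refine ⟨fun p => P' p ∧ Q' p, (ih hP hQ).1, ?_⟩
      intro a
      simp only [h, h']
      rw [← exists_or]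
      simp only [not_and_or]

theorem Sg.and {m : ℕ} {P Q : α → Prop} (h : Sg m P) (h' : Sg m Q) : Sg m (fun a => P a ∧ Q a) :=
  (Sg.and_or m h h').1
theorem Sg.or {m : ℕ} {P Q : α → Prop} (h : Sg m P) (h' : Sg m Q) : Sg m (fun a => P a ∨ Q a) :=
  (Sg.and_or m h h').2

theorem Sg.ofBool {f : α → Bool} (hf : Computable f) (m : ℕ) : Sg m (fun a => f a = true) :=
  Sg.mono (m := 0) ⟨f, hf, fun _ => Iff.rfl⟩ (Nat.zero_le _)

theorem Sg.ofPrim {P : α → Prop} [DecidablePred P] (hf : PrimrecPred P) (m : ℕ) : Sg m P := by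
  refine (Sg.ofBool (f := fun a => decide (P a)) ?_ m).congr (by simp)
  exact (PrimrecPred.decide hf).to_comp

theorem Sg.bex_ball (m : ℕ) : ∀ {α : Type} [Primcodable α] {P : α × ℕ → Prop} {b : α → ℕ},
    Sg m P → Computable b →
    Sg m (fun a => ∃ j < b a, P (a, j)) ∧ Sg m (fun a => ∀ j < b a, P (a, j)) := by
  induction m with
  | zero =>
    intro α _ P b ⟨f, hf, h⟩ hb
    have hh : Computable₂ (fun (a : α) (p : ℕ × Bool) => f (a, p.1)) :=
      hf.comp (Computable.pair Computable.fst (Computable.fst.comp Computable.snd))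
    have hs : Computable₂ (fun (a : α) (p : ℕ × Bool) => p.2) := Computable.snd.comp Computable.snd
    constructor
    · refine ⟨fun a => Nat.rec (motive := fun _ => Bool) false (fun j r => f (a, j) || r) (b a), ?_, ?_⟩
      · exact Computable.nat_rec hb (Computable.const _) (Primrec.or.to_comp.comp hh hs).to₂
      · intro a
        simp only [h]
        generalize b a = k
        induction k with
        | zero => simp
        | succ k ih => rw [Nat.exists_lt_succ_right, ih]; simp [or_comm]
    · refine ⟨fun a => Nat.rec (motive := fun _ => Bool) true (fun j r => f (a, j) && r) (b a), ?_, ?_⟩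
      · exact Computable.nat_rec hb (Computable.const _) (Primrec.and.to_comp.comp hh hs).to₂
      · intro a
        simp only [h]
        generalize b a = k
        induction k with
        | zero => simp
        | succ k ih => rw [Nat.forall_lt_succ_right, ih]; simp [and_comm]
  | succ m ih =>
    intro α _ P b hP hb
    constructor
    · have h2 : Sg (m+1) (fun p : α × ℕ => p.2 < b p.1) := by
        refine (Sg.ofBool (f := fun p : α × ℕ => decide (p.2 < b p.1)) ?_ _).congr (by simp)
        exact (PrimrecPred.decide Primrec.nat_lt).to_comp.comp (Computable.pair Computable.snd (hb.comp Computable.fst))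
      exact (h2.and hP).exN
    · obtain ⟨Q, hQ, h⟩ := hP
      refine ⟨fun p : α × ℕ => ∃ j < b p.1, Q ((p.1, j), (dec (List ℕ) p.2).getD j 0),
        (ih (P := fun q : (α × ℕ) × ℕ => Q ((q.1.1, q.2), (dec (List ℕ) q.1.2).getD q.2 0)) ?_ (hb.comp Computable.fst)).1, ?_⟩
      · refine hQ.comp (Computable.pair (Computable.pair (Computable.fst.comp Computable.fst) Computable.snd) ?_)
        exact (Primrec.list_getD 0).to_comp.comp (dec_comp.comp (Computable.snd.comp Computable.fst)) Computable.snd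
      · intro a
        simp only [h]
        constructor
        · intro hh
          have : ∀ j, ∃ y, j < b a → ¬ Q ((a, j), y) := by
            intro j
            by_cases hj : j < b a
            · obtain ⟨y, hy⟩ := hh j hj; exact ⟨y, fun _ => hy⟩
            · exact ⟨0, fun h => absurd h hj⟩
          choose g hg using this
          refine ⟨Encodable.encode ((List.range (b a)).map g), ?_⟩
          simp only [dec_encode]
          push Not
          intro j hj
          simpa [List.getD_eq_getElem?_getD, hj] using hg j hj
        · rintro ⟨y, hy⟩ j hj
          push Not at hy
          exact ⟨_, hy j hj⟩

theorem Sg.bex {m : ℕ} {P : α × ℕ → Prop} {b : α → ℕ} (h : Sg m P) (hb : Computable b) :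
    Sg m (fun a => ∃ j < b a, P (a, j)) := (Sg.bex_ball m h hb).1
theorem Sg.ball {m : ℕ} {P : α × ℕ → Prop} {b : α → ℕ} (h : Sg m P) (hb : Computable b) :
    Sg m (fun a => ∀ j < b a, P (a, j)) := (Sg.bex_ball m h hb).2
end Calc
end ArithFC

namespace ArithFC
section Calc2
variable {α β γ δ : Type} [Primcodable α] [Primcodable β] [Primcodable γ] [Primcodable δ]

/-- Functions with graph of level `n+1`. -/
@[fun_prop]
def AA (n : ℕ) (f : α → β) : Prop := Sg (n+1) (fun p : α × β => f p.1 = p.2)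

/-- Predicates of level Delta `n+1`. -/
def DD (n : ℕ) (P : α → Prop) : Prop := Sg (n+1) P ∧ Sg (n+1) (fun a => ¬ P a)

theorem Sg.eqC {f g : α → β} (hf : Computable f) (hg : Computable g) (m : ℕ) :
    Sg m (fun a => f a = g a) := by
  refine (Sg.ofBool (f := fun a => decide (Encodable.encode (f a) = Encodable.encode (g a))) ?_ m).congr (by simp)
  exact (PrimrecPred.decide Primrec.eq).to_comp.comp (Computable.pair (Computable.encode.comp hf) (Computable.encode.comp hg))

variable {n : ℕ}

theorem DD.congr {P Q : α → Prop} (h : DD n P) (e : ∀ a, P a ↔ Q a) : DD n Q := by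
  have : P = Q := funext fun a => propext (e a)
  exact this ▸ h

theorem AA.congr {f g : α → β} (h : AA n f) (e : ∀ a, f a = g a) : AA n g := by
  have : f = g := funext e
  exact this ▸ h

theorem AA.ofC {f : α → β} (hf : Computable f) : AA n f :=
  Sg.eqC (hf.comp Computable.fst) Computable.snd _

theorem AA.ofP {f : α → β} (hf : Primrec f) : AA n f := AA.ofC hf.to_comp

@[fun_prop] theorem AA.id : AA n (fun a : α => a) := AA.ofC Computable.id
@[fun_prop] theorem AA.const (b : β) : AA n (fun a : α => b) := AA.ofC (Computable.const b)

theorem Sg.compA [Inhabited β] {P : β → Prop} {f : α → β} (h : Sg (n+1) P) (hf : AA n f) :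
    Sg (n+1) (fun a => P (f a)) := by
  have h1 : Sg (n+1) (fun p : α × β => f p.1 = p.2 ∧ P p.2) := Sg.and hf (h.comp Computable.snd)
  refine h1.ex.congr fun a => ?_
  simp

theorem DD.comp [Inhabited β] {P : β → Prop} {f : α → β} (h : DD n P) (hf : AA n f) :
    DD n (fun a => P (f a)) := ⟨h.1.compA hf, h.2.compA hf⟩

@[fun_prop] theorem AA.comp [Inhabited β] {g : β → γ} {f : α → β} (hg : AA n g) (hf : AA n f) :
    AA n (fun a => g (f a)) := by
  have h1 : AA n (fun p : α × γ => f p.1) := Sg.comp (P := fun p : α × β => f p.1 = p.2) hf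
    (Computable.pair (Computable.fst.comp Computable.fst) Computable.snd)
  have h2 : Sg (n+1) (fun p : (α × γ) × β => f p.1.1 = p.2 ∧ g p.2 = p.1.2) :=
    Sg.and h1 (Sg.comp (P := fun p : β × γ => g p.1 = p.2) hg
      (Computable.pair Computable.snd (Computable.snd.comp Computable.fst)))
  refine h2.ex.congr fun a => ?_
  simp

@[fun_prop] theorem AA.fst : AA n (fun p : α × β => p.1) := AA.ofC Computable.fst
@[fun_prop] theorem AA.snd : AA n (fun p : α × β => p.2) := AA.ofC Computable.snd

@[fun_prop] theorem AA.pair {f : α → β} {g : α → γ} (hf : AA n f) (hg : AA n g) :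
    AA n (fun a => (f a, g a)) := by
  refine (Sg.and (Sg.comp (P := fun p : α × β => f p.1 = p.2) (f := fun p : α × (β × γ) => (p.1, p.2.1)) hf ?_)
    (Sg.comp (P := fun p : α × γ => g p.1 = p.2) (f := fun p : α × (β × γ) => (p.1, p.2.2)) hg ?_)).congr fun p => ?_
  · exact Computable.pair Computable.fst (Computable.fst.comp Computable.snd)
  · exact Computable.pair Computable.fst (Computable.snd.comp Computable.snd)
  · simp [Prod.ext_iff]

@[fun_prop] theorem AA.fst' [Inhabited β] [Inhabited γ] {f : α → β × γ} (hf : AA n f) : AA n (fun a => (f a).1) := AA.fst.comp hf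
@[fun_prop] theorem AA.snd' [Inhabited β] [Inhabited γ] {f : α → β × γ} (hf : AA n f) : AA n (fun a => (f a).2) := AA.snd.comp hf

theorem AA.comp2 [Inhabited β] [Inhabited γ] {g : β → γ → δ} (hg : AA n (fun p : β × γ => g p.1 p.2))
    {f : α → β} {f' : α → γ} (hf : AA n f) (hf' : AA n f') : AA n (fun a => g (f a) (f' a)) :=
  hg.comp (hf.pair hf')

theorem DD.not {P : α → Prop} (h : DD n P) : DD n (fun a => ¬ P a) :=
  ⟨h.2, h.1.congr (by simp)⟩
theorem DD.and {P Q : α → Prop} (h : DD n P) (h' : DD n Q) : DD n (fun a => P a ∧ Q a) :=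
  ⟨h.1.and h'.1, (h.2.or h'.2).congr (fun a => by tauto)⟩
theorem DD.or {P Q : α → Prop} (h : DD n P) (h' : DD n Q) : DD n (fun a => P a ∨ Q a) :=
  ⟨h.1.or h'.1, (h.2.and h'.2).congr (fun a => by tauto)⟩
theorem DD.imp {P Q : α → Prop} (h : DD n P) (h' : DD n Q) : DD n (fun a => P a → Q a) :=
  (h.not.or h').congr (fun a => by tauto)
theorem DD.iff {P Q : α → Prop} (h : DD n P) (h' : DD n Q) : DD n (fun a => P a ↔ Q a) :=
  ((h.imp h').and (h'.imp h)).congr (fun a => by tauto)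

theorem DD.of_sg {m : ℕ} {P : α → Prop} (h : Sg m P) (hm : m ≤ n) : DD n P :=
  ⟨h.mono (by omega), h.lift_not' (by omega)⟩
theorem DD.of_nsg {m : ℕ} {P : α → Prop} (h : Sg m (fun a => ¬ P a)) (hm : m ≤ n) : DD n P :=
  (DD.of_sg h hm).not.congr (by simp)
theorem DD.of_sg0 {P : α → Prop} (h : Sg 0 P) : DD n P := DD.of_sg h (Nat.zero_le _)
theorem DD.const (p : Prop) : DD n (fun _ : α => p) := by
  by_cases hp : p
  · exact DD.of_sg0 ⟨fun _ => true, Computable.const _, by simp [hp]⟩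
  · exact DD.of_sg0 ⟨fun _ => false, Computable.const _, by simp [hp]⟩

theorem DD.eq [Inhabited β] {f g : α → β} (hf : AA n f) (hg : AA n g) : DD n (fun a => f a = g a) :=
  DD.comp (P := fun p : β × β => p.1 = p.2) (DD.of_sg0 (Sg.eqC Computable.fst Computable.snd _)) (hf.pair hg)
theorem DD.lt {f g : α → ℕ} (hf : AA n f) (hg : AA n g) : DD n (fun a => f a < g a) :=
  DD.comp (P := fun p : ℕ × ℕ => p.1 < p.2) (DD.of_sg0 (Sg.ofPrim Primrec.nat_lt _)) (hf.pair hg)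
theorem DD.le {f g : α → ℕ} (hf : AA n f) (hg : AA n g) : DD n (fun a => f a ≤ g a) :=
  DD.comp (P := fun p : ℕ × ℕ => p.1 ≤ p.2) (DD.of_sg0 (Sg.ofPrim Primrec.nat_le _)) (hf.pair hg)

theorem DD.ball [Inhabited α] {P : α × ℕ → Prop} {b : α → ℕ} (h : DD n P) (hb : AA n b) :
    DD n (fun a => ∀ j < b a, P (a, j)) := by
  have hc : Computable (fun q : (α × ℕ) × ℕ => (q.1.1, q.2)) :=
    Computable.pair (Computable.fst.comp Computable.fst) Computable.snd
  have h1 : DD n (fun q : α × ℕ => ∀ j < q.2, P (q.1, j)) := by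
    refine ⟨Sg.ball (P := fun q : (α × ℕ) × ℕ => P (q.1.1, q.2)) (h.1.comp hc) Computable.snd, ?_⟩
    refine (Sg.bex (P := fun q : (α × ℕ) × ℕ => ¬ P (q.1.1, q.2)) (h.2.comp hc) Computable.snd).congr ?_
    intro a; push Not; rfl
  exact h1.comp (AA.id.pair hb)

theorem DD.bex [Inhabited α] {P : α × ℕ → Prop} {b : α → ℕ} (h : DD n P) (hb : AA n b) :
    DD n (fun a => ∃ j < b a, P (a, j)) :=
  (h.not.ball hb).not.congr (by intro a; push Not; rfl)

open Classical in
theorem AA.ite {P : α → Prop} (hP : DD n P) {f g : α → β} (hf : AA n f) (hg : AA n g) :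
    AA n (fun a => if P a then f a else g a) := by
  refine (((hP.1.comp Computable.fst).and hf).or ((hP.2.comp Computable.fst).and hg)).congr fun p => ?_
  by_cases h : P p.1 <;> simp [h]

theorem AA.searchN [Inhabited α] {Q : α × ℕ → Prop} (hQ : DD n Q) (h : ∀ a, ∃ y, Q (a, y)) :
    ∃ f : α → ℕ, AA n f ∧ ∀ a, Q (a, f a) := by
  classical
  refine ⟨fun a => Nat.find (h a), ?_, fun a => Nat.find_spec (h a)⟩
  have h1 : DD n (fun p : α × ℕ => Q p ∧ ∀ z < p.2, ¬ Q (p.1, z)) :=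
    hQ.and (DD.ball (P := fun q : (α × ℕ) × ℕ => ¬ Q (q.1.1, q.2)) (hQ.not.comp (by fun_prop)) AA.snd)
  refine h1.1.congr fun p => ?_
  rw [Nat.find_eq_iff]

@[fun_prop] theorem AA.dec [Inhabited β] : AA n (ArithFC.dec β) := AA.ofC dec_comp
@[fun_prop] theorem AA.encode : AA n (Encodable.encode : β → ℕ) := AA.ofC Computable.encode

theorem AA.search [Inhabited α] [Inhabited β] {P : α → Prop} (hP : DD n P) {Q : α × β → Prop} (hQ : DD n Q) (h : ∀ a, P a → ∃ y, Q (a, y)) :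
    ∃ f : α → β, AA n f ∧ ∀ a, P a → Q (a, f a) := by
  obtain ⟨f, hf, hf'⟩ := AA.searchN (Q := fun p : α × ℕ => P p.1 → Q (p.1, ArithFC.dec β p.2))
    ((hP.comp (by fun_prop)).imp (hQ.comp (by fun_prop))) (by
      intro a
      by_cases ha : P a
      · obtain ⟨y, hy⟩ := h a ha
        exact ⟨Encodable.encode y, fun _ => by simpa [dec_encode] using hy⟩
      · exact ⟨0, fun h => absurd h ha⟩)
  exact ⟨fun a => ArithFC.dec β (f a), by fun_prop, hf'⟩

theorem AA.searchT [Inhabited α] [Inhabited β] {Q : α × β → Prop} (hQ : DD n Q) (h : ∀ a, ∃ y, Q (a, y)) :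
    ∃ f : α → β, AA n f ∧ ∀ a, Q (a, f a) := by
  obtain ⟨f, hf, h'⟩ := AA.search (DD.const True) hQ (fun a _ => h a)
  exact ⟨f, hf, fun a => h' a trivial⟩

@[fun_prop] theorem AA.getD [Inhabited α] [Inhabited β] {f : α → List β} {g : α → ℕ} (d : β) (hf : AA n f) (hg : AA n g) :
    AA n (fun a => (f a).getD (g a) d) :=
  AA.comp (g := fun p : List β × ℕ => p.1.getD p.2 d) (AA.ofP (Primrec.list_getD d)) (hf.pair hg)
@[fun_prop] theorem AA.add {f g : α → ℕ} (hf : AA n f) (hg : AA n g) :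
    AA n (fun a => f a + g a) :=
  AA.comp (g := fun p : ℕ × ℕ => p.1 + p.2) (AA.ofP Primrec.nat_add) (hf.pair hg)
@[fun_prop] theorem AA.mul {f g : α → ℕ} (hf : AA n f) (hg : AA n g) :
    AA n (fun a => f a * g a) :=
  AA.comp (g := fun p : ℕ × ℕ => p.1 * p.2) (AA.ofP Primrec.nat_mul) (hf.pair hg)
@[fun_prop] theorem AA.sub {f g : α → ℕ} (hf : AA n f) (hg : AA n g) :
    AA n (fun a => f a - g a) :=
  AA.comp (g := fun p : ℕ × ℕ => p.1 - p.2) (AA.ofP Primrec.nat_sub) (hf.pair hg)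
@[fun_prop] theorem AA.div {f g : α → ℕ} (hf : AA n f) (hg : AA n g) :
    AA n (fun a => f a / g a) :=
  AA.comp (g := fun p : ℕ × ℕ => p.1 / p.2) (AA.ofP Primrec.nat_div) (hf.pair hg)
@[fun_prop] theorem AA.mod {f g : α → ℕ} (hf : AA n f) (hg : AA n g) :
    AA n (fun a => f a % g a) :=
  AA.comp (g := fun p : ℕ × ℕ => p.1 % p.2) (AA.ofP Primrec.nat_mod) (hf.pair hg)
@[fun_prop] theorem AA.npair {f g : α → ℕ} (hf : AA n f) (hg : AA n g) :
    AA n (fun a => Nat.pair (f a) (g a)) :=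
  AA.comp (g := fun p : ℕ × ℕ => Nat.pair p.1 p.2) (AA.ofP Primrec₂.natPair) (hf.pair hg)
@[fun_prop] theorem AA.unpair {f : α → ℕ} (hf : AA n f) :
    AA n (fun a => Nat.unpair (f a)) := AA.comp (AA.ofP Primrec.unpair) hf
@[fun_prop] theorem AA.length {f : α → List β} (hf : AA n f) :
    AA n (fun a => (f a).length) := AA.comp (AA.ofP Primrec.list_length) hf
@[fun_prop] theorem AA.range {f : α → ℕ} (hf : AA n f) :
    AA n (fun a => List.range (f a)) := AA.comp (AA.ofP Primrec.list_range) hf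

theorem DD.ball_list [Inhabited α] [Inhabited β] {P : α × β → Prop} {l : α → List β} (h : DD n P) (hl : AA n l) :
    DD n (fun a => ∀ t ∈ l a, P (a, t)) := by
  refine (DD.ball (P := fun q : α × ℕ => P (q.1, (l q.1).getD q.2 default)) (b := fun a => (l a).length)
    (h.comp (by fun_prop)) (by fun_prop)).congr fun a => ?_
  rw [List.forall_mem_iff_getElem]
  refine forall₂_congr fun j hj => ?_
  simp [List.getD_eq_getElem?_getD, hj]
theorem DD.bex_list [Inhabited α] [Inhabited β] {P : α × β → Prop} {l : α → List β} (h : DD n P) (hl : AA n l) :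
    DD n (fun a => ∃ t ∈ l a, P (a, t)) :=
  (h.not.ball_list hl).not.congr (by intro a; push Not; rfl)

theorem AA.nat_rec [Inhabited α] [Inhabited β] {f : α → ℕ} {g : α → β} {h : α × ℕ × β → β}
    (hf : AA n f) (hg : AA n g) (hh : AA n h) :
    AA n (fun a => Nat.rec (motive := fun _ => β) (g a) (fun i r => h (a, i, r)) (f a)) := by
  obtain ⟨F, hF, hF'⟩ := AA.searchT (n := n) (α := α) (β := List β)
    (Q := fun p => p.2.getD 0 default = g p.1 ∧ ∀ i < f p.1, p.2.getD (i+1) default = h (p.1, i, p.2.getD i default))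
    ((DD.eq (by fun_prop) (by fun_prop)).and (DD.ball (P := fun q : (α × List β) × ℕ => q.1.2.getD (q.2+1) default = h (q.1.1, q.2, q.1.2.getD q.2 default))
      (DD.eq (by fun_prop) (by fun_prop)) (by fun_prop))) (by
    intro a
    refine ⟨(List.range (f a + 1)).map (fun k => Nat.rec (motive := fun _ => β) (g a) (fun i r => h (a, i, r)) k), ?_, ?_⟩
    · simp [List.getD_eq_getElem?_getD]
    · intro i hi
      replace hi : i < f a := hi
      simp [List.getD_eq_getElem?_getD, hi, show i < f a + 1 by omega])
  refine AA.congr (f := fun a => (F a).getD (f a) default) (by fun_prop) fun a => ?_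
  obtain ⟨h0, h1⟩ := hF' a
  replace h1 : ∀ i < f a, (F a).getD (i+1) default = h (a, i, (F a).getD i default) := h1
  have : ∀ k ≤ f a, (F a).getD k default = Nat.rec (motive := fun _ => β) (g a) (fun i r => h (a, i, r)) k := by
    intro k
    induction k with
    | zero => intro _; exact h0
    | succ k ih => intro hk; rw [h1 k (by omega), ih (by omega)]
  exact this _ le_rfl

/-- counting -/
noncomputable def cnt (P : ℕ → Prop) (b : ℕ) : ℕ := by
  classical exact ((Finset.range b).filter P).card

open Classical in
theorem cnt_rec (P : ℕ → Prop) (b : ℕ) : cnt P b = Nat.rec (motive := fun _ => ℕ) 0 (fun i r => r + if P i then 1 else 0) b := by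
  induction b with
  | zero => simp [cnt]
  | succ b ih =>
    simp only [← ih]
    unfold cnt
    rw [Finset.range_add_one, Finset.filter_insert]
    split_ifs with h
    · rw [Finset.card_insert_of_notMem (by simp)]
    · rfl

theorem AA.cnt [Inhabited α] {P : α × ℕ → Prop} (hP : DD n P) {b : α → ℕ} (hb : AA n b) :
    AA n (fun a => cnt (fun j => P (a, j)) (b a)) := by
  classical
  refine AA.congr (AA.nat_rec (g := fun a : α => (0:ℕ)) (h := fun p : α × ℕ × ℕ => p.2.2 + if P (p.1, p.2.1) then 1 else 0) hb (AA.const 0) ?_) (fun a => (cnt_rec (fun j => P (a, j)) _).symm)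
  exact AA.add (by fun_prop) (AA.ite (hP.comp (by fun_prop)) (AA.const _) (AA.const _))

theorem AA.pow {f g : α → ℕ} [Inhabited α] (hf : AA n f) (hg : AA n g) : AA n (fun a => f a ^ g a) := by
  refine AA.congr (AA.nat_rec (f := g) (g := fun a => 1) (h := fun p : α × ℕ × ℕ => p.2.2 * f p.1) hg (by fun_prop) (by fun_prop)) fun a => ?_
  induction g a with
  | zero => simp
  | succ k ih => simp [ih, pow_succ]
attribute [fun_prop] AA.pow

end Calc2
end ArithFC

namespace ArithFC
section Univ
variable {α β : Type} [Primcodable α] [Primcodable β]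
open Nat.Partrec (Code)

/-- Universal predicates: `Un m` is universal of level `m+1`. -/
def Un : ℕ → ℕ → ℕ → Prop
  | 0, e, x => ∃ k, ((dec Code e).evaln k x).isSome
  | m + 1, e, x => ∃ y, ¬ Un m e (Nat.pair x y)

theorem Sg.un (m : ℕ) : Sg (m+1) (fun p : ℕ × ℕ => Un m p.1 p.2) := by
  induction m with
  | zero =>
    refine Sg.exN (P := fun p : (ℕ × ℕ) × ℕ => ((dec Code p.1.1).evaln p.2 p.1.2).isSome) ?_
    refine Sg.ofBool ?_ _
    refine Primrec.option_isSome.to_comp.comp ?_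
    refine Code.primrec_evaln.to_comp.comp (Computable.pair (Computable.pair Computable.snd ?_) ?_)
    · exact dec_comp.comp (Computable.fst.comp Computable.fst)
    · exact (Computable.snd.comp Computable.fst)
  | succ m ih =>
    refine ⟨fun p => Un m p.1.1 (Nat.pair p.1.2 p.2), ih.comp (f := fun p : (ℕ × ℕ) × ℕ => (p.1.1, Nat.pair p.1.2 p.2)) ?_, fun a => Iff.rfl⟩
    refine Computable.pair (Computable.fst.comp Computable.fst) ?_
    exact Primrec₂.natPair.to_comp.comp (Computable.snd.comp Computable.fst) Computable.snd

theorem Sg.exists_un (m : ℕ) : ∀ {P : ℕ → Prop}, Sg (m+1) P → ∃ e, ∀ x, P x ↔ Un m e x := by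
  induction m with
  | zero =>
    rintro P ⟨Q, ⟨f, hf, h⟩, h'⟩
    have h1 : Partrec (fun x : ℕ => Nat.rfind (fun y => Part.some (!f (x, y)))) := by
      refine Partrec.rfind (p := fun x y => Part.some (!f (x, y))) ?_
      exact (Primrec.not.to_comp.comp hf).partrec
    obtain ⟨c, hc⟩ := Code.exists_code.1 (Partrec.nat_iff.1 h1)
    refine ⟨Encodable.encode c, fun x => ?_⟩
    have h2 : P x ↔ (c.eval x).Dom := by
      rw [hc, h']
      simp only [Nat.rfind_dom', h]
      constructor
      · rintro ⟨y, hy⟩; exact ⟨y, by simpa using hy, fun _ _ => trivial⟩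
      · rintro ⟨y, hy, _⟩; exact ⟨y, by simpa using hy⟩
    rw [h2, Part.dom_iff_mem]
    simp only [Un, dec_encode, Option.isSome_iff_exists, Code.evaln_complete]
    exact ⟨fun ⟨y, k, hk⟩ => ⟨k, y, hk⟩, fun ⟨k, y, hk⟩ => ⟨y, k, hk⟩⟩
  | succ m ih =>
    rintro P ⟨Q, hQ, h⟩
    obtain ⟨e, he⟩ := ih (P := fun z => Q (z.unpair.1, z.unpair.2)) (hQ.comp Computable.unpair)
    refine ⟨e, fun x => ?_⟩
    simp only [h, Un, ← he]
    simp

theorem Sg.countable (m : ℕ) [Inhabited α] : {P : α → Prop | Sg (m+1) P}.Countable := by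
  refine (Set.countable_range (fun e : ℕ => fun a : α => Un m e (Encodable.encode a))).mono ?_
  intro P hP
  obtain ⟨e, he⟩ := Sg.exists_un m (P := fun k => P (dec α k)) (hP.comp dec_comp)
  exact ⟨e, funext fun a => propext (by show Un m e _ ↔ _; rw [← he]; simp [dec_encode])⟩

theorem DD.countable (n : ℕ) [Inhabited α] : {P : α → Prop | DD n P}.Countable :=
  (Sg.countable n).mono fun P hP => hP.1

theorem AA.countable (n : ℕ) [Inhabited α] [Inhabited β] : {f : α → β | AA n f}.Countable := by
  refine Set.MapsTo.countable_of_injOn (f := fun (f : α → β) (p : α × β) => f p.1 = p.2) (t := {P | Sg (n+1) P}) ?_ ?_ (Sg.countable n)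
  · intro f hf; exact hf
  · intro f _ g _ h
    funext a
    have := congrFun h (a, f a)
    simpa [eq_comm] using this
end Univ
end ArithFC

namespace ArithFC
section Model

/-- function interpretation over the naturals -/
def funN : ∀ k, Func k → (Fin k → ℕ) → ℕ
  | _, Func.zero, _ => 0
  | _, Func.one, _ => 1
  | _, Func.add, v => v 0 + v 1
  | _, Func.mul, v => v 0 * v 1
/-- relation interpretation over the naturals -/
def relN : ∀ k, Rel k → (Fin k → ℕ) → Prop
  | _, Rel.lt, v => v 0 < v 1

/-- The standard model. -/
@[reducible] def strN : lang.Structure ℕ where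
  funMap {k} f v := funN k f v
  RelMap {k} r v := relN k r v

/-- Term evaluation in the standard model. -/
def tev {B : Type} (v : B → ℕ) (t : lang.Term B) : ℕ := @Term.realize lang ℕ strN B v t
/-- Truth in the standard model. -/
def FN {A : Type} {k : ℕ} (φ : lang.BoundedFormula A k) (v : A → ℕ) (xs : Fin k → ℕ) : Prop :=
  @BoundedFormula.Realize lang ℕ strN A k φ v xs
theorem FN_imp {A : Type} {k : ℕ} (φ ψ : lang.BoundedFormula A k) (v : A → ℕ) (xs : Fin k → ℕ) :
    FN (φ.imp ψ) v xs ↔ (FN φ v xs → FN ψ v xs) := Iff.rfl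
theorem FN_all {A : Type} {k : ℕ} (φ : lang.BoundedFormula A (k+1)) (v : A → ℕ) (xs : Fin k → ℕ) :
    FN (φ.all) v xs ↔ ∀ y : ℕ, FN φ v (Fin.snoc (α := fun _ => ℕ) xs y) := Iff.rfl
theorem FN_ex {A : Type} {k : ℕ} (φ : lang.BoundedFormula A (k+1)) (v : A → ℕ) (xs : Fin k → ℕ) :
    FN (φ.ex) v xs ↔ ∃ y : ℕ, FN φ v (Fin.snoc (α := fun _ => ℕ) xs y) := @BoundedFormula.realize_ex lang ℕ strN _ _ _ _ _

/-- The ultrafilter. -/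
noncomputable abbrev UF : Filter ℕ := (Filter.hyperfilter ℕ : Filter ℕ)

/-- Families of sequences closed under `AA n`. -/
structure Mod (n : ℕ) where
  make ::
  S : Set (ℕ → ℕ)
  pair : ∀ {x y}, x ∈ S → y ∈ S → (fun i => Nat.pair (x i) (y i)) ∈ S
  app : ∀ {f : ℕ → ℕ} {x}, AA n f → x ∈ S → (fun i => f (x i)) ∈ S
  id : (fun i => i) ∈ S

variable {n : ℕ}

/-- membership for sequences of arbitrary type -/
def Mod.SS (S : Mod n) {β : Type} [Primcodable β] (x : ℕ → β) : Prop := (fun i => Encodable.encode (x i)) ∈ S.S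

variable {α β γ : Type} [Primcodable α] [Primcodable β] [Primcodable γ]

theorem Mod.SS.iff {S : Mod n} {x : ℕ → ℕ} : S.SS x ↔ x ∈ S.S := Iff.rfl

theorem Mod.SS.app [Inhabited α] {S : Mod n} {x : ℕ → α} (hx : S.SS x) {f : α → β} (hf : AA n f) :
    S.SS (fun i => f (x i)) := by
  have h1 : AA n (fun k : ℕ => Encodable.encode (f (dec α k))) := AA.comp (g := fun a : α => Encodable.encode (f a)) (by
    have : AA n (Encodable.encode : β → ℕ) := AA.encode
    refine Sg.congr (P := fun p : α × ℕ => ∃ k : ℕ, True ∧ Encodable.encode (f p.1) = p.2) ?_ (by simp)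
    refine Sg.exN (P := fun p : (α × ℕ) × ℕ => True ∧ Encodable.encode (f p.1.1) = p.1.2) ?_
    by_cases hβ : Nonempty β
    · have : Inhabited β := ⟨hβ.some⟩
      have h := AA.comp (AA.encode (n := n)) hf
      exact (Sg.comp (P := fun p : α × ℕ => Encodable.encode (f p.1) = p.2) h Computable.fst).congr (by simp)
    · exact absurd ⟨f default⟩ hβ) AA.dec
  have := S.app h1 hx
  simpa [dec_encode, Mod.SS] using this

theorem Mod.SS.pair {S : Mod n} {x : ℕ → α} {y : ℕ → β} (hx : S.SS x) (hy : S.SS y) :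
    S.SS (fun i => (x i, y i)) := S.pair hx hy

theorem Mod.SS.cid {S : Mod n} : S.SS (fun i => i) := S.id
theorem Mod.SS.const {S : Mod n} (b : β) : S.SS (fun _ => b) :=
  Mod.SS.cid.app (AA.const b)

theorem Mod.search [Inhabited α] [Inhabited β] (S : Mod n) {P : α → Prop} (hP : DD n P) {Q : α × β → Prop}
    (hQ : DD n Q) (h : ∀ a, P a → ∃ y, Q (a, y)) {a : ℕ → α} (ha : S.SS a) (hPa : ∀ᶠ i in UF, P (a i)) :
    ∃ y : ℕ → β, S.SS y ∧ ∀ᶠ i in UF, Q (a i, y i) := by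
  obtain ⟨f, hf, hf'⟩ := AA.search hP hQ h
  exact ⟨_, ha.app hf, hPa.mono fun i hi => hf' _ hi⟩

theorem Mod.search' [Inhabited α] [Inhabited β] (S : Mod n) {Q : α × β → Prop}
    (hQ : DD n Q) (h : ∀ a, ∃ y, Q (a, y)) {a : ℕ → α} (ha : S.SS a) :
    ∃ y : ℕ → β, S.SS y ∧ ∀ i, Q (a i, y i) := by
  obtain ⟨f, hf, hf'⟩ := AA.searchT hQ h
  exact ⟨_, ha.app hf, fun i => hf' _⟩

/-- the setoid of a.e. equality -/
def Mod.setoid (S : Mod n) : Setoid S.S where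
  r x y := ∀ᶠ i in UF, x.1 i = y.1 i
  iseqv := ⟨fun x => Filter.Eventually.of_forall fun _ => rfl, fun h => h.mono fun _ h => h.symm,
    fun h h' => (h.and h').mono fun _ h => h.1.trans h.2⟩

/-- The model. -/
def MM (S : Mod n) : Type := Quotient S.setoid

open Classical in
/-- The class of a sequence. -/
noncomputable def Mod.mk (S : Mod n) (x : ℕ → ℕ) : MM S :=
  if h : x ∈ S.S then Quotient.mk S.setoid ⟨x, h⟩ else Quotient.mk S.setoid ⟨_, S.id⟩

theorem Mod.mk_pos (S : Mod n) {x : ℕ → ℕ} (h : x ∈ S.S) : S.mk x = (Quotient.mk S.setoid ⟨x, h⟩ : Quotient S.setoid) := dif_pos h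

/-- A representative. -/
noncomputable def Mod.rep (S : Mod n) (x : MM S) : ℕ → ℕ := (Quotient.out (s := S.setoid) x).1

theorem Mod.rep_mem (S : Mod n) (x : MM S) : S.SS (S.rep x) := (Quotient.out (s := S.setoid) x).2

theorem Mod.mk_rep (S : Mod n) (x : MM S) : S.mk (S.rep x) = x := by
  have := S.rep_mem x
  have h2 : S.rep x ∈ S.S := this
  rw [S.mk_pos h2]
  exact Quotient.out_eq (s := S.setoid) x

theorem Mod.mk_eq (S : Mod n) {x y : ℕ → ℕ} (hx : S.SS x) (hy : S.SS y) :
    S.mk x = S.mk y ↔ ∀ᶠ i in UF, x i = y i := by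
  have hx : x ∈ S.S := hx
  have hy : y ∈ S.S := hy
  rw [S.mk_pos hx, S.mk_pos hy]
  exact Quotient.eq (r := S.setoid)

theorem Mod.rep_mk (S : Mod n) {x : ℕ → ℕ} (hx : S.SS x) : ∀ᶠ i in UF, S.rep (S.mk x) i = x i :=
  (S.mk_eq (S.rep_mem _) hx).1 (S.mk_rep _)

theorem Mod.exists_rep (S : Mod n) (x : MM S) : ∃ y, S.SS y ∧ x = S.mk y := ⟨_, S.rep_mem x, (S.mk_rep x).symm⟩

noncomputable instance (S : Mod n) : lang.Structure (MM S) where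
  funMap {k} f v := S.mk (fun i => funN k f (fun j => S.rep (v j) i))
  RelMap {k} r v := ∀ᶠ i in UF, relN k r (fun j => S.rep (v j) i)

theorem Mod.funN_mem (S : Mod n) {k : ℕ} (f : Func k) {x : Fin k → ℕ → ℕ} (hx : ∀ j, S.SS (x j)) :
    S.SS (fun i => funN k f (fun j => x j i)) := by
  cases f with
  | zero => exact Mod.SS.const 0
  | one => exact Mod.SS.const 1
  | add => exact ((hx 0).pair (hx 1)).app (f := fun p : ℕ × ℕ => p.1 + p.2) (by fun_prop)
  | mul => exact ((hx 0).pair (hx 1)).app (f := fun p : ℕ × ℕ => p.1 * p.2) (by fun_prop)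

theorem Mod.ev_rep (S : Mod n) {k : ℕ} {x : Fin k → ℕ → ℕ} (hx : ∀ j, S.SS (x j)) :
    ∀ᶠ i in UF, (fun j => S.rep (S.mk (x j)) i) = (fun j => x j i) := by
  have : ∀ᶠ i in UF, ∀ j, S.rep (S.mk (x j)) i = x j i :=
    Filter.eventually_all.2 fun j => S.rep_mk (hx j)
  exact this.mono fun i hi => funext hi

theorem Mod.funMap_mk (S : Mod n) {k : ℕ} (f : Func k) {x : Fin k → ℕ → ℕ} (hx : ∀ j, S.SS (x j)) :
    Structure.funMap (L := lang) (M := MM S) f (fun j => S.mk (x j)) = S.mk (fun i => funN k f (fun j => x j i)) := by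
  refine (S.mk_eq (S.funN_mem f fun j => S.rep_mem _) (S.funN_mem f hx)).2 ?_
  filter_upwards [S.ev_rep hx] with i hi
  rw [hi]

theorem Mod.relMap_mk (S : Mod n) {k : ℕ} (f : Rel k) {x : Fin k → ℕ → ℕ} (hx : ∀ j, S.SS (x j)) :
    Structure.RelMap (L := lang) (M := MM S) f (fun j => S.mk (x j)) ↔ ∀ᶠ i in UF, relN k f (fun j => x j i) := by
  refine Filter.eventually_congr ?_
  filter_upwards [S.ev_rep hx] with i hi
  rw [hi]

theorem Mod.mk_add (S : Mod n) {x y : ℕ → ℕ} (hx : S.SS x) (hy : S.SS y) : S.mk x + S.mk y = S.mk (fun i => x i + y i) := by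
  have := S.funMap_mk Func.add (x := ![x, y]) (by intro j; fin_cases j <;> assumption)
  refine Eq.trans ?_ this
  show Structure.funMap (L := lang) (M := MM S) Func.add ![S.mk x, S.mk y] = _
  congr 1; funext j; fin_cases j <;> rfl
theorem Mod.mk_mul (S : Mod n) {x y : ℕ → ℕ} (hx : S.SS x) (hy : S.SS y) : S.mk x * S.mk y = S.mk (fun i => x i * y i) := by
  have := S.funMap_mk Func.mul (x := ![x, y]) (by intro j; fin_cases j <;> assumption)
  refine Eq.trans ?_ this
  show Structure.funMap (L := lang) (M := MM S) Func.mul ![S.mk x, S.mk y] = _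
  congr 1; funext j; fin_cases j <;> rfl
theorem Mod.mk_lt (S : Mod n) {x y : ℕ → ℕ} (hx : S.SS x) (hy : S.SS y) : S.mk x < S.mk y ↔ ∀ᶠ i in UF, x i < y i := by
  have := S.relMap_mk Rel.lt (x := ![x, y]) (by intro j; fin_cases j <;> assumption)
  refine Iff.trans (Eq.to_iff ?_) this
  show Structure.RelMap (L := lang) (M := MM S) Rel.lt ![S.mk x, S.mk y] = _
  congr 1; funext j; fin_cases j <;> rfl
theorem Mod.mk_le (S : Mod n) {x y : ℕ → ℕ} (hx : S.SS x) (hy : S.SS y) : S.mk x ≤ S.mk y ↔ ∀ᶠ i in UF, x i ≤ y i := by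
  show S.mk x < S.mk y ∨ S.mk x = S.mk y ↔ _
  rw [S.mk_lt hx hy, S.mk_eq hx hy, ← Ultrafilter.eventually_or]
  exact Filter.eventually_congr (Filter.Eventually.of_forall fun i => le_iff_lt_or_eq.symm)
theorem Mod.mk_zero (S : Mod n) : (0 : MM S) = S.mk (fun _ => 0) := rfl
theorem Mod.mk_one (S : Mod n) : (1 : MM S) = S.mk (fun _ => 1) := rfl

section L1
variable {A : Type}

theorem realN_computable {k : ℕ} (t : lang.Term (A ⊕ Fin k)) (pv : A → γ → ℕ) (px : Fin k → γ → ℕ)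
    (hv : ∀ a, Computable (pv a)) (hx : ∀ j, Computable (px j)) :
    Computable (fun g => tev (Sum.elim (fun a => pv a g) (fun j => px j g)) t) := by
  induction t with
  | var a => cases a with
    | inl a => exact hv a
    | inr j => exact hx j
  | func f ts ih =>
    change Computable fun g => funN _ f (fun j => tev (Sum.elim (fun a => pv a g) (fun j => px j g)) (ts j))
    cases f with
    | zero => exact Computable.const 0
    | one => exact Computable.const 1
    | add => exact Primrec.nat_add.to_comp.comp (ih 0) (ih 1)
    | mul => exact Primrec.nat_mul.to_comp.comp (ih 0) (ih 1)

/-- extended projections -/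
def exv (pv : A → γ → ℕ) : A → γ × ℕ → ℕ := fun a g => pv a g.1
/-- extended projections -/
def exx {k : ℕ} (px : Fin k → γ → ℕ) : Fin (k+1) → γ × ℕ → ℕ := Fin.snoc (α := fun _ => γ × ℕ → ℕ) (fun j g => px j g.1) (fun g => g.2)

theorem exv_c {pv : A → γ → ℕ} (hv : ∀ a, Computable (pv a)) : ∀ a, Computable (exv pv a) :=
  fun a => (hv a).comp Computable.fst
theorem exx_c {k : ℕ} {px : Fin k → γ → ℕ} (hx : ∀ a, Computable (px a)) : ∀ a, Computable (exx px a) := by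
  intro j
  refine Fin.lastCases ?_ (fun j => ?_) j
  · simp only [exx, Fin.snoc_last]; exact Computable.snd
  · simp only [exx, Fin.snoc_castSucc]; exact (hx j).comp Computable.fst
theorem exx_eq {k : ℕ} (px : Fin k → γ → ℕ) (g : γ) (y : ℕ) :
    (fun j => exx px j (g, y)) = Fin.snoc (α := fun _ => ℕ) (fun j => px j g) y := by
  funext j
  refine Fin.lastCases ?_ (fun j => ?_) j
  · simp [exx]
  · simp [exx]

theorem bd_realize {M : Type} [lang.Structure M] {k : ℕ} (t : lang.Term (A ⊕ Fin k)) (φ : lang.BoundedFormula A (k+1)) (v : A → M) (xs : Fin k → M) :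
    (BoundedFormula.all ((ltFm (Term.var (Sum.inr (Fin.last k))) (t.liftAt 1 k)).imp φ)).Realize v xs ↔
      ∀ y : M, y < t.realize (Sum.elim v xs) → φ.Realize v (Fin.snoc xs y) := by
  simp only [BoundedFormula.realize_all, BoundedFormula.realize_imp]
  refine forall_congr' fun y => imp_congr ?_ Iff.rfl
  refine Eq.to_iff ?_
  show Structure.RelMap (L := lang) Rel.lt (fun i => ((![Term.var (Sum.inr (Fin.last k)), t.liftAt 1 k] : Fin 2 → lang.Term (A ⊕ Fin (k+1))) i).realize (Sum.elim v (Fin.snoc xs y))) = Structure.RelMap (L := lang) Rel.lt ![y, t.realize (Sum.elim v xs)]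
  congr 1
  funext j
  fin_cases j
  · simp
  · simp only [Term.liftAt, Matrix.cons_val_one, Matrix.cons_val_zero, Term.realize_relabel, Fin.mk_one]
    congr 1
    funext a
    cases a with
    | inl a => rfl
    | inr j => simp [Fin.snoc, Fin.castLT]

theorem FN_bd {k : ℕ} (t : lang.Term (A ⊕ Fin k)) (φ : lang.BoundedFormula A (k+1)) (v : A → ℕ) (xs : Fin k → ℕ) :
    FN (BoundedFormula.all ((ltFm (Term.var (Sum.inr (Fin.last k))) (t.liftAt 1 k)).imp φ)) v xs ↔
      ∀ y : ℕ, y < tev (Sum.elim v xs) t → FN φ v (Fin.snoc (α := fun _ => ℕ) xs y) :=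
  @bd_realize A ℕ strN k t φ v xs

/-- abbreviation for truth in the standard model -/
def TN {k : ℕ} (φ : lang.BoundedFormula A k) (pv : A → γ → ℕ) (px : Fin k → γ → ℕ) (g : γ) : Prop :=
  FN φ (fun a => pv a g) (fun j => px j g)

theorem L1_delta0 {k : ℕ} {φ : lang.BoundedFormula A k} (h : IsDelta0 k φ) :
    ∀ {γ : Type} [Primcodable γ] {pv : A → γ → ℕ} {px : Fin k → γ → ℕ}, (∀ a, Computable (pv a)) →
      (∀ j, Computable (px j)) → Sg 0 (TN φ pv px) := by
  induction h with
  | falsum k => intro γ _ pv px hv hx; exact ⟨fun _ => false, Computable.const _, fun a => by simp [TN, FN, BoundedFormula.Realize]⟩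
  | equal k t u =>
    intro γ _ pv px hv hx
    exact Sg.eqC (realN_computable t pv px hv hx) (realN_computable u pv px hv hx) 0
  | rel k l R ts =>
    intro γ _ pv px hv hx
    cases R
    refine (Sg.ofPrim Primrec.nat_lt 0).comp (f := fun g : γ => (tev (Sum.elim (fun a => pv a g) (fun j => px j g)) (ts 0), tev (Sum.elim (fun a => pv a g) (fun j => px j g)) (ts 1))) ?_
    exact Computable.pair (realN_computable _ pv px hv hx) (realN_computable _ pv px hv hx)
  | imp k h1 h2 ih1 ih2 =>
    intro γ _ pv px hv hx
    refine ((ih1 hv hx).not0.or (ih2 hv hx)).congr fun a => ?_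
    simp only [TN, FN_imp]; tauto
  | bdAll k t h ih =>
    intro γ _ pv px hv hx
    refine (Sg.ball (ih (exv_c hv) (exx_c hx)) (realN_computable t pv px hv hx)).congr fun a => ?_
    simp only [TN, FN_bd, exx_eq]
    rfl
mutual
theorem L1_S {k m : ℕ} {φ : lang.BoundedFormula A k} : SigmaFm m k φ →
    ∀ {γ : Type} [Primcodable γ] {pv : A → γ → ℕ} {px : Fin k → γ → ℕ}, (∀ a, Computable (pv a)) →
      (∀ j, Computable (px j)) → Sg m (TN φ pv px)
  | .delta0 m k h, _, _, _, _, hv, hx => (L1_delta0 h hv hx).mono (Nat.zero_le _)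
  | .ofPi m k h, _, _, _, _, hv, hx => ((L1_P h hv hx).lift_not).congr (by simp)
  | .ex m k h, _, _, _, _, hv, hx => (Sg.exN (L1_S h (exv_c hv) (exx_c hx))).congr fun a => by
      simp only [TN, FN_ex, exx_eq]; rfl
theorem L1_P {k m : ℕ} {φ : lang.BoundedFormula A k} : PiFm m k φ →
    ∀ {γ : Type} [Primcodable γ] {pv : A → γ → ℕ} {px : Fin k → γ → ℕ}, (∀ a, Computable (pv a)) →
      (∀ j, Computable (px j)) → Sg m (fun g => ¬ TN φ pv px g)
  | .delta0 m k h, _, _, _, _, hv, hx => ((L1_delta0 h hv hx).not0).mono (Nat.zero_le _)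
  | .ofSigma m k h, _, _, _, _, hv, hx => ((L1_S h hv hx).lift_not)
  | .all m k h, _, _, _, _, hv, hx => (Sg.exN (L1_P h (exv_c hv) (exx_c hx))).congr fun a => by
      simp only [TN, FN_all, exx_eq, not_forall]; rfl
end
end L1

section Los
variable {A : Type} (S : Mod n)

/-- truth in the ultrapower-like model -/
def TM {k : ℕ} (φ : lang.BoundedFormula A k) (pv : A → γ → ℕ) (px : Fin k → γ → ℕ) (g : ℕ → γ) : Prop :=
  φ.Realize (M := MM S) (fun a => S.mk (fun i => pv a (g i))) (fun j => S.mk (fun i => px j (g i)))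

variable {S}
theorem real_mk [Inhabited γ] {k : ℕ} (t : lang.Term (A ⊕ Fin k)) {pv : A → γ → ℕ} {px : Fin k → γ → ℕ}
    (hv : ∀ a, Computable (pv a)) (hx : ∀ j, Computable (px j)) {g : ℕ → γ} (hg : S.SS g) :
    t.realize (M := MM S) (Sum.elim (fun a => S.mk (fun i => pv a (g i))) (fun j => S.mk (fun i => px j (g i)))) =
      S.mk (fun i => tev (Sum.elim (fun a => pv a (g i)) (fun j => px j (g i))) t) := by
  induction t with
  | var a => cases a <;> rfl
  | func f ts ih =>
    simp only [Term.realize_func, ih]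
    exact S.funMap_mk f (x := fun j i => tev (Sum.elim (fun a => pv a (g i)) (fun j => px j (g i))) (ts j))
      fun j => hg.app (AA.ofC (realN_computable (ts j) pv px hv hx))

theorem TM_snoc {k : ℕ} {φ : lang.BoundedFormula A (k+1)} {pv : A → γ → ℕ} {px : Fin k → γ → ℕ} {g : ℕ → γ} (y : ℕ → ℕ) :
    φ.Realize (M := MM S) (fun a => S.mk (fun i => pv a (g i))) (Fin.snoc (fun j => S.mk (fun i => px j (g i))) (S.mk y)) ↔
    TM S φ (exv pv) (exx px) (fun i => (g i, y i)) := by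
  unfold TM
  refine Eq.to_iff ?_
  congr 1
  funext j
  refine Fin.lastCases ?_ (fun j => ?_) j
  · simp [exx]
  · simp [exx]

theorem ex_mk {P : MM S → Prop} : (∃ x, P x) ↔ ∃ y, S.SS y ∧ P (S.mk y) :=
  ⟨fun ⟨x, hx⟩ => ⟨_, S.rep_mem x, by rwa [S.mk_rep]⟩, fun ⟨y, _, hy⟩ => ⟨_, hy⟩⟩
theorem all_mk {P : MM S → Prop} : (∀ x, P x) ↔ ∀ y, S.SS y → P (S.mk y) :=
  ⟨fun h y _ => h _, fun h x => by rw [← S.mk_rep x]; exact h _ (S.rep_mem x)⟩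

theorem los0 {k : ℕ} {φ : lang.BoundedFormula A k} (h : IsDelta0 k φ) :
    ∀ {γ : Type} [Primcodable γ] [Inhabited γ] {pv : A → γ → ℕ} {px : Fin k → γ → ℕ}, (∀ a, Computable (pv a)) →
      (∀ j, Computable (px j)) → ∀ {g : ℕ → γ}, S.SS g → (TM S φ pv px g ↔ ∀ᶠ i in UF, TN φ pv px (g i)) := by
  induction h with
  | falsum k =>
    intro γ _ _ pv px hv hx g hg
    have : ¬ ∀ᶠ i in UF, False := by rw [Filter.eventually_false_iff_eq_bot]; exact Filter.NeBot.ne inferInstance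
    exact iff_of_false (fun h => h) this
  | equal k t u =>
    intro γ _ _ pv px hv hx g hg
    simp only [TM, BoundedFormula.Realize]
    rw [real_mk t hv hx hg, real_mk u hv hx hg, S.mk_eq (hg.app (AA.ofC (realN_computable t pv px hv hx))) (hg.app (AA.ofC (realN_computable u pv px hv hx)))]
    rfl
  | rel k l R ts =>
    intro γ _ _ pv px hv hx g hg
    simp only [TM, BoundedFormula.Realize, real_mk _ hv hx hg]
    exact S.relMap_mk R fun j => (hg.app (AA.ofC (realN_computable (ts j) pv px hv hx)))
  | imp k h1 h2 ih1 ih2 =>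
    intro γ _ _ pv px hv hx g hg
    have e1 := ih1 hv hx hg
    have e2 := ih2 hv hx hg
    simp only [TM, TN, BoundedFormula.realize_imp, FN_imp] at *
    rw [e1, e2, Ultrafilter.eventually_imp]
  | @bdAll k t φ h ih =>
    intro γ _ _ pv px hv hx g hg
    have hC := hg.app (AA.ofC (n := n) (realN_computable t pv px hv hx))
    have e1 : TM S (BoundedFormula.all ((ltFm (Term.var (Sum.inr (Fin.last k))) (t.liftAt 1 k)).imp φ)) pv px g ↔
      ∀ y, S.SS y → (∀ᶠ i in UF, y i < tev (Sum.elim (fun a => pv a (g i)) (fun j => px j (g i))) t) → ∀ᶠ i in UF, TN φ (exv pv) (exx px) (g i, y i) := by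
      unfold TM
      rw [bd_realize, all_mk]
      refine forall₂_congr fun y hy => ?_
      rw [real_mk t hv hx hg, S.mk_lt hy hC, TM_snoc, ih (exv_c hv) (exx_c hx) (hg.pair hy)]
    have e2 : ∀ a, TN (BoundedFormula.all ((ltFm (Term.var (Sum.inr (Fin.last k))) (t.liftAt 1 k)).imp φ)) pv px a ↔
      ∀ y < tev (Sum.elim (fun a' => pv a' a) (fun j => px j a)) t, TN φ (exv pv) (exx px) (a, y) := by
      intro a
      simp only [TN, FN_bd, exx_eq]
      rfl
    rw [e1]
    constructor
    · intro hh
      by_contra hc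
      rw [← Ultrafilter.eventually_not] at hc
      have d1 : DD n (fun a => ¬ TN (BoundedFormula.all ((ltFm (Term.var (Sum.inr (Fin.last k))) (t.liftAt 1 k)).imp φ)) pv px a) :=
        (DD.of_sg0 (L1_delta0 (IsDelta0.bdAll k t h) hv hx)).not
      have d2 : DD n (fun q : γ × ℕ => q.2 < tev (Sum.elim (fun a' => pv a' q.1) (fun j => px j q.1)) t ∧ ¬ TN φ (exv pv) (exx px) q) :=
        (DD.lt AA.snd ((AA.ofC (realN_computable t pv px hv hx)).comp AA.fst)).and (DD.of_sg0 (L1_delta0 h (exv_c hv) (exx_c hx))).not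
      obtain ⟨y, hy, hy'⟩ := S.search d1 d2 (by
        intro a ha
        rw [e2] at ha
        push Not at ha
        exact ha) hg hc
      have := hh y hy (hy'.mono fun i h => h.1)
      obtain ⟨i, hi1, hi2⟩ := (this.and hy').exists
      exact hi2.2 hi1
    · intro hh y hy hlt
      filter_upwards [hh, hlt] with i h1 h2
      exact (e2 _).1 h1 _ h2

mutual
theorem losS {k m : ℕ} {φ : lang.BoundedFormula A k} : SigmaFm m k φ → m ≤ n →
    ∀ {γ : Type} [Primcodable γ] [Inhabited γ] {pv : A → γ → ℕ} {px : Fin k → γ → ℕ}, (∀ a, Computable (pv a)) →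
      (∀ j, Computable (px j)) → ∀ {g : ℕ → γ}, S.SS g → (TM S φ pv px g ↔ ∀ᶠ i in UF, TN φ pv px (g i))
  | .delta0 m k h, _, _, _, _, _, _, hv, hx, _, hg => los0 h hv hx hg
  | .ofPi m k h, hm, _, _, _, _, _, hv, hx, _, hg => losP h (by omega) hv hx hg
  | @SigmaFm.ex _ m k φ h, hm, γ, _, _, pv, px, hv, hx, g, hg => by
      have e1 : TM S φ.ex pv px g ↔ ∃ y, S.SS y ∧ ∀ᶠ i in UF, TN φ (exv pv) (exx px) (g i, y i) := by
        unfold TM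
        rw [BoundedFormula.realize_ex, ex_mk]
        refine exists_congr fun y => and_congr_right fun hy => ?_
        rw [TM_snoc, losS h hm (exv_c hv) (exx_c hx) (hg.pair hy)]
      have e2 : ∀ a, TN φ.ex pv px a ↔ ∃ y, TN φ (exv pv) (exx px) (a, y) := by
        intro a
        simp only [TN, FN_ex, exx_eq]
        rfl
      rw [e1]
      constructor
      · rintro ⟨y, hy, hh⟩
        exact hh.mono fun i hi => (e2 _).2 ⟨_, hi⟩
      · intro hh
        exact S.search (DD.of_sg (L1_S (SigmaFm.ex m k h) hv hx) hm) (DD.of_sg (L1_S h (exv_c hv) (exx_c hx)) hm)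
          (fun a ha => (e2 a).1 ha) hg hh
theorem losP {k m : ℕ} {φ : lang.BoundedFormula A k} : PiFm m k φ → m ≤ n →
    ∀ {γ : Type} [Primcodable γ] [Inhabited γ] {pv : A → γ → ℕ} {px : Fin k → γ → ℕ}, (∀ a, Computable (pv a)) →
      (∀ j, Computable (px j)) → ∀ {g : ℕ → γ}, S.SS g → (TM S φ pv px g ↔ ∀ᶠ i in UF, TN φ pv px (g i))
  | .delta0 m k h, _, _, _, _, _, _, hv, hx, _, hg => los0 h hv hx hg
  | .ofSigma m k h, hm, _, _, _, _, _, hv, hx, _, hg => losS h (by omega) hv hx hg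
  | @PiFm.all _ m k φ h, hm, γ, _, _, pv, px, hv, hx, g, hg => by
      have e1 : TM S φ.all pv px g ↔ ∀ y, S.SS y → ∀ᶠ i in UF, TN φ (exv pv) (exx px) (g i, y i) := by
        unfold TM
        rw [BoundedFormula.realize_all, all_mk]
        refine forall₂_congr fun y hy => ?_
        rw [TM_snoc, losP h hm (exv_c hv) (exx_c hx) (hg.pair hy)]
      have e2 : ∀ a, TN φ.all pv px a ↔ ∀ y, TN φ (exv pv) (exx px) (a, y) := by
        intro a
        simp only [TN, FN_all, exx_eq]
        rfl
      rw [e1]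
      constructor
      · intro hh
        by_contra hc
        rw [← Ultrafilter.eventually_not] at hc
        obtain ⟨y, hy, hy'⟩ := S.search (DD.of_sg (L1_P (PiFm.all m k h) hv hx) hm) (DD.of_sg (L1_P h (exv_c hv) (exx_c hx)) hm)
          (fun a ha => by rw [e2] at ha; push Not at ha; exact ha) hg hc
        obtain ⟨i, h1, h2⟩ := ((hh y hy).and hy').exists
        exact h2 h1
      · intro hh y hy
        exact hh.mono fun i hi => (e2 _).1 hi _
end

theorem losS1 {k m : ℕ} {φ : lang.BoundedFormula A k} : SigmaFm m k φ → m = n + 1 →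
    ∀ {γ : Type} [Primcodable γ] [Inhabited γ] {pv : A → γ → ℕ} {px : Fin k → γ → ℕ}, (∀ a, Computable (pv a)) →
      (∀ j, Computable (px j)) → ∃ Q : γ × ℕ → Prop, DD n Q ∧ (∀ a, TN φ pv px a ↔ ∃ w, Q (a, w)) ∧
       ∀ {g : ℕ → γ}, S.SS g → (TM S φ pv px g ↔ ∃ w, S.SS w ∧ ∀ᶠ i in UF, Q (g i, w i))
  | .delta0 m k h, _, _, _, _, _, _, hv, hx => by
      refine ⟨fun q => TN φ _ _ q.1, (DD.of_sg0 (L1_delta0 h hv hx)).comp AA.fst, fun a => by simp, ?_⟩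
      intro g hg
      rw [los0 h hv hx hg]
      exact ⟨fun h => ⟨fun _ => 0, Mod.SS.const 0, h⟩, fun ⟨_, _, h⟩ => h⟩
  | .ofPi m k h, hm, _, _, _, _, _, hv, hx => by
      refine ⟨fun q => TN φ _ _ q.1, (DD.of_nsg (L1_P h hv hx) (by omega)).comp AA.fst, fun a => by simp, ?_⟩
      intro g hg
      rw [losP h (by omega) hv hx hg]
      exact ⟨fun h => ⟨fun _ => 0, Mod.SS.const 0, h⟩, fun ⟨_, _, h⟩ => h⟩
  | @SigmaFm.ex _ m k φ h, hm, γ, _, _, pv, px, hv, hx => by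
      obtain ⟨Q, hQ, h1, h2⟩ := losS1 h hm (exv_c hv) (exx_c hx)
      refine ⟨fun q => Q ((q.1, q.2.unpair.1), q.2.unpair.2), hQ.comp (by fun_prop), ?_, ?_⟩
      · intro a
        have : TN φ.ex pv px a ↔ ∃ y, TN φ (exv pv) (exx px) (a, y) := by
          simp only [TN, FN_ex, exx_eq]
          rfl
        rw [this]
        simp only [h1]
        constructor
        · rintro ⟨y, w, h⟩; exact ⟨Nat.pair y w, by simpa using h⟩
        · rintro ⟨y, h⟩; exact ⟨_, _, h⟩
      · intro g hg
        unfold TM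
        rw [BoundedFormula.realize_ex, ex_mk]
        constructor
        · rintro ⟨y, hy, h⟩
          rw [TM_snoc, h2 (hg.pair hy)] at h
          obtain ⟨w, hw, hh⟩ := h
          exact ⟨fun i => Nat.pair (y i) (w i), S.pair hy hw, by simpa using hh⟩
        · rintro ⟨w, hw, hh⟩
          refine ⟨fun i => (w i).unpair.1, hw.app (f := fun k => k.unpair.1) (by fun_prop), ?_⟩
          rw [TM_snoc, h2 (hg.pair (hw.app (f := fun k => k.unpair.1) (by fun_prop)))]
          exact ⟨fun i => (w i).unpair.2, hw.app (f := fun k => k.unpair.2) (by fun_prop), hh⟩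
end Los
end Model
end ArithFC

namespace ArithFC
section Coding2
variable {α : Type} [Primcodable α] {n : ℕ}

/-- Cantor pairing over the naturals -/
def IsPairN (z x y : ℕ) : Prop := z + z = (x + y) * (x + y + 1) + (y + y)

theorem IsPairN.exists (z : ℕ) : ∃ p : ℕ × ℕ, IsPairN z p.1 p.2 := by
  induction z with
  | zero => exact ⟨(0, 0), by simp [IsPairN]⟩
  | succ z ih =>
    obtain ⟨⟨x, y⟩, h⟩ := ih
    simp only [IsPairN] at h ⊢
    cases x with
    | zero => exact ⟨(y+1, 0), by simp at *; nlinarith⟩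
    | succ x => exact ⟨(x, y+1), by simp at *; nlinarith⟩

theorem IsPairN.inj {z x y x' y' : ℕ} (h : IsPairN z x y) (h' : IsPairN z x' y') : x = x' ∧ y = y' := by
  simp only [IsPairN] at *
  have key : x + y = x' + y' := by
    rcases lt_trichotomy (x+y) (x'+y') with hlt | h1 | hlt
    · have : (x + y + 1) * (x + y + 2) ≤ (x'+y') * (x'+y'+1) := Nat.mul_le_mul (by omega) (by omega)
      nlinarith
    · exact h1
    · have : (x' + y' + 1) * (x' + y' + 2) ≤ (x+y) * (x+y+1) := Nat.mul_le_mul (by omega) (by omega)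
      nlinarith
  rw [key] at h
  omega

theorem IsPairN.exists' (x y : ℕ) : ∃ z, IsPairN z x y := by
  obtain ⟨k, hk⟩ := Nat.even_mul_succ_self (x+y)
  exact ⟨k + y, by simp only [IsPairN]; have : (x+y) * (x+y+1) = k + k := hk; omega⟩

/-- inverse Cantor pairing -/
noncomputable def cunp (z : ℕ) : ℕ × ℕ := (IsPairN.exists z).choose
theorem cunp_spec (z : ℕ) : IsPairN z (cunp z).1 (cunp z).2 := (IsPairN.exists z).choose_spec
theorem cunp_eq {z x y : ℕ} (h : IsPairN z x y) : cunp z = (x, y) := by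
  have := (cunp_spec z).inj h
  exact Prod.ext this.1 this.2
theorem cunp_iff {z x y : ℕ} : IsPairN z x y ↔ (cunp z).1 = x ∧ (cunp z).2 = y :=
  ⟨fun h => by simp [cunp_eq h], fun ⟨h1, h2⟩ => h1 ▸ h2 ▸ cunp_spec z⟩

theorem DD.isPairN {f g h : α → ℕ} (hf : AA n f) (hg : AA n g) (hh : AA n h) : DD n (fun a => IsPairN (f a) (g a) (h a)) :=
  DD.eq (by fun_prop) (by fun_prop)

theorem AA.cunp0 : AA n cunp := by
  refine (DD.isPairN (n := n) (α := ℕ × (ℕ × ℕ)) (f := fun p => p.1) (g := fun p => p.2.1) (h := fun p => p.2.2) (by fun_prop) (by fun_prop) (by fun_prop)).1.congr fun p => ?_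
  rw [cunp_iff, Prod.ext_iff]
@[fun_prop] theorem AA.cunp {f : α → ℕ} (hf : AA n f) : AA n (fun a => cunp (f a)) := AA.cunp0.comp hf

/-- decoded sequence entries -/
noncomputable def nSeq (s i : ℕ) : ℕ := (cunp s).1 % ((i + 1) * (cunp s).2 + 1)
@[fun_prop] theorem AA.nSeq {f g : α → ℕ} (hf : AA n f) (hg : AA n g) : AA n (fun a => nSeq (f a) (g a)) := by
  unfold ArithFC.nSeq; fun_prop

theorem exists_nSeq (l : List ℕ) : ∃ s, ∀ i < l.length, nSeq s i = l.getD i 0 := by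
  obtain ⟨s, hs⟩ := IsPairN.exists' (Nat.unbeta l).unpair.1 (Nat.unbeta l).unpair.2
  refine ⟨s, fun i hi => ?_⟩
  have := Nat.beta_unbeta_coe l ⟨i, hi⟩
  rw [Nat.beta] at this
  simp only [nSeq, cunp_eq hs]
  rw [List.getD_eq_getElem _ _ hi]
  exact this

variable {S : Mod n}

theorem Mod.SS.add {x y : ℕ → ℕ} (hx : S.SS x) (hy : S.SS y) : S.SS (fun i => x i + y i) :=
  (hx.pair hy).app (f := fun p : ℕ × ℕ => p.1 + p.2) (by fun_prop)
theorem Mod.SS.mul {x y : ℕ → ℕ} (hx : S.SS x) (hy : S.SS y) : S.SS (fun i => x i * y i) :=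
  (hx.pair hy).app (f := fun p : ℕ × ℕ => p.1 * p.2) (by fun_prop)

theorem pam : PAm (MM S) := by
  have R := fun x => S.exists_rep x
  refine ⟨?_,?_,?_,?_,?_,?_,?_,?_,?_,?_,?_,?_,?_,?_,?_,?_,?_⟩
  · intro x y z
    obtain ⟨x, hx, rfl⟩ := R x; obtain ⟨y, hy, rfl⟩ := R y; obtain ⟨z, hz, rfl⟩ := R z
    rw [S.mk_add hx hy, S.mk_add hy hz, S.mk_add (hx.add hy) hz, S.mk_add hx (hy.add hz)]
    simp only [Nat.add_assoc]
  · intro x y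
    obtain ⟨x, hx, rfl⟩ := R x; obtain ⟨y, hy, rfl⟩ := R y
    rw [S.mk_add hx hy, S.mk_add hy hx]
    simp only [Nat.add_comm]
  · intro x y z
    obtain ⟨x, hx, rfl⟩ := R x; obtain ⟨y, hy, rfl⟩ := R y; obtain ⟨z, hz, rfl⟩ := R z
    rw [S.mk_mul hx hy, S.mk_mul hy hz, S.mk_mul (hx.mul hy) hz, S.mk_mul hx (hy.mul hz)]
    simp only [Nat.mul_assoc]
  · intro x y
    obtain ⟨x, hx, rfl⟩ := R x; obtain ⟨y, hy, rfl⟩ := R y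
    rw [S.mk_mul hx hy, S.mk_mul hy hx]
    simp only [Nat.mul_comm]
  · intro x y z
    obtain ⟨x, hx, rfl⟩ := R x; obtain ⟨y, hy, rfl⟩ := R y; obtain ⟨z, hz, rfl⟩ := R z
    rw [S.mk_add hy hz, S.mk_mul hx hy, S.mk_mul hx hz, S.mk_mul hx (hy.add hz), S.mk_add (hx.mul hy) (hx.mul hz)]
    simp only [Nat.mul_add]
  · intro x
    obtain ⟨x, hx, rfl⟩ := R x
    rw [S.mk_zero, S.mk_add hx (Mod.SS.const 0)]
    rfl
  · intro x
    obtain ⟨x, hx, rfl⟩ := R x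
    rw [S.mk_zero, S.mk_mul hx (Mod.SS.const 0)]
    rfl
  · intro x
    obtain ⟨x, hx, rfl⟩ := R x
    rw [S.mk_one, S.mk_mul hx (Mod.SS.const 1)]
    simp only [Nat.mul_one]
  · intro x y z
    obtain ⟨x, hx, rfl⟩ := R x; obtain ⟨y, hy, rfl⟩ := R y; obtain ⟨z, hz, rfl⟩ := R z
    rw [S.mk_lt hx hy, S.mk_lt hy hz, S.mk_lt hx hz]
    intro h h'
    exact (h.and h').mono fun i h => h.1.trans h.2
  · intro x
    obtain ⟨x, hx, rfl⟩ := R x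
    rw [S.mk_lt hx hx]
    intro h
    obtain ⟨i, hi⟩ := h.exists
    exact absurd hi (lt_irrefl _)
  · intro x y
    obtain ⟨x, hx, rfl⟩ := R x; obtain ⟨y, hy, rfl⟩ := R y
    rw [S.mk_lt hx hy, S.mk_lt hy hx, S.mk_eq hx hy, ← Ultrafilter.eventually_or, ← Ultrafilter.eventually_or]
    exact Filter.Eventually.of_forall fun i => lt_trichotomy _ _
  · intro x y z
    obtain ⟨x, hx, rfl⟩ := R x; obtain ⟨y, hy, rfl⟩ := R y; obtain ⟨z, hz, rfl⟩ := R z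
    rw [S.mk_add hx hz, S.mk_add hy hz, S.mk_lt hx hy, S.mk_lt (hx.add hz) (hy.add hz)]
    intro h
    exact h.mono fun i h => by omega
  · intro x y z
    obtain ⟨x, hx, rfl⟩ := R x; obtain ⟨y, hy, rfl⟩ := R y; obtain ⟨z, hz, rfl⟩ := R z
    rw [S.mk_zero, S.mk_mul hx hz, S.mk_mul hy hz, S.mk_lt hx hy, S.mk_lt (hx.mul hz) (hy.mul hz), S.mk_lt (Mod.SS.const 0) hz]
    intro h h'
    exact (h.and h').mono fun i h => Nat.mul_lt_mul_of_pos_right h.1 h.2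
  · intro x y
    obtain ⟨x, hx, rfl⟩ := R x; obtain ⟨y, hy, rfl⟩ := R y
    rw [S.mk_lt hx hy]
    intro h
    have hz : S.SS (fun i => y i - x i) := (hy.pair hx).app (f := fun p : ℕ × ℕ => p.1 - p.2) (by fun_prop)
    refine ⟨S.mk (fun i => y i - x i), ?_⟩
    rw [S.mk_add hx hz, S.mk_eq (hx.add hz) hy]
    exact h.mono fun i h => by omega
  · rw [S.mk_zero, S.mk_one, S.mk_lt (Mod.SS.const 0) (Mod.SS.const 1)]
    exact Filter.Eventually.of_forall fun i => Nat.one_pos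
  · intro x
    obtain ⟨x, hx, rfl⟩ := R x
    rw [S.mk_zero, S.mk_one, S.mk_lt (Mod.SS.const 0) hx, S.mk_le (Mod.SS.const 1) hx]
    exact fun h => h
  · intro x
    obtain ⟨x, hx, rfl⟩ := R x
    rw [S.mk_zero, S.mk_le (Mod.SS.const 0) hx]
    exact Filter.Eventually.of_forall fun i => Nat.zero_le _

theorem isPairC_mk {z x y : ℕ → ℕ} (hz : S.SS z) (hx : S.SS x) (hy : S.SS y) :
    IsPairC (S.mk z) (S.mk x) (S.mk y) ↔ ∀ᶠ i in UF, IsPairN (z i) (x i) (y i) := by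
  unfold IsPairC
  rw [S.mk_one, S.mk_add hz hz, S.mk_add hx hy, S.mk_add hy hy, S.mk_add (hx.add hy) (Mod.SS.const 1),
    S.mk_mul (hx.add hy) ((hx.add hy).add (Mod.SS.const 1)), S.mk_add ((hx.add hy).mul ((hx.add hy).add (Mod.SS.const 1))) (hy.add hy),
    S.mk_eq (hz.add hz) (((hx.add hy).mul ((hx.add hy).add (Mod.SS.const 1))).add (hy.add hy))]
  rfl

theorem betaC_mk {a b j x : ℕ → ℕ} (ha : S.SS a) (hb : S.SS b) (hj : S.SS j) (hx : S.SS x) :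
    BetaC (S.mk a) (S.mk b) (S.mk j) (S.mk x) ↔ ∀ᶠ i in UF, a i % ((j i + 1) * b i + 1) = x i := by
  unfold BetaC
  have h1 := ((hj.add (Mod.SS.const 1)).mul hb).add (Mod.SS.const 1)
  rw [S.mk_one, S.mk_add hj (Mod.SS.const 1), S.mk_mul (hj.add (Mod.SS.const 1)) hb,
    S.mk_add ((hj.add (Mod.SS.const 1)).mul hb) (Mod.SS.const 1), S.mk_lt hx h1, ex_mk]
  constructor
  · rintro ⟨h, q, hq, h'⟩
    rw [S.mk_mul hq h1, S.mk_add (hq.mul h1) hx, S.mk_eq ha ((hq.mul h1).add hx)] at h'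
    filter_upwards [h, h'] with i e1 e2
    rw [e2, Nat.mul_add_mod', Nat.mod_eq_of_lt e1]
  · intro h
    refine ⟨h.mono fun i hi => hi ▸ Nat.mod_lt _ (by omega), ?_⟩
    have hq : S.SS (fun i => a i / ((j i + 1) * b i + 1)) := (ha.pair h1).app (f := fun p : ℕ × ℕ => p.1 / p.2) (by fun_prop)
    refine ⟨_, hq, ?_⟩
    rw [S.mk_mul hq h1, S.mk_add (hq.mul h1) hx, S.mk_eq ha ((hq.mul h1).add hx)]
    filter_upwards [h] with i hi
    rw [← hi, Nat.div_add_mod']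

theorem seqAt_mk {s j x : ℕ → ℕ} (hs : S.SS s) (hj : S.SS j) (hx : S.SS x) :
    SeqAt (S.mk s) (S.mk j) (S.mk x) ↔ ∀ᶠ i in UF, nSeq (s i) (j i) = x i := by
  have ha : S.SS (fun i => (cunp (s i)).1) := hs.app (f := fun s => (cunp s).1) (by fun_prop)
  have hb : S.SS (fun i => (cunp (s i)).2) := hs.app (f := fun s => (cunp s).2) (by fun_prop)
  unfold SeqAt
  constructor
  · rintro ⟨a, b, h1, h2⟩
    obtain ⟨a, ha, rfl⟩ := S.exists_rep a
    obtain ⟨b, hb, rfl⟩ := S.exists_rep b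
    rw [isPairC_mk hs ha hb] at h1
    rw [betaC_mk ha hb hj hx] at h2
    filter_upwards [h1, h2] with i e1 e2
    rw [nSeq, cunp_eq e1, e2]
  · intro h
    refine ⟨S.mk (fun i => (cunp (s i)).1), S.mk (fun i => (cunp (s i)).2), ?_, ?_⟩
    · rw [isPairC_mk hs ha hb]
      exact Filter.Eventually.of_forall fun i => cunp_spec _
    · rw [betaC_mk ha hb hj hx]
      exact h

theorem SS_ofFn {k : ℕ} {x : Fin k → ℕ → ℕ} (hx : ∀ j, S.SS (x j)) : S.SS (fun i => List.ofFn (fun j => x j i)) := by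
  induction k with
  | zero => simpa using Mod.SS.const []
  | succ k ih =>
    simp only [List.ofFn_succ]
    exact ((hx 0).pair (ih (x := fun j => x j.succ) (fun j => hx _))).app (f := fun p : ℕ × List ℕ => p.1 :: p.2)
      (AA.ofP Primrec.list_cons)

section Rep
variable {k : ℕ} {R : (Fin k → MM S) → Prop}

/-- projections for coded environments -/
def pvE (k p : ℕ) : Fin k ⊕ Fin p → List ℕ × ℕ → ℕ := Sum.elim (fun j g => g.1.getD j 0) (fun j g => (dec (List ℕ) g.2).getD j 0)
theorem pvE_c (k p : ℕ) (a : Fin k ⊕ Fin p) : Computable (pvE k p a) := by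
  cases a with
  | inl j => exact (Primrec.list_getD 0).to_comp.comp Computable.fst (Computable.const _)
  | inr j => exact (Primrec.list_getD 0).to_comp.comp (dec_comp.comp Computable.snd) (Computable.const _)

theorem rep_env {p : ℕ} (φ : lang.BoundedFormula (Fin k ⊕ Fin p) 0) (w : Fin p → MM S) (x : Fin k → ℕ → ℕ) :
    φ.Realize (M := MM S) (Sum.elim (fun j => S.mk (x j)) w) finZeroElim ↔
      TM S φ (pvE k p) (fun (j : Fin 0) => j.elim0) (fun i => (List.ofFn (fun j => x j i), Encodable.encode (List.ofFn (fun j => S.rep (w j) i)))) := by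
  unfold TM
  refine Eq.to_iff ?_
  congr 1
  · funext a
    cases a with
    | inl j => simp [pvE, List.getD_eq_getElem?_getD]
    | inr j => simp [pvE, dec_encode, List.getD_eq_getElem?_getD, S.mk_rep]
  · funext j; exact j.elim0

theorem repS {m : ℕ} (hm : m ≤ n) (h : IsSigmaDef m (MM S) R) :
    ∃ P : List ℕ × ℕ → Prop, Sg m P ∧ ∃ p, S.SS p ∧ ∀ x : Fin k → ℕ → ℕ, (∀ j, S.SS (x j)) →
      (R (fun j => S.mk (x j)) ↔ ∀ᶠ i in UF, P (List.ofFn (fun j => x j i), p i)) := by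
  obtain ⟨p, φ, w, hφ, h⟩ := h
  have hp : S.SS (fun i => Encodable.encode (List.ofFn (fun j => S.rep (w j) i))) := SS_ofFn fun j => S.rep_mem _
  refine ⟨TN φ (pvE k p) (fun (j : Fin 0) => j.elim0), L1_S hφ (pvE_c k p) (fun j => j.elim0), _, hp, fun x hx => ?_⟩
  rw [h, rep_env, losS hφ hm (pvE_c k p) (fun j => j.elim0) ((SS_ofFn hx).pair hp)]

theorem repS1 (h : IsSigmaDef (n+1) (MM S) R) :
    ∃ Q : (List ℕ × ℕ) × ℕ → Prop, DD n Q ∧ ∃ p, S.SS p ∧ ∀ x : Fin k → ℕ → ℕ, (∀ j, S.SS (x j)) →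
      (R (fun j => S.mk (x j)) ↔ ∃ w, S.SS w ∧ ∀ᶠ i in UF, Q ((List.ofFn (fun j => x j i), p i), w i)) := by
  obtain ⟨p, φ, w, hφ, h⟩ := h
  have hp : S.SS (fun i => Encodable.encode (List.ofFn (fun j => S.rep (w j) i))) := SS_ofFn fun j => S.rep_mem _
  obtain ⟨Q, hQ, _, h2⟩ := losS1 (S := S) hφ rfl (pvE_c k p) (px := fun (j : Fin 0) => j.elim0) (fun j => j.elim0)
  refine ⟨Q, hQ, _, hp, fun x hx => ?_⟩
  rw [h, rep_env, h2 ((SS_ofFn hx).pair hp)]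

theorem comp_l1 : Computable (fun p : ℕ × ℕ => (([p.1], p.2) : List ℕ × ℕ)) :=
  (Computable.pair (Primrec.list_cons.to_comp.comp Computable.fst (Computable.const [])) Computable.snd)
theorem comp_l2 : Computable (fun p : (ℕ × ℕ) × ℕ => (([p.1.1, p.1.2], p.2) : List ℕ × ℕ)) :=
  (Computable.pair (Primrec.list_cons.to_comp.comp (Computable.fst.comp Computable.fst)
    (Primrec.list_cons.to_comp.comp (Computable.snd.comp Computable.fst) (Computable.const []))) Computable.snd)

theorem rep1 {m : ℕ} (hm : m ≤ n) {A : Set (MM S)} (h : SigmaDef1 m (MM S) A) :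
    ∃ P : ℕ × ℕ → Prop, Sg m P ∧ ∃ p, S.SS p ∧ ∀ x, S.SS x → (S.mk x ∈ A ↔ ∀ᶠ i in UF, P (x i, p i)) := by
  obtain ⟨P, hP, p, hp, h⟩ := repS hm h
  refine ⟨fun q => P ([q.1], q.2), hP.comp comp_l1, p, hp, fun x hx => ?_⟩
  simpa using h (fun _ => x) (fun _ => hx)

theorem rep2 {m : ℕ} (hm : m ≤ n) {R : MM S → MM S → Prop} (h : SigmaDef2 m (MM S) R) :
    ∃ P : (ℕ × ℕ) × ℕ → Prop, Sg m P ∧ ∃ p, S.SS p ∧ ∀ x y, S.SS x → S.SS y → (R (S.mk x) (S.mk y) ↔ ∀ᶠ i in UF, P ((x i, y i), p i)) := by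
  obtain ⟨P, hP, p, hp, h⟩ := repS hm h
  refine ⟨fun q => P ([q.1.1, q.1.2], q.2), hP.comp comp_l2, p, hp, fun x y hx hy => ?_⟩
  simpa using h ![x, y] (by intro j; fin_cases j <;> assumption)

theorem rep2' {R : MM S → MM S → Prop} (h : SigmaDef2 (n+1) (MM S) R) :
    ∃ Q : ((ℕ × ℕ) × ℕ) × ℕ → Prop, DD n Q ∧ ∃ p, S.SS p ∧ ∀ x y, S.SS x → S.SS y →
      (R (S.mk x) (S.mk y) ↔ ∃ w, S.SS w ∧ ∀ᶠ i in UF, Q (((x i, y i), p i), w i)) := by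
  obtain ⟨Q, hQ, p, hp, h⟩ := repS1 h
  refine ⟨fun q => Q (([q.1.1.1, q.1.1.2], q.1.2), q.2), hQ.comp (AA.ofC (Computable.pair (comp_l2.comp Computable.fst) Computable.snd)), p, hp, fun x y hx hy => ?_⟩
  simpa using h ![x, y] (by intro j; fin_cases j <;> assumption)
end Rep

theorem isig : ISig n (MM S) := by
  intro A hA h0 hs x
  obtain ⟨P, hP, p, hp, h⟩ := rep1 le_rfl hA
  obtain ⟨x, hx, rfl⟩ := S.exists_rep x
  have dP : DD n P := DD.of_sg hP le_rfl
  by_contra hc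
  rw [h x hx, ← Ultrafilter.eventually_not] at hc
  rw [S.mk_zero, h _ (Mod.SS.const 0)] at h0
  obtain ⟨z, hz, hz'⟩ := S.search (α := ℕ × ℕ) (β := ℕ) (P := fun a => P (0, a.2) ∧ ¬ P (a.1, a.2))
    (Q := fun a => P (a.2, a.1.2) ∧ ¬ P (a.2 + 1, a.1.2)) ((dP.comp (by fun_prop)).and (dP.comp (by fun_prop)).not)
    ((dP.comp (by fun_prop)).and (dP.comp (by fun_prop)).not) (by
      rintro ⟨a, q⟩ ⟨h1, h2⟩
      by_contra hcc
      push Not at hcc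
      apply h2
      exact Nat.rec h1 (fun k ih => hcc k ih) a) (hx.pair hp) (h0.and hc)
  have h1 := hs (S.mk z) ((h z hz).2 (hz'.mono fun i h => h.1))
  rw [S.mk_one, S.mk_add hz (Mod.SS.const 1), h _ (hz.add (Mod.SS.const 1))] at h1
  obtain ⟨i, e1, e2⟩ := (h1.and hz').exists
  exact e2.2 e1

theorem psig (hn : 1 ≤ n) : PSig n (MM S) := by
  obtain ⟨m, rfl⟩ : ∃ m, n = m + 1 := ⟨n - 1, by omega⟩
  intro f hf hfun b
  obtain ⟨P, hP, p, hp, h⟩ := rep2 le_rfl hf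
  obtain ⟨b, hb, rfl⟩ := S.exists_rep b
  have dP : DD (m+1) P := DD.of_sg hP le_rfl
  -- functionality
  have sF : Sg (m+1) (fun q : ℕ => ∃ t : ℕ × ℕ × ℕ, (P ((t.1, t.2.1), q) ∧ P ((t.1, t.2.2), q)) ∧ ¬ t.2.1 = t.2.2) := by
    refine Sg.ex (P := fun u : ℕ × (ℕ × ℕ × ℕ) => (P ((u.2.1, u.2.2.1), u.1) ∧ P ((u.2.1, u.2.2.2), u.1)) ∧ ¬ u.2.2.1 = u.2.2.2) ?_
    refine ((hP.comp (f := fun u : ℕ × (ℕ × ℕ × ℕ) => ((u.2.1, u.2.2.1), u.1)) ?_).and (hP.comp (f := fun u : ℕ × (ℕ × ℕ × ℕ) => ((u.2.1, u.2.2.2), u.1)) ?_)).and ?_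
    · exact Computable.pair (Computable.pair (Computable.fst.comp Computable.snd) (Computable.fst.comp (Computable.snd.comp Computable.snd))) Computable.fst
    · exact Computable.pair (Computable.pair (Computable.fst.comp Computable.snd) (Computable.snd.comp (Computable.snd.comp Computable.snd))) Computable.fst
    · exact ((Sg.eqC (Computable.fst.comp (Computable.snd.comp Computable.snd)) (Computable.snd.comp (Computable.snd.comp Computable.snd)) 0).not0).mono (Nat.zero_le _)
  have hF : ∀ᶠ i in UF, ¬ ∃ t : ℕ × ℕ × ℕ, (P ((t.1, t.2.1), p i) ∧ P ((t.1, t.2.2), p i)) ∧ ¬ t.2.1 = t.2.2 := by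
    by_contra hc
    rw [← Ultrafilter.eventually_not] at hc
    simp only [not_not] at hc
    obtain ⟨t, ht, ht'⟩ := S.search (β := ℕ × ℕ × ℕ) (DD.of_sg sF le_rfl)
      (Q := fun u : ℕ × (ℕ × ℕ × ℕ) => (P ((u.2.1, u.2.2.1), u.1) ∧ P ((u.2.1, u.2.2.2), u.1)) ∧ ¬ u.2.2.1 = u.2.2.2)
      (((dP.comp (by fun_prop)).and (dP.comp (by fun_prop))).and (DD.eq (by fun_prop) (by fun_prop)).not)
      (fun a h => h) hp hc
    have hx : S.SS (fun i => (t i).1) := ht.app AA.fst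
    have hy : S.SS (fun i => (t i).2.1) := ht.app (f := fun t => t.2.1) (by fun_prop)
    have hz : S.SS (fun i => (t i).2.2) := ht.app (f := fun t => t.2.2) (by fun_prop)
    have := hfun (S.mk fun i => (t i).1) (S.mk fun i => (t i).2.1) (S.mk fun i => (t i).2.2)
      ((h _ _ hx hy).2 (ht'.mono fun i h => h.1.1)) ((h _ _ hx hz).2 (ht'.mono fun i h => h.1.2))
    rw [S.mk_eq hy hz] at this
    obtain ⟨i, e1, e2⟩ := (this.and ht').exists
    exact e2.2 e1
  have sQ : Sg (m+1) (fun u : (ℕ × ℕ) × ℕ => ∃ t : ℕ × ℕ × ℕ, P ((t.2.1, t.2.2), u.1.2) ∧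
      t.1 + 1 < u.1.1 ∧ t.2.1 ≤ nSeq u.2 t.1 ∧ nSeq u.2 (t.1+1) < t.2.2) := by
    refine Sg.ex (P := fun v : ((ℕ × ℕ) × ℕ) × (ℕ × ℕ × ℕ) => P ((v.2.2.1, v.2.2.2), v.1.1.2) ∧
      v.2.1 + 1 < v.1.1.1 ∧ v.2.2.1 ≤ nSeq v.1.2 v.2.1 ∧ nSeq v.1.2 (v.2.1+1) < v.2.2.2) ?_
    refine (hP.comp (f := fun v : ((ℕ × ℕ) × ℕ) × (ℕ × ℕ × ℕ) => ((v.2.2.1, v.2.2.2), v.1.1.2)) ?_).and (Sg.mono (m := 1) ?_ (by omega))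
    · exact Computable.pair (Computable.snd.comp Computable.snd) (Computable.snd.comp (Computable.fst.comp Computable.fst))
    · exact ((DD.lt (n := 0) (by fun_prop) (by fun_prop)).and ((DD.le (by fun_prop) (by fun_prop)).and (DD.lt (by fun_prop) (by fun_prop)))).1
  obtain ⟨s, hs, hs'⟩ := S.search (α := ℕ × ℕ) (β := ℕ) (P := fun a => ¬ ∃ t : ℕ × ℕ × ℕ, (P ((t.1, t.2.1), a.2) ∧ P ((t.1, t.2.2), a.2)) ∧ ¬ t.2.1 = t.2.2)
    (Q := fun u => ¬ ∃ t : ℕ × ℕ × ℕ, P ((t.2.1, t.2.2), u.1.2) ∧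
      t.1 + 1 < u.1.1 ∧ t.2.1 ≤ nSeq u.2 t.1 ∧ nSeq u.2 (t.1+1) < t.2.2) (((DD.of_sg sF le_rfl).comp (f := fun a : ℕ × ℕ => a.2) (by fun_prop)).not)
    (DD.of_sg sQ le_rfl).not (by
      rintro ⟨b, q⟩ hq
      push Not at hq
      have hb : ∀ u : ℕ, ∃ v, ∀ x ≤ u, ∀ y, P ((x, y), q) → y ≤ v := by
        intro u
        induction u with
        | zero =>
          by_cases hy : ∃ y, P ((0, y), q)
          · obtain ⟨y, hy⟩ := hy
            refine ⟨y, fun x hx y' hy' => ?_⟩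
            obtain rfl : x = 0 := by omega
            exact (hq (0, y', y) ⟨hy', hy⟩).le
          · push Not at hy
            exact ⟨0, fun x hx y' hy' => by obtain rfl : x = 0 := by omega
                                            exact absurd hy' (hy _)⟩
        | succ u ih =>
          obtain ⟨v, hv⟩ := ih
          by_cases hy : ∃ y, P ((u+1, y), q)
          · obtain ⟨y, hy⟩ := hy
            refine ⟨max v y, fun x hx y' hy' => ?_⟩
            rcases Nat.lt_or_ge u x with hux | hux
            · obtain rfl : x = u + 1 := by omega
              exact (hq (u+1, y', y) ⟨hy', hy⟩).le.trans (le_max_right _ _)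
            · exact (hv x hux y' hy').trans (le_max_left _ _)
          · push Not at hy
            refine ⟨v, fun x hx y' hy' => ?_⟩
            rcases Nat.lt_or_ge u x with hux | hux
            · obtain rfl : x = u + 1 := by omega
              exact absurd hy' (hy _)
            · exact hv x hux y' hy'
      choose F hF using hb
      obtain ⟨s, hs⟩ := exists_nSeq ((List.range b).map fun i => F^[i] 0)
      refine ⟨s, ?_⟩
      rintro ⟨⟨i, x, y⟩, h1, h2, h3, h4⟩
      simp only at h1 h2 h3 h4
      have e1 := hs i (by simp; omega)
      have e2 := hs (i+1) (by simpa using h2)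
      rw [List.getD_eq_getElem _ _ (by simp; omega)] at e1 e2
      simp only [List.getElem_map, List.getElem_range] at e1 e2
      rw [e1] at h3
      rw [e2, Function.iterate_succ_apply'] at h4
      exact absurd (hF _ x h3 y h1) (by omega)) (hb.pair hp) hF
  refine ⟨S.mk s, ?_, ?_⟩
  · intro i hi
    obtain ⟨i, hi', rfl⟩ := S.exists_rep i
    have : S.SS (fun k => nSeq (s k) (i k)) := (hs.pair hi').app (f := fun p : ℕ × ℕ => nSeq p.1 p.2) (by fun_prop)
    exact ⟨_, (seqAt_mk hs hi' this).2 (Filter.Eventually.of_forall fun _ => rfl)⟩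
  · intro i u v x y
    obtain ⟨i, hi, rfl⟩ := S.exists_rep i
    obtain ⟨u, hu, rfl⟩ := S.exists_rep u
    obtain ⟨v, hv, rfl⟩ := S.exists_rep v
    obtain ⟨x, hx, rfl⟩ := S.exists_rep x
    obtain ⟨y, hy, rfl⟩ := S.exists_rep y
    have hi1 := hi.add (Mod.SS.const 1)
    rw [S.mk_one, S.mk_add hi (Mod.SS.const 1), S.mk_lt hi1 hb, seqAt_mk hs hi hu, seqAt_mk hs hi1 hv, S.mk_le hx hu, h x y hx hy, S.mk_le hy hv]
    intro h1 h2 h3 h4 h5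
    filter_upwards [h1, h2, h3, h4, h5, hs'] with k e1 e2 e3 e4 e5 e6
    push Not at e6
    rw [← e3]
    exact e6 (i k, x k, y k) e5 e1 (by simpa [e2] using e4)
end Coding2
end ArithFC

namespace ArithFC
section L2

/-- prepend to an environment -/
def cns (y : ℕ) (w : ℕ → ℕ) : ℕ → ℕ := fun j => Nat.casesOn j y w
@[simp] theorem cns_zero (y : ℕ) (w : ℕ → ℕ) : cns y w 0 = y := rfl
@[simp] theorem cns_succ (y : ℕ) (w : ℕ → ℕ) (j : ℕ) : cns y w (j+1) = w j := rfl
@[simp] theorem cns_one (y : ℕ) (w : ℕ → ℕ) : cns y w 1 = w 0 := rfl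
@[simp] theorem cns_two (y : ℕ) (w : ℕ → ℕ) : cns y w 2 = w 1 := rfl
@[simp] theorem cns_three (y : ℕ) (w : ℕ → ℕ) : cns y w 3 = w 2 := rfl
@[simp] theorem cns_four (y : ℕ) (w : ℕ → ℕ) : cns y w 4 = w 3 := rfl
@[simp] theorem cns_five (y : ℕ) (w : ℕ → ℕ) : cns y w 5 = w 4 := rfl

/-- polynomial functions -/
def Pl (p : (ℕ → ℕ) → ℕ) : Prop := ∃ t : lang.Term ℕ, ∀ w, p w = tev w t

theorem Pl.var (j : ℕ) : Pl (fun w => w j) := ⟨Term.var j, fun w => rfl⟩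
theorem Pl.zero : Pl (fun _ => 0) := ⟨Term.func (L := lang) Func.zero ![], fun w => rfl⟩
theorem Pl.one : Pl (fun _ => 1) := ⟨Term.func (L := lang) Func.one ![], fun w => rfl⟩
theorem Pl.add {p q : (ℕ → ℕ) → ℕ} (hp : Pl p) (hq : Pl q) : Pl (fun w => p w + q w) := by
  obtain ⟨t, ht⟩ := hp; obtain ⟨u, hu⟩ := hq
  exact ⟨Term.func (L := lang) Func.add ![t, u], fun w => by show p w + q w = _; rw [ht, hu]; rfl⟩
theorem Pl.mul {p q : (ℕ → ℕ) → ℕ} (hp : Pl p) (hq : Pl q) : Pl (fun w => p w * q w) := by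
  obtain ⟨t, ht⟩ := hp; obtain ⟨u, hu⟩ := hq
  exact ⟨Term.func (L := lang) Func.mul ![t, u], fun w => by show p w * q w = _; rw [ht, hu]; rfl⟩

theorem tev_subst {A B : Type} (s : A → lang.Term B) (v : B → ℕ) (t : lang.Term A) :
    tev v (t.subst s) = tev (fun a => tev v (s a)) t :=
  @Term.realize_subst lang ℕ strN A B t s v

/-- Delta zero predicates. -/
def D0 (R : (ℕ → ℕ) → Prop) : Prop := ∀ (α : Type) (k : ℕ) (t : ℕ → lang.Term (α ⊕ Fin k)),
  ∃ φ : lang.BoundedFormula α k, IsDelta0 k φ ∧ ∀ v xs, FN φ v xs ↔ R (fun j => tev (Sum.elim v xs) (t j))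

theorem D0.congr {R R' : (ℕ → ℕ) → Prop} (h : D0 R) (e : ∀ w, R w ↔ R' w) : D0 R' := by
  have : R = R' := funext fun w => propext (e w)
  exact this ▸ h
theorem D0.fls : D0 (fun _ => False) := fun α k t => ⟨_, .falsum k, fun v xs => Iff.rfl⟩
theorem D0.imp {R R' : (ℕ → ℕ) → Prop} (h : D0 R) (h' : D0 R') : D0 (fun w => R w → R' w) := by
  intro α k t
  obtain ⟨φ, h1, h2⟩ := h α k t
  obtain ⟨ψ, h3, h4⟩ := h' α k t
  exact ⟨_, .imp k h1 h3, fun v xs => by rw [FN_imp, h2, h4]⟩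
theorem D0.not {R : (ℕ → ℕ) → Prop} (h : D0 R) : D0 (fun w => ¬ R w) := h.imp D0.fls
theorem D0.or {R R' : (ℕ → ℕ) → Prop} (h : D0 R) (h' : D0 R') : D0 (fun w => R w ∨ R' w) :=
  (h.not.imp h').congr fun w => by tauto
theorem D0.and {R R' : (ℕ → ℕ) → Prop} (h : D0 R) (h' : D0 R') : D0 (fun w => R w ∧ R' w) :=
  (h.imp h'.not).not.congr fun w => by tauto
theorem D0.eq {p q : (ℕ → ℕ) → ℕ} (hp : Pl p) (hq : Pl q) : D0 (fun w => p w = q w) := by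
  intro α k t
  obtain ⟨u, hu⟩ := hp; obtain ⟨u', hu'⟩ := hq
  refine ⟨_, .equal k (u.subst t) (u'.subst t), fun v xs => ?_⟩
  show tev _ _ = tev _ _ ↔ _
  rw [tev_subst, tev_subst, ← hu, ← hu']
theorem D0.lt {p q : (ℕ → ℕ) → ℕ} (hp : Pl p) (hq : Pl q) : D0 (fun w => p w < q w) := by
  intro α k t
  obtain ⟨u, hu⟩ := hp; obtain ⟨u', hu'⟩ := hq
  refine ⟨_, .rel k 2 Rel.lt ![u.subst t, u'.subst t], fun v xs => ?_⟩
  show tev _ (u.subst t) < tev _ (u'.subst t) ↔ _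
  rw [tev_subst, tev_subst, ← hu, ← hu']
theorem D0.comp {R : (ℕ → ℕ) → Prop} (h : D0 R) {σ : (ℕ → ℕ) → ℕ → ℕ} (hσ : ∀ j, Pl (fun w => σ w j)) :
    D0 (fun w => R (σ w)) := by
  intro α k t
  choose s hs using hσ
  obtain ⟨φ, h1, h2⟩ := h α k (fun j => (s j).subst t)
  refine ⟨φ, h1, fun v xs => ?_⟩
  rw [h2]
  refine Eq.to_iff (congrArg R (funext fun j => ?_))
  rw [tev_subst]; exact (hs j _).symm

/-- extended term environment -/
def exT {α : Type} {k : ℕ} (t : ℕ → lang.Term (α ⊕ Fin k)) : ℕ → lang.Term (α ⊕ Fin (k+1)) :=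
  fun j => Nat.casesOn j (Term.var (Sum.inr (Fin.last k))) (fun j => (t j).relabel (Sum.map id Fin.castSucc))
theorem exT_eq {α : Type} {k : ℕ} (t : ℕ → lang.Term (α ⊕ Fin k)) (v : α → ℕ) (xs : Fin k → ℕ) (y : ℕ) :
    (fun j => tev (Sum.elim v (Fin.snoc (α := fun _ => ℕ) xs y)) (exT t j)) = cns y (fun j => tev (Sum.elim v xs) (t j)) := by
  funext j
  cases j with
  | zero =>
    show (Fin.snoc (α := fun _ => ℕ) xs y) (Fin.last k) = y
    simp
  | succ j =>
    show tev _ ((t j).relabel _) = tev _ _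
    refine (@Term.realize_relabel lang ℕ strN _ _ (t j) _ _).trans ?_
    show @Term.realize lang ℕ strN _ _ _ = @Term.realize lang ℕ strN _ _ _
    congr 1
    funext a
    cases a with
    | inl a => rfl
    | inr j => simp

theorem D0.ball {R : (ℕ → ℕ) → Prop} (h : D0 R) {p : (ℕ → ℕ) → ℕ} (hp : Pl p) : D0 (fun w => ∀ y < p w, R (cns y w)) := by
  intro α k t
  obtain ⟨u, hu⟩ := hp
  obtain ⟨φ, h1, h2⟩ := h α (k+1) (exT t)
  refine ⟨_, .bdAll k (u.subst t) h1, fun v xs => ?_⟩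
  rw [FN_bd, tev_subst]
  simp only [h2, exT_eq, hu]
theorem D0.bex {R : (ℕ → ℕ) → Prop} (h : D0 R) {p : (ℕ → ℕ) → ℕ} (hp : Pl p) : D0 (fun w => ∃ y < p w, R (cns y w)) :=
  (h.not.ball hp).not.congr fun w => by push Not; rfl

theorem Pl.comp {p : (ℕ → ℕ) → ℕ} (h : Pl p) {σ : (ℕ → ℕ) → ℕ → ℕ} (hσ : ∀ j, Pl (fun w => σ w j)) : Pl (fun w => p (σ w)) := by
  obtain ⟨t, ht⟩ := h
  choose s hs using hσ
  refine ⟨t.subst s, fun w => ?_⟩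
  rw [tev_subst]; beta_reduce; rw [ht]
  exact congrArg (fun v => tev v t) (funext fun j => hs j w)

/-- the hierarchy over Delta zero -/
def HS : ℕ → ((ℕ → ℕ) → Prop) → Prop
  | 0, R => D0 R
  | m + 1, R => ∃ Q, HS m Q ∧ ∀ w, R w ↔ ∃ y, ¬ Q (cns y w)

theorem HS.congr {m : ℕ} {R R' : (ℕ → ℕ) → Prop} (h : HS m R) (e : ∀ w, R w ↔ R' w) : HS m R' := by
  have : R = R' := funext fun w => propext (e w)
  exact this ▸ h

theorem cns_comp {σ : (ℕ → ℕ) → ℕ → ℕ} (hσ : ∀ j, Pl (fun w => σ w j)) (j : ℕ) :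
    Pl (fun w => cns (w 0) (σ (fun i => w (i+1))) j) := by
  cases j with
  | zero => exact Pl.var 0
  | succ j => exact (hσ j).comp (σ := fun w i => w (i+1)) (fun i => Pl.var _)

theorem HS.comp {m : ℕ} : ∀ {R : (ℕ → ℕ) → Prop} (h : HS m R) {σ : (ℕ → ℕ) → ℕ → ℕ} (hσ : ∀ j, Pl (fun w => σ w j)),
    HS m (fun w => R (σ w)) := by
  induction m with
  | zero => intro R h σ hσ; exact D0.comp h hσ
  | succ m ih =>
    intro R ⟨Q, hQ, h⟩ σ hσ
    refine ⟨_, ih hQ (cns_comp hσ), fun w => ?_⟩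
    beta_reduce; rw [h]; rfl

theorem HS.and_or {m : ℕ} : ∀ {R D : (ℕ → ℕ) → Prop} (h : HS m R) (hD : D0 D), HS m (fun w => D w ∧ R w) ∧ HS m (fun w => D w ∨ R w) := by
  induction m with
  | zero => intro R D h hD; exact ⟨hD.and h, hD.or h⟩
  | succ m ih =>
    intro R D ⟨Q, hQ, h⟩ hD
    have hD' : D0 (fun w => ¬ D (fun i => w (i+1))) := (hD.comp (σ := fun w i => w (i+1)) (fun j => Pl.var _)).not
    refine ⟨⟨_, (ih hQ hD').2, fun w => ?_⟩, ⟨_, (ih hQ hD').1, fun w => ?_⟩⟩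
    · beta_reduce; rw [h]; simp
    · beta_reduce; rw [h]; simp only [cns_succ, not_and, not_not, ← imp_iff_not_or, exists_or]
      constructor
      · rintro (h | ⟨y, h⟩)
        · exact ⟨0, fun h' => absurd h h'⟩
        · exact ⟨y, fun _ => h⟩
      · rintro ⟨y, h⟩
        by_cases hd : D w
        · exact Or.inl hd
        · exact Or.inr ⟨y, h hd⟩

theorem HS.fm {m : ℕ} : ∀ {R : (ℕ → ℕ) → Prop} (h : HS m R) (α : Type) (k : ℕ) (t : ℕ → lang.Term (α ⊕ Fin k)),
    (∃ φ : lang.BoundedFormula α k, SigmaFm m k φ ∧ ∀ v xs, FN φ v xs ↔ R (fun j => tev (Sum.elim v xs) (t j))) ∧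
    (∃ φ : lang.BoundedFormula α k, PiFm m k φ ∧ ∀ v xs, FN φ v xs ↔ ¬ R (fun j => tev (Sum.elim v xs) (t j))) := by
  induction m with
  | zero =>
    intro R h α k t
    obtain ⟨φ, h1, h2⟩ := h α k t
    obtain ⟨ψ, h3, h4⟩ := (D0.not h) α k t
    exact ⟨⟨φ, .delta0 0 k h1, h2⟩, ⟨ψ, .delta0 0 k h3, h4⟩⟩
  | succ m ih =>
    intro R ⟨Q, hQ, h⟩ α k t
    obtain ⟨⟨φ, h1, h2⟩, ⟨ψ, h3, h4⟩⟩ := ih hQ α (k+1) (exT t)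
    refine ⟨⟨_, .ex m k (.ofPi m _ h3), fun v xs => ?_⟩, ⟨_, .all m k (.ofSigma m _ h1), fun v xs => ?_⟩⟩
    · rw [FN_ex, h]; simp only [h4, exT_eq]
    · rw [FN_all, h]; simp only [h2, exT_eq, not_exists, not_not]

/-- Sigma one predicates -/
def E1 (R : (ℕ → ℕ) → Prop) : Prop := ∃ Q, D0 Q ∧ ∀ w, R w ↔ ∃ y, Q (cns y w)
theorem E1.hs {R : (ℕ → ℕ) → Prop} (h : E1 R) : HS 1 R := by
  obtain ⟨Q, hQ, h⟩ := h
  exact ⟨_, hQ.not, fun w => by simp [h]⟩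
theorem E1.congr {R R' : (ℕ → ℕ) → Prop} (h : E1 R) (e : ∀ w, R w ↔ R' w) : E1 R' := by
  have : R = R' := funext fun w => propext (e w)
  exact this ▸ h
theorem E1.of {R : (ℕ → ℕ) → Prop} (h : D0 R) : E1 R :=
  ⟨fun w => R (fun i => w (i+1)), h.comp (fun j => Pl.var _), fun w => by simp⟩
theorem E1.comp {R : (ℕ → ℕ) → Prop} (h : E1 R) {σ : (ℕ → ℕ) → ℕ → ℕ} (hσ : ∀ j, Pl (fun w => σ w j)) : E1 (fun w => R (σ w)) := by
  obtain ⟨Q, hQ, h⟩ := h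
  refine ⟨_, hQ.comp (cns_comp hσ), fun w => ?_⟩
  beta_reduce; rw [h]; rfl
theorem pl_perm (f : ℕ → ℕ) (j : ℕ) : Pl (fun w => w (f j)) := Pl.var _
theorem E1.and {R R' : (ℕ → ℕ) → Prop} (h : E1 R) (h' : E1 R') : E1 (fun w => R w ∧ R' w) := by
  obtain ⟨Q, hQ, h⟩ := h; obtain ⟨Q', hQ', h'⟩ := h'
  refine ⟨fun w => (∃ y < w 0 + 1, Q (cns y (fun i => w (i+1)))) ∧ (∃ y < w 0 + 1, Q' (cns y (fun i => w (i+1)))), ?_, fun w => ?_⟩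
  · have hs : ∀ j, Pl (fun w => cns (w 0) (fun i => w (i+2)) j) := fun j => by
      cases j with
      | zero => exact Pl.var 0
      | succ j => exact Pl.var _
    refine D0.and ?_ ?_
    · exact (D0.bex (hQ.comp hs) ((Pl.var 0).add Pl.one))
    · exact (D0.bex (hQ'.comp hs) ((Pl.var 0).add Pl.one))
  · beta_reduce; rw [h, h']; simp only [cns_zero, cns_succ]
    constructor
    · rintro ⟨⟨y, hy⟩, ⟨z, hz⟩⟩
      exact ⟨y + z, ⟨y, by omega, hy⟩, ⟨z, by omega, hz⟩⟩
    · rintro ⟨s, ⟨y, _, hy⟩, ⟨z, _, hz⟩⟩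
      exact ⟨⟨y, hy⟩, ⟨z, hz⟩⟩
theorem pl_a (j : ℕ) : Pl (fun w => cns (w 0) (cns (w 1) (fun i => w (i+3))) j) := by
  match j with
  | 0 => exact Pl.var 0
  | 1 => exact Pl.var 1
  | j+2 => exact Pl.var _
theorem E1.ex {R : (ℕ → ℕ) → Prop} (h : E1 R) : E1 (fun w => ∃ x, R (cns x w)) := by
  obtain ⟨Q, hQ, h⟩ := h
  refine ⟨fun w => ∃ x < w 0 + 1, ∃ y < w 0 + 1, Q (cns y (cns x (fun i => w (i+1)))), ?_, fun w => ?_⟩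
  · exact D0.bex (R := fun w => ∃ y < w 1 + 1, Q (cns y (cns (w 0) (fun i => w (i+2)))))
      (D0.bex (R := fun w => Q (cns (w 0) (cns (w 1) (fun i => w (i+3))))) (hQ.comp pl_a) ((Pl.var 1).add Pl.one)) ((Pl.var 0).add Pl.one)
  · simp only [h, cns_zero, cns_succ]
    constructor
    · rintro ⟨x, y, hy⟩
      exact ⟨x + y, x, by omega, y, by omega, hy⟩
    · rintro ⟨_, x, _, y, _, hy⟩
      exact ⟨x, y, hy⟩
theorem E1.ball {R : (ℕ → ℕ) → Prop} (h : E1 R) {p : (ℕ → ℕ) → ℕ} (hp : Pl p) : E1 (fun w => ∀ x < p w, R (cns x w)) := by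
  obtain ⟨Q, hQ, h⟩ := h
  refine ⟨fun w => ∀ x < p (fun i => w (i+1)), ∃ y < w 0 + 1, Q (cns y (cns x (fun i => w (i+1)))), ?_, fun w => ?_⟩
  · exact D0.ball (R := fun w => ∃ y < w 1 + 1, Q (cns y (cns (w 0) (fun i => w (i+2)))))
      (D0.bex (R := fun w => Q (cns (w 0) (cns (w 1) (fun i => w (i+3))))) (hQ.comp pl_a) ((Pl.var 1).add Pl.one))
      (hp.comp fun j => Pl.var _)
  · simp only [h, cns_zero, cns_succ]
    constructor
    · intro h
      choose! f hf using h
      refine ⟨∑ x ∈ Finset.range (p w), f x, fun x hx => ⟨f x, ?_, hf x hx⟩⟩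
      exact Nat.lt_succ_of_le (Finset.single_le_sum (f := f) (fun _ _ => Nat.zero_le _) (Finset.mem_range.2 hx))
    · rintro ⟨_, h⟩ x hx
      obtain ⟨y, _, hy⟩ := h x hx
      exact ⟨y, hy⟩
end L2
end ArithFC

namespace ArithFC
section L2b

theorem E1.ex' {G : ℕ → (ℕ → ℕ) → Prop} (h : E1 (fun w => G (w 0) (fun i => w (i+1)))) : E1 (fun w => ∃ x, G x w) := h.ex
theorem E1.ball' {G : ℕ → (ℕ → ℕ) → Prop} {p : (ℕ → ℕ) → ℕ} (hp : Pl p) (h : E1 (fun w => G (w 0) (fun i => w (i+1)))) :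
    E1 (fun w => ∀ x < p w, G x w) := h.ball hp
theorem D0.bex' {G : ℕ → (ℕ → ℕ) → Prop} {p : (ℕ → ℕ) → ℕ} (hp : Pl p) (h : D0 (fun w => G (w 0) (fun i => w (i+1)))) :
    D0 (fun w => ∃ x < p w, G x w) := h.bex hp
theorem E1.s2 {G : ℕ → ℕ → Prop} (h : E1 (fun w => G (w 0) (w 1))) {p q : (ℕ → ℕ) → ℕ} (hp : Pl p) (hq : Pl q) :
    E1 (fun w => G (p w) (q w)) :=
  h.comp (σ := fun w => cns (p w) (cns (q w) (fun _ => 0))) (fun j => by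
    match j with
    | 0 => exact hp
    | 1 => exact hq
    | j+2 => exact Pl.zero)

theorem D0.pair {p q r : (ℕ → ℕ) → ℕ} (hp : Pl p) (hq : Pl q) (hr : Pl r) : D0 (fun w => p w = Nat.pair (q w) (r w)) := by
  refine (((D0.lt hq hr).and (D0.eq hp ((hr.mul hr).add hq))).or ((D0.lt hq hr).not.and (D0.eq hp (((hq.mul hq).add hq).add hr)))).congr fun w => ?_
  unfold Nat.pair
  split_ifs with h <;> simp [h]

/-- beta function graph -/
def Bt (a b i x : ℕ) : Prop := x < (i+1)*b+1 ∧ ∃ q < a + 1, a = q * ((i+1)*b+1) + x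
theorem Bt_iff {a b i x : ℕ} : Bt a b i x ↔ a % ((i+1)*b+1) = x := by
  constructor
  · rintro ⟨h, q, _, h'⟩
    rw [h', Nat.mul_add_mod', Nat.mod_eq_of_lt h]
  · rintro rfl
    refine ⟨Nat.mod_lt _ (by omega), a / ((i+1)*b+1), ?_, (Nat.div_add_mod' _ _).symm⟩
    exact Nat.lt_succ_of_le (Nat.div_le_self _ _)
theorem Bt_ex (l : List ℕ) : ∃ a b, ∀ i < l.length, Bt a b i (l.getD i 0) := by
  refine ⟨(Nat.unbeta l).unpair.1, (Nat.unbeta l).unpair.2, fun i hi => ?_⟩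
  have := Nat.beta_unbeta_coe l ⟨i, hi⟩
  rw [Nat.beta] at this
  rw [Bt_iff, List.getD_eq_getElem _ _ hi]
  exact this
theorem D0.bt {a b i x : (ℕ → ℕ) → ℕ} (ha : Pl a) (hb : Pl b) (hi : Pl i) (hx : Pl x) : D0 (fun w => Bt (a w) (b w) (i w) (x w)) := by
  have hm := ((hi.add Pl.one).mul hb).add Pl.one
  refine (D0.lt hx hm).and (D0.bex' (ha.add Pl.one) ?_)
  have hs : ∀ j, Pl (fun w : ℕ → ℕ => w (j+1)) := fun j => Pl.var _
  exact D0.eq (ha.comp (σ := fun w i => w (i+1)) hs) (((Pl.var 0).mul (hm.comp (σ := fun w i => w (i+1)) hs)).add (hx.comp (σ := fun w i => w (i+1)) hs))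

theorem prec_mem {f g : ℕ →. ℕ} (a m y : ℕ) :
    (y ∈ (Nat.rec (f a) (fun i IH => IH.bind fun v => g (Nat.pair a (Nat.pair i v))) m : Part ℕ)) ↔
    ∃ s : ℕ → ℕ, s 0 ∈ f a ∧ (∀ i < m, s (i+1) ∈ g (Nat.pair a (Nat.pair i (s i)))) ∧ s m = y := by
  induction m generalizing y with
  | zero =>
    constructor
    · intro h; exact ⟨fun _ => y, h, by simp, rfl⟩
    · rintro ⟨s, h, _, rfl⟩; exact h
  | succ m ih =>
    simp only [Part.mem_bind_iff, ih]
    constructor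
    · rintro ⟨v, ⟨s, h1, h2, rfl⟩, h⟩
      refine ⟨fun i => if i ≤ m then s i else y, by simpa using h1, fun i hi => ?_, by simp⟩
      rcases Nat.lt_succ_iff_lt_or_eq.1 hi with h3 | rfl
      · simpa [h3.le, Nat.succ_le_of_lt h3] using h2 i h3
      · simpa using h
    · rintro ⟨s, h1, h2, rfl⟩
      exact ⟨s m, ⟨s, h1, fun i hi => h2 i (by omega), rfl⟩, h2 m (by omega)⟩

theorem partrec_E1 {f : ℕ →. ℕ} (hf : Nat.Partrec f) : E1 (fun w => w 1 ∈ f (w 0)) := by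
  induction hf with
  | zero =>
    refine (E1.of (D0.eq (Pl.var 1) Pl.zero)).congr fun w => ?_
    exact (Part.mem_some_iff (a := 0) (b := w 1)).symm
  | succ => exact (E1.of (D0.eq (Pl.var 1) ((Pl.var 0).add Pl.one))).congr fun w => by simp
  | left =>
    refine E1.congr (R := fun w => ∃ z, w 0 = Nat.pair (w 1) z) (E1.ex' ?_) fun w => ?_
    · exact E1.of (D0.pair (Pl.var 1) (Pl.var 2) (Pl.var 0))
    · simp only [PFun.coe_val, Part.mem_some_iff]
      exact ⟨fun ⟨z, hz⟩ => by rw [hz, Nat.unpair_pair], fun h => ⟨(w 0).unpair.2, by rw [h, Nat.pair_unpair]⟩⟩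
  | right =>
    refine E1.congr (R := fun w => ∃ z, w 0 = Nat.pair z (w 1)) (E1.ex' ?_) fun w => ?_
    · exact E1.of (D0.pair (Pl.var 1) (Pl.var 0) (Pl.var 2))
    · simp only [PFun.coe_val, Part.mem_some_iff]
      exact ⟨fun ⟨z, hz⟩ => by rw [hz, Nat.unpair_pair], fun h => ⟨(w 0).unpair.1, by rw [h, Nat.pair_unpair]⟩⟩
  | @pair f g _ _ ihf ihg =>
    refine E1.congr (R := fun w => ∃ a, ∃ b, (a ∈ f (w 0) ∧ b ∈ g (w 0)) ∧ w 1 = Nat.pair a b) (E1.ex' (E1.ex' ?_)) fun w => ?_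
    · exact ((E1.s2 (G := fun x y => y ∈ f x) ihf (Pl.var 2) (Pl.var 1)).and (E1.s2 (G := fun x y => y ∈ g x) ihg (Pl.var 2) (Pl.var 0))).and
        (E1.of (D0.pair (Pl.var 3) (Pl.var 1) (Pl.var 0)))
    · simp [Seq.seq, eq_comm, and_assoc]
  | @comp f g _ _ ihf ihg =>
    refine E1.congr (R := fun w => ∃ a, a ∈ g (w 0) ∧ w 1 ∈ f a) (E1.ex' ?_) fun w => ?_
    · exact ((E1.s2 (G := fun x y => y ∈ g x) ihg (Pl.var 1) (Pl.var 0)).and (E1.s2 (G := fun x y => y ∈ f x) ihf (Pl.var 0) (Pl.var 2)))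
    · exact Part.mem_bind_iff.symm
  | @prec f g _ _ ihf ihg =>
    refine E1.congr (R := fun w => ∃ a, ∃ m, ∃ A, ∃ B, (w 0 = Nat.pair a m ∧ Bt A B m (w 1)) ∧ (∃ v, v ∈ f a ∧ Bt A B 0 v) ∧
      ∀ i < m, ∃ u, ∃ v, ∃ p1, ∃ p2, (Bt A B i u ∧ Bt A B (i+1) v) ∧ (p1 = Nat.pair i u ∧ p2 = Nat.pair a p1) ∧ v ∈ g p2) ?_ fun w => ?_
    · refine E1.ex' (E1.ex' (E1.ex' (E1.ex' (E1.and (E1.of ?_) (E1.and (E1.ex' (E1.and ?_ (E1.of ?_))) (E1.ball' (Pl.var 2) (E1.ex' (E1.ex' (E1.ex' (E1.ex' (E1.and (E1.of (D0.and ?_ ?_)) (E1.and (E1.of (D0.and ?_ ?_)) ?_)))))))))))) 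
      · exact (D0.pair (Pl.var 4) (Pl.var 3) (Pl.var 2)).and (D0.bt (Pl.var 1) (Pl.var 0) (Pl.var 2) (Pl.var 5))
      · exact (E1.s2 (G := fun x y => y ∈ f x) ihf (Pl.var 4) (Pl.var 0))
      · exact (D0.bt (Pl.var 2) (Pl.var 1) Pl.zero (Pl.var 0))
      -- p2 p1 v u i B A m a
      · exact (D0.bt (Pl.var 6) (Pl.var 5) (Pl.var 4) (Pl.var 3))
      · exact (D0.bt (Pl.var 6) (Pl.var 5) ((Pl.var 4).add Pl.one) (Pl.var 2))
      · exact (D0.pair (Pl.var 1) (Pl.var 4) (Pl.var 3))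
      · exact (D0.pair (Pl.var 0) (Pl.var 8) (Pl.var 1))
      · exact (E1.s2 (G := fun x y => y ∈ g x) ihg (Pl.var 0) (Pl.var 2))
    · have := prec_mem (f := f) (g := g) (w 0).unpair.1 (w 0).unpair.2 (w 1)
      simp only [Nat.unpaired, Part.bind_eq_bind]
      rw [this]
      constructor
      · rintro ⟨a, m, A, B, ⟨h1, h2⟩, ⟨v, h3, h4⟩, h5⟩
        rw [h1]; simp only [Nat.unpair_pair]
        refine ⟨fun i => A % ((i+1)*B+1), ?_, fun i hi => ?_, Bt_iff.1 h2⟩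
        · show A % ((0+1)*B+1) ∈ f a
          rw [Bt_iff.1 h4]; exact h3
        · obtain ⟨u, v, p1, p2, ⟨h6, h7⟩, ⟨rfl, rfl⟩, h8⟩ := h5 i hi
          rw [Bt_iff] at h6 h7
          show A % ((i+1+1)*B+1) ∈ g (Nat.pair a (Nat.pair i (A % ((i+1)*B+1))))
          rw [h6, h7]; exact h8
      · rintro ⟨s, h1, h2, h3⟩
        obtain ⟨A, B, hAB⟩ := Bt_ex ((List.range ((w 0).unpair.2 + 1)).map s)
        have hAB' : ∀ i ≤ (w 0).unpair.2, Bt A B i (s i) := fun i hi => by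
          have := hAB i (by simp; omega)
          rwa [List.getD_eq_getElem _ _ (by simp; omega), List.getElem_map, List.getElem_range] at this
        refine ⟨_, _, A, B, ⟨(Nat.pair_unpair _).symm, h3 ▸ hAB' _ le_rfl⟩, ⟨_, h1, hAB' 0 (Nat.zero_le _)⟩, fun i hi => ?_⟩
        exact ⟨s i, s (i+1), _, _, ⟨hAB' i hi.le, hAB' (i+1) hi⟩, ⟨rfl, rfl⟩, h2 i hi⟩
  | @rfind f _ ihf =>
    refine E1.congr (R := fun w => (∃ p, p = Nat.pair (w 0) (w 1) ∧ 0 ∈ f p) ∧ ∀ i < w 1, ∃ p, ∃ v, (p = Nat.pair (w 0) i ∧ ¬ v = 0) ∧ v ∈ f p) ?_ fun w => ?_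
    · refine (E1.ex' (E1.and (E1.of ?_) ?_)).and (E1.ball' (Pl.var 1) (E1.ex' (E1.ex' (E1.and (E1.of (D0.and ?_ ?_)) ?_))))
      · exact (D0.pair (Pl.var 0) (Pl.var 1) (Pl.var 2))
      · exact (E1.s2 (G := fun x y => y ∈ f x) ihf (Pl.var 0) Pl.zero)
      · exact (D0.pair (Pl.var 1) (Pl.var 3) (Pl.var 2))
      · exact (D0.eq (Pl.var 0) Pl.zero).not
      · exact (E1.s2 (G := fun x y => y ∈ f x) ihf (Pl.var 1) (Pl.var 0))
    · simp only [exists_eq_left]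
      refine Iff.trans ?_ (Nat.mem_rfind (p := fun k => (f (Nat.pair (w 0) k)).map (fun m => decide (m = 0)))).symm
      simp only [Part.mem_map_iff, decide_eq_true_eq, decide_eq_false_iff_not, exists_eq_right]
      refine and_congr Iff.rfl (forall_congr' fun i => imp_congr_right fun _ => ?_)
      constructor
      · rintro ⟨p, v, ⟨rfl, h⟩, h'⟩; exact ⟨v, h', h⟩
      · rintro ⟨v, h', h⟩; exact ⟨_, v, ⟨rfl, h⟩, h'⟩

/-- general cons -/
def cnsG {A : Type} (y : A) (w : ℕ → A) : ℕ → A := fun j => Nat.casesOn j y w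
theorem Sg.hs {m : ℕ} : ∀ {P : ℕ → Prop}, Sg (m+1) P → HS (m+1) (fun w => P (w 0)) := by
  induction m with
  | zero =>
    intro P ⟨Q, ⟨f, hf, hQ⟩, h⟩
    have hg : Computable (fun k : ℕ => Encodable.encode (f k.unpair)) := Computable.encode.comp (hf.comp Computable.unpair)
    have hg' := partrec_E1 (Partrec.nat_iff.1 hg)
    refine (E1.congr (R := fun w => ∃ y, ∃ z, z = Nat.pair (w 0) y ∧ 0 ∈ (fun k : ℕ => Part.some (Encodable.encode (f k.unpair))) z) (E1.ex' (E1.ex' (E1.and (E1.of ?_) ?_))) fun w => ?_).hs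
    · exact (D0.pair (Pl.var 0) (Pl.var 2) (Pl.var 1))
    · exact E1.s2 (G := fun x y => y ∈ (fun k : ℕ => Part.some (Encodable.encode (f k.unpair))) x) hg' (Pl.var 0) Pl.zero
    · simp only [h, hQ, exists_eq_left, Part.mem_some_iff, Nat.unpair_pair]
      refine exists_congr fun y => ?_
      cases f (w 0, y) <;> simp
  | succ m ih =>
    intro P ⟨Q, hQ, h⟩
    have h1 := ih (hQ.comp Computable.unpair)
    have h2 : D0 (fun w => ¬ ∃ y < w 0 + 1, w 0 = Nat.pair (w 1) y) := (D0.bex' ((Pl.var 0).add Pl.one) (D0.pair (Pl.var 1) (Pl.var 2) (Pl.var 0))).not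
    refine ⟨_, (HS.and_or h1 h2).2, fun w => ?_⟩
    simp only [h, cns_zero, cns_one, not_or, not_not]
    constructor
    · rintro ⟨y, hy⟩
      exact ⟨Nat.pair (w 0) y, ⟨y, Nat.lt_succ_of_le (Nat.right_le_pair _ _), rfl⟩, by simpa using hy⟩
    · rintro ⟨z, ⟨y, _, rfl⟩, hz⟩
      exact ⟨y, by simpa using hz⟩

/-- term environment for three variables -/
def cnsT : ℕ → lang.Term ((Fin 2 ⊕ Fin 1) ⊕ Fin 0) :=
  cnsG (Term.var (Sum.inl (Sum.inl 0))) (cnsG (Term.var (Sum.inl (Sum.inl 1))) fun _ => Term.var (Sum.inl (Sum.inr 0)))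
theorem Sg.fm3 {m : ℕ} {P : (ℕ × ℕ) × ℕ → Prop} (hP : Sg (m+2) P) :
    ∃ φ : lang.BoundedFormula (Fin 2 ⊕ Fin 1) 0, SigmaFm (m+2) 0 φ ∧
      ∀ v xs, FN φ v xs ↔ P ((v (Sum.inl 0), v (Sum.inl 1)), v (Sum.inr 0)) := by
  obtain ⟨Q, hQ, h⟩ := hP
  have h1 := (hQ.comp (f := fun k : ℕ => ((k.unpair.1.unpair.1.unpair, k.unpair.1.unpair.2), k.unpair.2)) (by
    have hu : Computable Nat.unpair := Computable.unpair
    have a := Computable.fst.comp hu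
    exact Computable.pair (Computable.pair (hu.comp (a.comp a)) (Computable.snd.comp (hu.comp a))) (Computable.snd.comp hu))).hs
  have h2 : HS (m+2) (fun w => P ((w 0, w 1), w 2)) := by
    have h2 : D0 (fun w => ¬ ∃ y < w 0 + 1, ∃ a < w 0 + 1, ∃ b < w 0 + 1, (w 0 = Nat.pair a y ∧ a = Nat.pair b (w 3)) ∧ b = Nat.pair (w 1) (w 2)) := by
      refine D0.not (D0.bex' ((Pl.var 0).add Pl.one) (D0.bex' ((Pl.var 1).add Pl.one) (D0.bex' ((Pl.var 2).add Pl.one) ?_)))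
      exact ((D0.pair (Pl.var 3) (Pl.var 1) (Pl.var 2)).and (D0.pair (Pl.var 1) (Pl.var 0) (Pl.var 6))).and (D0.pair (Pl.var 0) (Pl.var 4) (Pl.var 5))
    refine ⟨_, (HS.and_or h1 h2).2, fun w => ?_⟩
    simp only [h, cns_zero, cns_one, cns_two, cns_three, not_or, not_not]
    constructor
    · rintro ⟨y, hy⟩
      refine ⟨Nat.pair (Nat.pair (Nat.pair (w 0) (w 1)) (w 2)) y, ⟨y, Nat.lt_succ_of_le (Nat.right_le_pair _ _), _, Nat.lt_succ_of_le (Nat.left_le_pair _ _), _,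
        Nat.lt_succ_of_le ((Nat.left_le_pair _ _).trans (Nat.left_le_pair _ _)), ⟨rfl, rfl⟩, rfl⟩, by simpa using hy⟩
    · rintro ⟨z, ⟨y, _, a, _, b, _, ⟨h1, rfl⟩, rfl⟩, hz⟩
      exact ⟨y, by simpa [h1] using hz⟩
  obtain ⟨φ, h3, h4⟩ := (h2.fm (Fin 2 ⊕ Fin 1) 0 (cnsT)).1
  exact ⟨φ, h3, fun v xs => h4 v xs⟩
end L2b
end ArithFC

namespace ArithFC
section L2c
variable {n : ℕ} {S : Mod n}

theorem sd2 (hn : 1 ≤ n) {P : (ℕ × ℕ) × ℕ → Prop} (hP : DD n P) {c : ℕ → ℕ} (hc : S.SS c) :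
    ∃ R : MM S → MM S → Prop, SigmaDef2 (n+1) (MM S) R ∧
      ∀ x y, S.SS x → S.SS y → (R (S.mk x) (S.mk y) ↔ ∀ᶠ i in UF, P ((x i, y i), c i)) := by
  obtain ⟨m, rfl⟩ : ∃ m, n = m + 1 := ⟨n - 1, by omega⟩
  obtain ⟨φ, h1, h2⟩ := hP.1.fm3
  let pv : (Fin 2 ⊕ Fin 1) → (ℕ × ℕ) × ℕ → ℕ := Sum.elim ![fun p => p.1.1, fun p => p.1.2] (fun _ p => p.2)
  have hpv : ∀ a, Computable (pv a) := by
    intro a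
    rcases a with a | a
    · fin_cases a
      · exact Computable.fst.comp Computable.fst
      · exact Computable.snd.comp Computable.fst
    · exact Computable.snd
  obtain ⟨Q, hQ, h3, h4⟩ := losS1 (S := S) h1 rfl hpv (px := fun (j : Fin 0) => j.elim0) (fun j => j.elim0)
  have h3' : ∀ a, P a ↔ ∃ w, Q (a, w) := fun a => by
    rw [← h3]; unfold TN; exact (h2 (fun b => pv b a) _).symm
  refine ⟨fun x y => φ.Realize (M := MM S) (Sum.elim ![x, y] (fun _ => S.mk c)) finZeroElim, ⟨1, φ, fun _ => S.mk c, h1, fun v => ?_⟩, fun x y hx hy => ?_⟩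
  · refine Eq.to_iff ?_
    beta_reduce
    congr 2
    funext j; fin_cases j <;> rfl
  · have hg : S.SS (fun i => ((x i, y i), c i)) := (hx.pair hy).pair hc
    have h5 := h4 hg
    refine Iff.trans (Eq.to_iff ?_) (h5.trans ?_)
    · unfold TM
      beta_reduce
      congr 1
      · funext a
        rcases a with a | a
        · fin_cases a <;> rfl
        · rfl
      · funext j; exact j.elim0
    · constructor
      · rintro ⟨w, hw, h⟩
        exact h.mono fun i hi => (h3' _).2 ⟨_, hi⟩
      · intro h
        exact S.search hP hQ (fun a ha => (h3' a).1 ha) hg h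
end L2c
end ArithFC

namespace ArithFC

theorem exists_digits (B d : ℕ) (hB : 0 < B) (f : ℕ → ℕ) : ∃ q < B ^ d, ∀ u < d, q / B ^ u % B = f u % B := by
  induction d generalizing f with
  | zero => exact ⟨0, by simp, by simp⟩
  | succ d ih =>
    obtain ⟨q, hq, h⟩ := ih (fun u => f (u+1))
    refine ⟨f 0 % B + B * q, ?_, ?_⟩
    · rw [pow_succ']
      have := Nat.mod_lt (f 0) hB
      calc f 0 % B + B * q < B + B * q := by omega
        _ = B * (q + 1) := by ring
        _ ≤ B * B ^ d := Nat.mul_le_mul_left _ hq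
    · intro u hu
      cases u with
      | zero => simp
      | succ u =>
        rw [← h u (by omega), pow_succ', ← Nat.div_div_eq_div_mul, Nat.add_mul_div_left _ _ hB, Nat.div_eq_of_lt (Nat.mod_lt _ hB), zero_add]

theorem cnt_eq (P : ℕ → Prop) [DecidablePred P] (b : ℕ) : cnt P b = ((Finset.range b).filter P).card := by
  unfold cnt; congr

theorem cnt_mono {P Q : ℕ → Prop} {b : ℕ} (h : ∀ j < b, P j → Q j) : cnt P b ≤ cnt Q b := by
  classical
  rw [cnt_eq, cnt_eq]
  refine Finset.card_le_card ?_
  intro j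
  simp only [Finset.mem_filter, Finset.mem_range]
  exact fun hj => ⟨hj.1, h j hj.1 hj.2⟩

theorem cnt_pigeon (c N : ℕ) (hc : 0 < c) (D : ℕ → ℕ) (hD : ∀ j, D j < c) : ∃ v < c, c * cnt (fun j => D j = v) N ≤ N := by
  classical
  by_contra hcon
  push Not at hcon
  have h1 : (Finset.range N).card = ∑ v ∈ Finset.range c, ((Finset.range N).filter (fun j => D j = v)).card :=
    Finset.card_eq_sum_card_fiberwise (fun j _ => by simpa using hD j)
  have h2 : ∑ v ∈ Finset.range c, N < ∑ v ∈ Finset.range c, c * ((Finset.range N).filter (fun j => D j = v)).card := by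
    refine Finset.sum_lt_sum_of_nonempty ⟨0, by simpa using hc⟩ fun v hv => ?_
    have := hcon v (by simpa using hv)
    rwa [cnt_eq] at this
  rw [← Finset.mul_sum, ← h1] at h2
  simp at h2

/-- `y` is the least witness of the `e`-th relation at `pair c e`. -/
def TT (m e c y : ℕ) : Prop := ¬ Un m e (Nat.pair (Nat.pair c e) y) ∧ ∀ y' < y, Un m e (Nat.pair (Nat.pair c e) y')

/-- `u` is removed at stage `y`. -/
def RR (m u y c : ℕ) : Prop := ∃ e < c, TT m e c y ∧ u / c ^ e % c ≠ y.unpair.1 % c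

/-- The elements not removed before stage `s`. -/
def UU (m s c u : ℕ) : Prop := u < c ^ c ∧ ∀ y < s, ¬ RR m u y c

variable {m n : ℕ}

theorem TT.uniq {e c y y' : ℕ} (h : TT m e c y) (h' : TT m e c y') : y = y' := by
  rcases lt_trichotomy y y' with hl | hl | hl
  · exact absurd (h'.2 y hl) h.1
  · exact hl
  · exact absurd (h.2 y' hl) h'.1

theorem DD.TT {α : Type} [Primcodable α] [Inhabited α] {f g h : α → ℕ} (hf : AA (m+1) f) (hg : AA (m+1) g) (hh : AA (m+1) h) :
    DD (m+1) (fun a => TT m (f a) (g a) (h a)) := by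
  have h1 : DD (m+1) (fun p : ℕ × ℕ => Un m p.1 p.2) := DD.of_sg (Sg.un m) le_rfl
  unfold ArithFC.TT
  refine DD.and (DD.not (h1.comp (f := fun a => (f a, Nat.pair (Nat.pair (g a) (f a)) (h a))) (by fun_prop))) ?_
  refine DD.ball (P := fun q : α × ℕ => Un m (f q.1) (Nat.pair (Nat.pair (g q.1) (f q.1)) q.2)) ?_ hh
  have hf' := hf.comp (AA.fst (α := α) (β := ℕ)); have hg' := hg.comp (AA.fst (α := α) (β := ℕ))
  exact (h1.comp (f := fun q : α × ℕ => (f q.1, Nat.pair (Nat.pair (g q.1) (f q.1)) q.2)) (by fun_prop))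

theorem AA.dig {α : Type} [Primcodable α] [Inhabited α] {u e c : α → ℕ} (hu : AA n u) (he : AA n e) (hc : AA n c) :
    AA n (fun a => u a / c a ^ e a % c a) := by
  have := AA.pow hc he
  fun_prop

theorem DD.UU {α : Type} [Primcodable α] [Inhabited α] {s c u : α → ℕ} (hs : AA (m+1) s) (hc : AA (m+1) c) (hu : AA (m+1) u) :
    DD (m+1) (fun a => UU m (s a) (c a) (u a)) := by
  unfold ArithFC.UU
  refine DD.and (DD.lt hu (AA.pow hc hc)) ?_
  have hc' := hc.comp (AA.fst (n := m+1) (α := α) (β := ℕ)); have hu' := hu.comp (AA.fst (n := m+1) (α := α) (β := ℕ))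
  refine DD.ball (P := fun q : α × ℕ => ¬ RR m (u q.1) q.2 (c q.1)) (DD.not ?_) hs
  unfold ArithFC.RR
  have hc2 := hc'.comp (AA.fst (n := m+1) (α := α × ℕ) (β := ℕ)); have hu2 := hu'.comp (AA.fst (n := m+1) (α := α × ℕ) (β := ℕ))
  refine DD.bex (P := fun q : (α × ℕ) × ℕ => ArithFC.TT m q.2 (c q.1.1) q.1.2 ∧ u q.1.1 / c q.1.1 ^ q.2 % c q.1.1 ≠ q.1.2.unpair.1 % c q.1.1) ?_ hc'
  refine DD.and (DD.TT (by fun_prop) hc2 (by fun_prop)) (DD.not (DD.eq (AA.dig hu2 (by fun_prop) hc2) ?_))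
  exact AA.mod (by fun_prop) hc2

theorem UU.anti {s s' c u : ℕ} (h : s ≤ s') (hu : UU m s' c u) : UU m s c u := ⟨hu.1, fun y hy => hu.2 y (by omega)⟩

theorem UU.nonempty (s c : ℕ) (hc : 0 < c) : ∃ u, UU m s c u := by
  classical
  obtain ⟨q, hq, h⟩ := exists_digits c c hc (fun e => if h : ∃ y, TT m e c y then h.choose.unpair.1 else 0)
  refine ⟨q, hq, fun y _ => ?_⟩
  rintro ⟨e, he, hT, hne⟩
  refine hne ?_
  rw [h e he]
  have hex : ∃ y, TT m e c y := ⟨y, hT⟩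
  rw [dif_pos hex, hex.choose_spec.uniq hT]

/-- The invariant. -/
def Inv (U : ℕ → ℕ → ℕ → Prop) (S : Mod n) : Prop := ∀ f : ℕ × ℕ → ℕ, AA n f → ∀ a N, S.SS a → S.SS N → ∀ r : ℕ,
  ∃ s : ℕ → ℕ, S.SS s ∧ ∀ᶠ i in UF, r * cnt (fun j => U (s i) i (f (a i, j))) (N i) ≤ N i

/-- The base model. -/
def S0 (n : ℕ) : Mod n where
  S := {f | AA n f}
  pair {x y} hx hy := by
    have hx : AA n x := hx
    have hy : AA n y := hy
    show AA n (fun i => Nat.pair (x i) (y i)); fun_prop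
  app {f x} hf hx := by
    have hx : AA n x := hx
    exact hf.comp hx
  id := AA.id (α := ℕ)

theorem S0_countable (n : ℕ) : (S0 n).S.Countable := AA.countable n

theorem ev_gt (e : ℕ) : ∀ᶠ i in UF, e < i := by
  have : ∀ᶠ i in Filter.cofinite, e < i := by
    rw [Nat.cofinite_eq_atTop]; exact Filter.eventually_gt_atTop e
  exact Filter.hyperfilter_le_cofinite this

theorem inv_S0 (m : ℕ) : Inv (UU m) (S0 (m+1)) := by
  intro f hf a N ha hN r
  have ha : AA (m+1) a := ha
  have hN : AA (m+1) N := hN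
  have hN1 := hN.comp (AA.comp (AA.fst (n := m+1) (α := ℕ) (β := ℕ)) (AA.fst (α := ℕ × ℕ) (β := ℕ)))
  have ha1 := ha.comp (AA.comp (AA.fst (n := m+1) (α := ℕ) (β := ℕ)) (AA.comp (AA.fst (α := ℕ × ℕ) (β := ℕ)) (AA.fst (α := (ℕ × ℕ) × ℕ) (β := ℕ))))
  have hfa : AA (m+1) (fun q : ((ℕ × ℕ) × ℕ) × ℕ => f (a q.1.1.1, q.2)) := hf.comp (ha1.pair AA.snd)
  -- phi
  obtain ⟨φ, hφ, hφ'⟩ := AA.search (n := m+1) (P := fun p : ℕ × ℕ => 0 < p.1)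
    (DD.lt (by fun_prop) (by fun_prop))
    (Q := fun q : (ℕ × ℕ) × ℕ => q.2 < q.1.1 ∧ q.1.1 * cnt (fun j => f (a q.1.1, j) / q.1.1 ^ q.1.2 % q.1.1 = q.2) (N q.1.1) ≤ N q.1.1)
    (by
      refine DD.and (DD.lt (by fun_prop) (by fun_prop)) (DD.le (AA.mul (by fun_prop) ?_) hN1)
      refine AA.cnt (P := fun q : ((ℕ × ℕ) × ℕ) × ℕ => f (a q.1.1.1, q.2) / q.1.1.1 ^ q.1.1.2 % q.1.1.1 = q.1.2) ?_ hN1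
      exact DD.eq (AA.dig hfa (by fun_prop) (by fun_prop)) (by fun_prop))
    (fun p hp => cnt_pigeon p.1 (N p.1) hp (fun j => f (a p.1, j) / p.1 ^ p.2 % p.1) fun j => Nat.mod_lt _ hp)
  obtain ⟨Q, hQ, hQφ⟩ := (show Sg (m+1+1) (fun p : (ℕ × ℕ) × ℕ => φ p.1 = p.2) from hφ)
  have hc : Computable (fun x : ℕ => (((x.unpair.1.unpair.1, x.unpair.1.unpair.2), x.unpair.2.unpair.1), x.unpair.2.unpair.2)) := by
    have h1 : Primrec (fun x : ℕ => x.unpair.1) := Primrec.fst.comp Primrec.unpair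
    have h2 : Primrec (fun x : ℕ => x.unpair.2) := Primrec.snd.comp Primrec.unpair
    exact (Primrec.pair (Primrec.pair (Primrec.pair (h1.comp h1) (h2.comp h1)) (h1.comp h2)) (h2.comp h2)).to_comp
  obtain ⟨e, he⟩ := Sg.exists_un m (hQ.comp hc)
  have he' : ∀ c y, Un m e (Nat.pair (Nat.pair c e) y) ↔ Q (((c, e), y.unpair.1), y.unpair.2) := by
    intro c y; rw [← he]; simp
  have hex : ∀ c, ∃ y, TT m e c y := by
    intro c
    classical
    have hy : ∃ y, ¬ Un m e (Nat.pair (Nat.pair c e) y) := by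
      obtain ⟨z, hz⟩ := (hQφ ((c, e), φ (c, e))).1 rfl
      refine ⟨Nat.pair (φ (c,e)) z, ?_⟩
      rw [he']; simpa using hz
    exact ⟨Nat.find hy, Nat.find_spec hy, fun y' h => by_contra fun h' => Nat.find_min hy h h'⟩
  obtain ⟨y, hy, hy'⟩ := AA.searchT (n := m+1) (Q := fun q : ℕ × ℕ => TT m e q.1 q.2) (DD.TT (by fun_prop) (by fun_prop) (by fun_prop)) hex
  refine ⟨fun c => y c + 1, by show AA (m+1) (fun c => y c + 1); fun_prop, ?_⟩
  filter_upwards [ev_gt e, ev_gt r] with c h1 h2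
  have hT := hy' c
  have hval : (y c).unpair.1 = φ (c, e) := by
    have := hT.1
    rw [he'] at this
    exact ((hQφ _).2 ⟨_, this⟩).symm
  have hc0 : 0 < c := by omega
  have hph := hφ' (c, e) hc0
  replace hph : φ (c, e) < c ∧ c * cnt (fun j => f (a c, j) / c ^ e % c = φ (c, e)) (N c) ≤ N c := hph
  refine le_trans (Nat.mul_le_mul h2.le (cnt_mono fun j hj hu => ?_)) hph.2
  by_contra hne
  refine hu.2 (y c) (by omega) ⟨e, h1, hT, ?_⟩
  rw [hval, Nat.mod_eq_of_lt hph.1]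
  exact hne

theorem not_bsig (S : Mod (m+1)) (h : Inv (UU m) S) : ¬ BSig (m+1+1) (MM S) := by
  intro hB
  have hRR : DD (m+1) (fun p : (ℕ × ℕ) × ℕ => ¬ UU m p.1.2 p.2 p.1.1) := DD.not (DD.UU (by fun_prop) (by fun_prop) (by fun_prop))
  obtain ⟨R, hR, hR'⟩ := sd2 (S := S) (by omega) hRR (c := fun i => i) Mod.SS.cid
  have hd : S.SS (fun i => i ^ i) := Mod.SS.cid.app (f := fun i => i ^ i) (AA.pow AA.id AA.id)
  have hB' := hB R hR (S.mk fun i => i ^ i)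
  refine absurd (hB' ?_) ?_
  rotate_left
  · rintro ⟨b, hb⟩
    obtain ⟨b, hb', rfl⟩ := S.exists_rep b
    obtain ⟨u, hu, hu'⟩ := S.search (P := fun p : ℕ × ℕ => 0 < p.1) (Q := fun q : (ℕ × ℕ) × ℕ => UU m q.1.2 q.1.1 q.2)
      (DD.lt (by fun_prop) (by fun_prop)) (DD.UU (by fun_prop) (by fun_prop) (by fun_prop))
      (fun p hp => UU.nonempty p.2 p.1 hp) (Mod.SS.cid.pair hb') (ev_gt 0)
    obtain ⟨y, hy, hy'⟩ := hb (S.mk u) ((S.mk_lt hu hd).2 (hu'.mono fun i hi => hi.1))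
    obtain ⟨y, hyS, rfl⟩ := S.exists_rep y
    rw [S.mk_lt hyS hb'] at hy
    rw [hR' u y hu hyS] at hy'
    obtain ⟨i, ⟨h1, h2⟩, h3⟩ := ((hy.and hy').and hu').exists
    exact h2 (h3.anti h1.le)
  · intro u hu
    obtain ⟨u, huS, rfl⟩ := S.exists_rep u
    obtain ⟨s, hs, hs'⟩ := h (fun p => p.1) (by fun_prop) u (fun _ => 1) huS (Mod.SS.const 1) 2
    refine ⟨S.mk s, ?_⟩
    rw [hR' u s huS hs]
    refine hs'.mono fun i hi => ?_
    intro hU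
    have : cnt (fun j => UU m (s i) i (u i)) 1 = 1 := by classical simp [cnt_eq, hU]
    simp only [this] at hi
    omega
end ArithFC

namespace ArithFC
variable {n : ℕ} {U : ℕ → ℕ → ℕ → Prop}

/-- Cofinal extension. -/
def Ext (S S' : Mod n) : Prop := S.S ⊆ S'.S ∧ ∀ w ∈ S'.S, ∃ s ∈ S.S, ∀ᶠ i in UF, w i ≤ s i

theorem Ext.refl (S : Mod n) : Ext S S := ⟨subset_rfl, fun w hw => ⟨w, hw, Filter.Eventually.of_forall fun _ => le_rfl⟩⟩
theorem Ext.trans {S S' S'' : Mod n} (h : Ext S S') (h' : Ext S' S'') : Ext S S'' := by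
  refine ⟨h.1.trans h'.1, fun w hw => ?_⟩
  obtain ⟨s, hs, h1⟩ := h'.2 w hw
  obtain ⟨s', hs', h2⟩ := h.2 s hs
  exact ⟨s', hs', by filter_upwards [h1, h2] with i a b using a.trans b⟩
theorem Ext.ss {β : Type} [Primcodable β] {S S' : Mod n} (h : Ext S S') {x : ℕ → β} (hx : S.SS x) : S'.SS x := h.1 hx

/-- Countable and satisfies the invariant. -/
def Good (U : ℕ → ℕ → ℕ → Prop) (S : Mod n) : Prop := S.S.Countable ∧ Inv U S

theorem chain_mono {C : ℕ → Mod n} (h : ∀ k, Ext (C k) (C (k+1))) {k l : ℕ} (hkl : k ≤ l) : Ext (C k) (C l) := by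
  induction hkl with
  | refl => exact Ext.refl _
  | step _ ih => exact ih.trans (h _)

theorem exists_union {C : ℕ → Mod n} (h : ∀ k, Ext (C k) (C (k+1))) (hG : ∀ k, Good U (C k)) :
    ∃ S' : Mod n, Good U S' ∧ (∀ k, Ext (C k) S') ∧ ∀ w, w ∈ S'.S ↔ ∃ k, w ∈ (C k).S := by
  let S' : Mod n :=
    { S := ⋃ k, (C k).S
      pair := by
        intro x y hx hy
        simp only [Set.mem_iUnion] at *
        obtain ⟨k, hk⟩ := hx
        obtain ⟨l, hl⟩ := hy
        exact ⟨max k l, (C _).pair ((chain_mono h (le_max_left k l)).1 hk) ((chain_mono h (le_max_right k l)).1 hl)⟩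
      app := by
        intro f x hf hx
        simp only [Set.mem_iUnion] at *
        obtain ⟨k, hk⟩ := hx
        exact ⟨k, (C k).app hf hk⟩
      id := Set.mem_iUnion.2 ⟨0, (C 0).id⟩ }
  have hm : ∀ w, w ∈ S'.S ↔ ∃ k, w ∈ (C k).S := fun w => Set.mem_iUnion
  have hE : ∀ k, Ext (C k) S' := by
    intro k
    refine ⟨fun w hw => (hm w).2 ⟨k, hw⟩, fun w hw => ?_⟩
    obtain ⟨l, hl⟩ := (hm w).1 hw
    exact (chain_mono h (le_max_left k l)).2 w ((chain_mono h (le_max_right k l)).1 hl)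
  refine ⟨S', ⟨Set.countable_iUnion fun k => (hG k).1, ?_⟩, hE, hm⟩
  intro f hf a N ha hN r
  obtain ⟨k, hk⟩ := (hm a).1 ha
  obtain ⟨l, hl⟩ := (hm N).1 hN
  obtain ⟨s, hs, hs'⟩ := (hG (max k l)).2 f hf a N ((chain_mono h (le_max_left k l)).1 hk) ((chain_mono h (le_max_right k l)).1 hl) r
  exact ⟨s, (hE _).1 hs, hs'⟩

theorem exists_chain {X : ℕ → Mod n → Mod n → Prop}
    (h : ∀ k S, Good U S → ∃ S', Good U S' ∧ Ext S S' ∧ X k S S') (S : Mod n) (hS : Good U S) :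
    ∃ C : ℕ → Mod n, C 0 = S ∧ (∀ k, Good U (C k)) ∧ (∀ k, Ext (C k) (C (k+1))) ∧ ∀ k, X k (C k) (C (k+1)) := by
  choose g hg using h
  let D : ℕ → {S : Mod n // Good U S} := fun k => Nat.rec (motive := fun _ => {S : Mod n // Good U S}) ⟨S, hS⟩ (fun k T => ⟨g k T.1 T.2, (hg k T.1 T.2).1⟩) k
  exact ⟨fun k => (D k).1, rfl, fun k => (D k).2, fun k => (hg k (D k).1 (D k).2).2.1, fun k => (hg k (D k).1 (D k).2).2.2⟩

theorem exists_closed {ι : Type} [Countable ι] (H : ι → (ℕ → ℕ) → Mod n → Prop)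
    (step : ∀ S, Good U S → ∀ t q, q ∈ S.S → ∃ S', Good U S' ∧ Ext S S' ∧ H t q S')
    (mono : ∀ S S', Ext S S' → ∀ t q, q ∈ S.S → H t q S → H t q S') (S : Mod n) (hS : Good U S) :
    ∃ S', Good U S' ∧ Ext S S' ∧ ∀ t q, q ∈ S'.S → H t q S' := by
  have L2 : ∀ (k : ℕ) (S : Mod n), Good U S → ∃ S', Good U S' ∧ Ext S S' ∧ ∀ t q, q ∈ S.S → H t q S' := by
    intro _ S hS
    by_cases hι : Nonempty ι
    swap
    · exact ⟨S, hS, Ext.refl _, fun t => absurd ⟨t⟩ hι⟩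
    have hc : (Set.univ ×ˢ S.S : Set (ι × (ℕ → ℕ))).Countable := (Set.countable_univ).prod hS.1
    obtain ⟨t, ht⟩ := hc.exists_eq_range ⟨(hι.some, _), Set.mem_univ _, S.id⟩
    have htS : ∀ k, (t k).2 ∈ S.S := fun k => by
      have : t k ∈ (Set.univ ×ˢ S.S : Set (ι × (ℕ → ℕ))) := by rw [ht]; exact ⟨k, rfl⟩
      exact this.2
    obtain ⟨C, h0, h1, h2, h3⟩ := exists_chain (U := U) (X := fun k T T' => (t k).2 ∈ T.S → H (t k).1 (t k).2 T') (fun k T hT => by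
      by_cases hk : (t k).2 ∈ T.S
      · obtain ⟨T', a, b, c⟩ := step T hT (t k).1 (t k).2 hk
        exact ⟨T', a, b, fun _ => c⟩
      · exact ⟨T, hT, Ext.refl _, fun h => absurd h hk⟩) S hS
    obtain ⟨S', hS', hE, hm⟩ := exists_union h2 h1
    have hE0 : Ext S (C 0) := by rw [h0]; exact Ext.refl _
    refine ⟨S', hS', hE0.trans (hE 0), fun t' q hq => ?_⟩
    have : (t', q) ∈ (Set.univ ×ˢ S.S : Set (ι × (ℕ → ℕ))) := ⟨Set.mem_univ _, hq⟩
    rw [ht] at this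
    obtain ⟨k, hk⟩ := this
    have e1 : (t k).1 = t' := by rw [hk]
    have e2 : (t k).2 = q := by rw [hk]
    have hh := h3 k ((hE0.trans (chain_mono h2 (Nat.zero_le k))).1 (htS k))
    rw [e1, e2] at hh
    exact mono _ _ (hE (k+1)) _ _ ((hE0.trans (chain_mono h2 (Nat.zero_le _))).1 hq) hh
  obtain ⟨C, h0, h1, h2, h3⟩ := exists_chain L2 S hS
  obtain ⟨S', hS', hE, hm⟩ := exists_union h2 h1
  refine ⟨S', hS', by rw [← h0]; exact hE 0, fun t q hq => ?_⟩
  obtain ⟨k, hk⟩ := (hm q).1 hq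
  exact mono _ _ (hE (k+1)) t q ((h2 k).1 hk) (h3 k t q hk)

theorem exists_sat {β : Type} [Inhabited β] {W : ℕ → ℕ → β → Prop} (h : ∀ m, ∀ᶠ i in UF, ∃ v, ∀ j ≤ m, W j i v) :
    ∃ v : ℕ → β, ∀ j, ∀ᶠ i in UF, W j i (v i) := by
  classical
  let P : ℕ → ℕ → Prop := fun i m => ∃ v, ∀ j ≤ m, W j i v
  let mm : ℕ → ℕ := fun i => Nat.findGreatest (P i) i
  refine ⟨fun i => if h : P i (mm i) then h.choose else default, fun j => ?_⟩
  filter_upwards [h j, ev_gt j] with i hi hj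
  have h1 : P i (mm i) := Nat.findGreatest_spec (P := P i) hj.le hi
  have h2 : j ≤ mm i := Nat.le_findGreatest hj.le hi
  rw [dif_pos h1]
  exact h1.choose_spec j h2

/-- Adjoining a sequence. -/
def adj (S : Mod n) (v : ℕ → ℕ) : Mod n where
  S := {w | ∃ f : ℕ → ℕ, AA n f ∧ ∃ a ∈ S.S, w = fun i => f (Nat.pair (a i) (v i))}
  pair := by
    rintro x y ⟨f, hf, a, ha, rfl⟩ ⟨g, hg, b, hb, rfl⟩
    refine ⟨fun k => Nat.pair (f (Nat.pair k.unpair.1.unpair.1 k.unpair.2)) (g (Nat.pair k.unpair.1.unpair.2 k.unpair.2)),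
      AA.npair (hf.comp (by fun_prop)) (hg.comp (by fun_prop)), _, S.pair ha hb, ?_⟩
    simp
  app := by
    rintro g x hg ⟨f, hf, a, ha, rfl⟩
    exact ⟨fun k => g (f k), hg.comp hf, a, ha, rfl⟩
  id := ⟨fun k => k.unpair.1, by fun_prop, _, S.id, by simp⟩

theorem adj_sub (S : Mod n) (v : ℕ → ℕ) : S.S ⊆ (adj S v).S := fun a ha => ⟨fun k => k.unpair.1, by fun_prop, a, ha, by simp⟩
theorem adj_mem (S : Mod n) (v : ℕ → ℕ) : v ∈ (adj S v).S := ⟨fun k => k.unpair.2, by fun_prop, _, S.id, by simp⟩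

theorem adj_ext (S : Mod n) {v X : ℕ → ℕ} (hX : S.SS X) (hv : ∀ᶠ i in UF, v i < X i) : Ext S (adj S v) := by
  refine ⟨adj_sub S v, ?_⟩
  rintro w ⟨f, hf, a, ha, rfl⟩
  obtain ⟨s, hs, hs'⟩ := S.search' (Q := fun q : (ℕ × ℕ) × ℕ => ∀ v < q.1.2, f (Nat.pair q.1.1 v) ≤ q.2)
    (DD.ball (P := fun r : ((ℕ × ℕ) × ℕ) × ℕ => f (Nat.pair r.1.1.1 r.2) ≤ r.1.2) (DD.le (hf.comp (by fun_prop)) (by fun_prop)) (by fun_prop))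
    (fun p => ⟨∑ v ∈ Finset.range p.2, f (Nat.pair p.1 v), fun v hv => Finset.single_le_sum (f := fun v => f (Nat.pair p.1 v)) (fun _ _ => Nat.zero_le _) (Finset.mem_range.2 hv)⟩)
    (Mod.SS.pair (show S.SS a from ha) hX)
  exact ⟨s, hs, hv.mono fun i hi => hs' i (v i) hi⟩

/-- Parametrised largeness condition. -/
def GoodAt (U : ℕ → ℕ → ℕ → Prop) (F : (ℕ × ℕ) × ℕ → ℕ) (G : ℕ × ℕ → ℕ) (r s c a v : ℕ) : Prop :=
  r * cnt (fun j => U s c (F ((a, v), j))) (G (a, v)) ≤ G (a, v)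

theorem GoodAt.mono (hU : ∀ {s s' c u}, s ≤ s' → U s' c u → U s c u) {F G} {r s s' c a v : ℕ} (h : s ≤ s')
    (hg : GoodAt U F G r s c a v) : GoodAt U F G r s' c a v :=
  le_trans (Nat.mul_le_mul_left _ (cnt_mono fun j _ => hU h)) hg

theorem adj_good {S : Mod n} (hS : Good U S) {v : ℕ → ℕ}
    (h : ∀ F G, AA n F → AA n G → ∀ a, S.SS a → ∀ r, ∃ s, S.SS s ∧ ∀ᶠ i in UF, GoodAt U F G r (s i) i (a i) (v i)) : Good U (adj S v) := by
  constructor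
  · have : (adj S v).S ⊆ (fun p : (ℕ → ℕ) × (ℕ → ℕ) => fun i => p.1 (Nat.pair (p.2 i) (v i))) '' ({f | AA n f} ×ˢ S.S) := by
      rintro w ⟨f, hf, a, ha, rfl⟩
      exact ⟨(f, a), ⟨hf, ha⟩, rfl⟩
    exact (((AA.countable n).prod hS.1).image _).mono this
  · intro f hf a' N' ha' hN' r
    have ha' : a' ∈ (adj S v).S := ha'
    have hN' : N' ∈ (adj S v).S := hN'
    obtain ⟨g, hg, a, ha, rfl⟩ := ha'
    obtain ⟨g', hg', b, hb, rfl⟩ := hN'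
    obtain ⟨s, hs, hs'⟩ := h (fun q => f (g (Nat.pair q.1.1.unpair.1 q.1.2), q.2)) (fun p => g' (Nat.pair p.1.unpair.2 p.2))
      (hf.comp (AA.pair (hg.comp (by fun_prop)) (by fun_prop))) (hg'.comp (by fun_prop)) (fun i => Nat.pair (a i) (b i)) (S.pair ha hb) r
    refine ⟨s, adj_sub S v hs, ?_⟩
    simpa [GoodAt] using hs'

theorem tasks_countable {S : Mod n} (hS : S.S.Countable) :
    ∃ t : ℕ → ((ℕ × ℕ) × ℕ → ℕ) × (ℕ × ℕ → ℕ) × (ℕ → ℕ) × ℕ, (∀ k, AA n (t k).1 ∧ AA n (t k).2.1 ∧ S.SS (t k).2.2.1) ∧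
      ∀ F G, AA n F → AA n G → ∀ a, S.SS a → ∀ r, ∃ k, t k = (F, G, a, r) := by
  have hc : ({F : (ℕ × ℕ) × ℕ → ℕ | AA n F} ×ˢ {G : ℕ × ℕ → ℕ | AA n G} ×ˢ S.S ×ˢ (Set.univ : Set ℕ)).Countable :=
    (AA.countable n).prod ((AA.countable n).prod (hS.prod Set.countable_univ))
  obtain ⟨t, ht⟩ := hc.exists_eq_range ⟨(fun _ => 0, fun _ => 0, _, 0), AA.const _, AA.const _, S.id, Set.mem_univ _⟩
  refine ⟨t, fun k => ?_, fun F G hF hG a ha r => ?_⟩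
  · have : t k ∈ Set.range t := ⟨k, rfl⟩
    rw [← ht] at this
    exact ⟨this.1, this.2.1, this.2.2.1⟩
  · have : (F, G, a, r) ∈ Set.range t := by rw [← ht]; exact ⟨hF, hG, ha, Set.mem_univ _⟩
    exact this

/-! counting -/
theorem cnt_add (P : ℕ → Prop) (a b : ℕ) : cnt P (a + b) = cnt P a + cnt (fun j => P (a + j)) b := by
  induction b with
  | zero => simp [cnt_rec]
  | succ b ih => rw [← add_assoc, cnt_rec, cnt_rec _ (b+1)]; simp only [← cnt_rec, ih]; ring
theorem cnt_mul (P : ℕ → Prop) (N X : ℕ) : cnt P (N * X) = ∑ v ∈ Finset.range X, cnt (fun j => P (N * v + j)) N := by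
  induction X with
  | zero => simp [cnt_rec]
  | succ X ih => rw [Nat.mul_succ, cnt_add, ih, Finset.sum_range_succ]
theorem cnt_mod (P : ℕ → Prop) (G q : ℕ) (hG : 0 < G) : cnt (fun j => P (j % G)) (G * q) = q * cnt P G := by
  rw [cnt_mul]
  have : ∀ v ∈ Finset.range q, cnt (fun j => P ((G * v + j) % G)) G = cnt P G := fun v _ =>
    le_antisymm (cnt_mono fun j hj => by simp [Nat.mul_add_mod, Nat.mod_eq_of_lt hj]) (cnt_mono fun j hj => by simp [Nat.mul_add_mod, Nat.mod_eq_of_lt hj])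
  rw [Finset.sum_congr rfl this]; simp

theorem avg {S : Mod n} (hS : Inv U S) {F G} (hF : AA n F) (hG : AA n G) {a X} (ha : S.SS a) (hX : S.SS X) (r K : ℕ) :
    ∃ s, S.SS s ∧ ∀ᶠ i in UF, K * cnt (fun v => ¬ GoodAt U F G r (s i) i (a i) v) (X i) ≤ X i := by
  obtain ⟨N, hN, hN'⟩ := S.search' (Q := fun q : (ℕ × ℕ) × ℕ => 0 < q.2 ∧ ∀ v < q.1.2, 0 < G (q.1.1, v) → q.2 % G (q.1.1, v) = 0)
    (by
      have hGG : AA n (fun q : ((ℕ × ℕ) × ℕ) × ℕ => G (q.1.1.1, q.2)) := hG.comp (by fun_prop)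
      refine DD.and (DD.lt (by fun_prop) (by fun_prop)) (DD.ball (P := fun q : ((ℕ × ℕ) × ℕ) × ℕ => 0 < G (q.1.1.1, q.2) → q.1.2 % G (q.1.1.1, q.2) = 0) ?_ (by fun_prop))
      exact DD.imp (DD.lt (by fun_prop) hGG) (DD.eq (by fun_prop) (by fun_prop)))
    (fun p => ⟨∏ v ∈ Finset.range p.2, max 1 (G (p.1, v)), by show 0 < ∏ v ∈ Finset.range p.2, max 1 (G (p.1, v)); exact Finset.prod_pos fun v _ => lt_max_of_lt_left one_pos, fun v hv h0 => by
      have : max 1 (G (p.1, v)) ∣ ∏ v ∈ Finset.range p.2, max 1 (G (p.1, v)) := Finset.dvd_prod_of_mem _ (Finset.mem_range.2 hv)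
      rw [max_eq_right (show 1 ≤ G (p.1, v) from h0)] at this
      exact Nat.mod_eq_zero_of_dvd this⟩)
    (ha.pair hX)
  have hanS : S.SS (fun i => Nat.pair (a i) (N i)) := S.pair ha hN
  have hFF : AA n (fun q : ℕ × ℕ => F ((q.1.unpair.1, q.2 / q.1.unpair.2), q.2 % q.1.unpair.2 % G (q.1.unpair.1, q.2 / q.1.unpair.2))) := by
    have hGG : AA n (fun q : ℕ × ℕ => G (q.1.unpair.1, q.2 / q.1.unpair.2)) := hG.comp (by fun_prop)
    exact hF.comp (by fun_prop)
  obtain ⟨s, hs, hs'⟩ := hS _ hFF _ _ hanS (hN.mul hX) (K * r)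
  refine ⟨s, hs, ?_⟩
  filter_upwards [hs'] with i hi
  obtain ⟨hN0, hNG⟩ := hN' i
  replace hN0 : 0 < N i := hN0
  replace hNG : ∀ v < X i, 0 < G (a i, v) → N i % G (a i, v) = 0 := hNG
  simp only [Nat.unpair_pair] at hi
  rw [cnt_mul] at hi
  have key : N i * cnt (fun v => ¬ GoodAt U F G r (s i) i (a i) v) (X i) ≤ r * ∑ v ∈ Finset.range (X i), cnt (fun j => U (s i) i (F ((a i, (N i * v + j) / N i), (N i * v + j) % N i % G (a i, (N i * v + j) / N i)))) (N i) := by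
    classical
    rw [cnt_eq, Finset.card_filter, Finset.mul_sum, Finset.mul_sum]
    refine Finset.sum_le_sum fun v hv => ?_
    split_ifs with hg
    · rw [mul_zero]; exact Nat.zero_le _
    rw [mul_one]
    have hG0 : 0 < G (a i, v) := by
      rcases Nat.eq_zero_or_pos (G (a i, v)) with h0 | h0
      · exact absurd (by unfold GoodAt; rw [h0]; simp [cnt_rec]) hg
      · exact h0
    obtain ⟨q, hq⟩ := Nat.dvd_of_mod_eq_zero (hNG v (by simpa using hv) hG0)
    have e1 : cnt (fun j => U (s i) i (F ((a i, (N i * v + j) / N i), (N i * v + j) % N i % G (a i, (N i * v + j) / N i)))) (N i)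
        ≥ cnt (fun j => U (s i) i (F ((a i, v), j % G (a i, v)))) (N i) := by
      refine cnt_mono fun j hj => ?_
      have d1 : (N i * v + j) / N i = v := by
        rw [Nat.mul_add_div hN0, Nat.div_eq_of_lt hj, add_zero]
      have d2 : (N i * v + j) % N i = j := by rw [Nat.mul_add_mod, Nat.mod_eq_of_lt hj]
      rw [d1, d2]; exact id
    refine le_trans ?_ (Nat.mul_le_mul_left r e1)
    conv_rhs => rw [hq]
    rw [cnt_mod (fun j => U (s i) i (F ((a i, v), j))) _ _ hG0]
    unfold GoodAt at hg
    push Not at hg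
    calc N i = q * G (a i, v) := by rw [hq, mul_comm]
      _ ≤ q * (r * cnt (fun j => U (s i) i (F ((a i, v), j))) (G (a i, v))) := Nat.mul_le_mul_left _ hg.le
      _ = _ := by ring
  refine Nat.le_of_mul_le_mul_left (?_ : N i * _ ≤ N i * _) hN0
  calc _ = K * (N i * cnt (fun v => ¬ GoodAt U F G r (s i) i (a i) v) (X i)) := by ring
    _ ≤ K * _ := Nat.mul_le_mul_left _ key
    _ = _ := by rw [mul_assoc]
    _ ≤ _ := hi
end ArithFC

namespace ArithFC
variable {n : ℕ} {U : ℕ → ℕ → ℕ → Prop}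

/-- domain at stage `s` -/
def DomW (Q : ((ℕ × ℕ) × ℕ) × ℕ → Prop) (p x s u : ℕ) : Prop := ∃ v < x, ∃ w < s, Q (((u, v), p), w)

/-- violation of injectivity -/
def ViolW (Q : ((ℕ × ℕ) × ℕ) × ℕ → Prop) (p x : ℕ) (y : (ℕ × ℕ) × ℕ × ℕ × ℕ) : Prop :=
  y.1.1 < x + x ∧ y.1.2 < x + x ∧ y.1.1 ≠ y.1.2 ∧ y.2.1 < x ∧ Q (((y.1.1, y.2.1), p), y.2.2.1) ∧ Q (((y.1.2, y.2.1), p), y.2.2.2)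

/-- The task is handled. -/
def HandW (Q : ((ℕ × ℕ) × ℕ) × ℕ → Prop) (p x : ℕ → ℕ) (S : Mod n) : Prop :=
  (∀ᶠ i in UF, 0 < x i) → (∃ y : ℕ → (ℕ × ℕ) × ℕ × ℕ × ℕ, S.SS y ∧ ∀ᶠ i in UF, ViolW Q (p i) (x i) (y i)) ∨
    ∃ v : ℕ → ℕ, S.SS v ∧ (∀ᶠ i in UF, v i < x i + x i) ∧ ∀ s, S.SS s → ∀ᶠ i in UF, ¬ DomW Q (p i) (x i) (s i) (v i)

theorem HandW.mono {Q} {p x : ℕ → ℕ} {S S' : Mod n} (hE : Ext S S') (h : HandW Q p x S) : HandW Q p x S' := by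
  intro hx
  rcases h hx with ⟨y, hy, h⟩ | ⟨v, hv, h1, h2⟩
  · exact Or.inl ⟨y, hE.ss hy, h⟩
  · refine Or.inr ⟨v, hE.ss hv, h1, fun s hs => ?_⟩
    obtain ⟨s', hs', hle⟩ := hE.2 s hs
    filter_upwards [hle, h2 s' hs'] with i a b
    rintro ⟨v, hv, w, hw, hQ⟩
    exact b ⟨v, hv, w, lt_of_lt_of_le hw a, hQ⟩

theorem DD.domW {Q} (hQ : DD n Q) : DD n (fun r : ((ℕ × ℕ) × ℕ) × ℕ => DomW Q r.1.1.1 r.1.1.2 r.1.2 r.2) := by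
  unfold DomW
  refine DD.bex (P := fun q : (((ℕ × ℕ) × ℕ) × ℕ) × ℕ => ∃ w < q.1.1.2, Q (((q.1.2, q.2), q.1.1.1.1), w)) ?_ (by fun_prop)
  refine DD.bex (P := fun q : ((((ℕ × ℕ) × ℕ) × ℕ) × ℕ) × ℕ => Q (((q.1.1.2, q.1.2), q.1.1.1.1.1), q.2)) ?_ (by fun_prop)
  exact hQ.comp (by fun_prop)

theorem SS_sum {S : Mod n} {σ : ℕ → ℕ → ℕ} (h : ∀ j, S.SS (σ j)) (m : ℕ) : S.SS (fun i => ∑ j ∈ Finset.range m, σ j i) := by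
  induction m with
  | zero => simpa using Mod.SS.const 0
  | succ m ih => simp only [Finset.sum_range_succ]; exact ih.add (h m)

theorem half_sum {b : ℕ → ℕ} {X : ℕ} (hX : 0 < X) (m : ℕ) (h : ∀ j < m, 2 ^ (j+2) * b j ≤ X) : 2 * ∑ j ∈ Finset.range m, b j < X := by
  have key : ∀ k ≤ m, 2 ^ (k+1) * ∑ j ∈ Finset.range k, b j + X ≤ 2 ^ k * X := by
    intro k
    induction k with
    | zero => simp
    | succ k ih =>
      intro hk
      have h1 := ih (by omega)
      have h2 := h k (by omega)
      rw [Finset.sum_range_succ]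
      have e1 : 2 ^ (k+1+1) * (∑ j ∈ Finset.range k, b j + b k) = 2 * (2 ^ (k+1) * ∑ j ∈ Finset.range k, b j) + 2 ^ (k+2) * b k := by ring
      have e2 : 2 ^ (k+1) * X = 2 * (2 ^ k * X) := by ring
      omega
  have := key m le_rfl
  by_contra hcon
  push Not at hcon
  have h3 : 2 ^ m * X ≤ 2 ^ m * (2 * ∑ j ∈ Finset.range m, b j) := Nat.mul_le_mul_left _ hcon
  have e : 2 ^ (m+1) * ∑ j ∈ Finset.range m, b j = 2 ^ m * (2 * ∑ j ∈ Finset.range m, b j) := by ring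
  omega

theorem stepW (hU : ∀ {s s' c u}, s ≤ s' → U s' c u → U s c u) {Q} (hQ : DD n Q) {S : Mod n} (hS : Good U S) {p x : ℕ → ℕ} (hp : S.SS p) (hx : S.SS x) :
    ∃ S', Good U S' ∧ Ext S S' ∧ HandW Q p x S' := by
  by_cases hx0 : ∀ᶠ i in UF, 0 < x i
  swap
  · exact ⟨S, hS, Ext.refl _, fun h => absurd h hx0⟩
  have hX := hx.add hx
  by_cases hA : ∃ s, S.SS s ∧ ∀ᶠ i in UF, x i < cnt (DomW Q (p i) (x i) (s i)) (x i + x i)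
  · obtain ⟨s, hs, hsA⟩ := hA
    refine ⟨S, hS, Ext.refl _, fun _ => Or.inl ?_⟩
    obtain ⟨y, hy, hy'⟩ := S.search (P := fun a : (ℕ × ℕ) × ℕ => a.1.2 < cnt (DomW Q a.1.1 a.1.2 a.2) (a.1.2 + a.1.2))
      (Q := fun q : ((ℕ × ℕ) × ℕ) × ((ℕ × ℕ) × ℕ × ℕ × ℕ) => ViolW Q q.1.1.1 q.1.1.2 q.2)
      (DD.lt (by fun_prop) (AA.cnt (P := fun r : ((ℕ × ℕ) × ℕ) × ℕ => DomW Q r.1.1.1 r.1.1.2 r.1.2 r.2) (DD.domW hQ) (by fun_prop)))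
      (by
        unfold ViolW
        refine DD.and (DD.lt (by fun_prop) (by fun_prop)) (DD.and (DD.lt (by fun_prop) (by fun_prop)) (DD.and (DD.not (DD.eq (by fun_prop) (by fun_prop))) (DD.and (DD.lt (by fun_prop) (by fun_prop)) (DD.and (hQ.comp (by fun_prop)) (hQ.comp (by fun_prop)))))))
      (by
        rintro ⟨⟨p, x⟩, s⟩ h
        replace h : x < cnt (DomW Q p x s) (x + x) := h
        classical
        rw [cnt_eq] at h
        have hd : ∀ u ∈ (Finset.range (x+x)).filter (DomW Q p x s), DomW Q p x s u := fun u hu => (Finset.mem_filter.1 hu).2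
        let g : ℕ → ℕ := fun u => if h : DomW Q p x s u then h.choose else 0
        obtain ⟨u, hu, u', hu', hne, he⟩ := Finset.exists_ne_map_eq_of_card_lt_of_maps_to (t := Finset.range x) (f := g) (by simpa using h) (by
          intro u hu
          have hdu := hd u hu
          simp only [g, dif_pos hdu, Finset.mem_coe, Finset.mem_range]
          exact hdu.choose_spec.1)
        have hdu := hd u hu
        have hdu' := hd u' hu'
        have s1 := hdu.choose_spec
        have s2 := hdu'.choose_spec
        simp only [g, dif_pos hdu, dif_pos hdu'] at he
        rw [← he] at s2
        obtain ⟨h1, w, hw, hq⟩ := s1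
        obtain ⟨h1', w', hw', hq'⟩ := s2
        refine ⟨((u, u'), hdu.choose, w, w'), ?_, ?_, hne, h1, hq, hq'⟩
        · simpa using (Finset.mem_filter.1 hu).1
        · simpa using (Finset.mem_filter.1 hu').1)
      ((hp.pair hx).pair hs) hsA
    exact ⟨y, hy, hy'⟩
  · push Not at hA
    obtain ⟨t, ht, ht'⟩ := tasks_countable hS.1
    obtain ⟨σ, hσ⟩ := hS.1.exists_eq_range ⟨_, S.id⟩
    have hσS : ∀ j, S.SS (σ j) := fun j => by
      have : σ j ∈ S.S := by rw [hσ]; exact ⟨j, rfl⟩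
      exact this
    have hav := fun k => avg hS.2 (ht k).1 (ht k).2.1 (ht k).2.2 hX (t k).2.2.2 (2 ^ (k+2))
    choose s hs hs' using hav
    obtain ⟨v, hv⟩ := exists_sat (W := fun j i v => v < x i + x i ∧ ¬ DomW Q (p i) (x i) (σ j i) v ∧
      GoodAt U (t j).1 (t j).2.1 (t j).2.2.2 (s j i) i ((t j).2.2.1 i) v) (by
      intro m
      have h1 := hA _ (SS_sum hσS (m+1))
      have h2 : ∀ᶠ i in UF, ∀ j < m+1, 2 ^ (j+2) * cnt (fun v => ¬ GoodAt U (t j).1 (t j).2.1 (t j).2.2.2 (s j i) i ((t j).2.2.1 i) v) (x i + x i) ≤ x i + x i := by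
        have := (Filter.eventually_all_finset (Finset.range (m+1)) (l := UF) (p := fun j i => 2 ^ (j+2) * cnt (fun v => ¬ GoodAt U (t j).1 (t j).2.1 (t j).2.2.2 (s j i) i ((t j).2.2.1 i) v) (x i + x i) ≤ x i + x i)).2 (fun j _ => hs' j)
        simpa using this
      filter_upwards [h1, h2, hx0] with i h1 h2 h0
      have h3 := half_sum (X := x i + x i) (by omega) (m+1) h2
      classical
      let A := (Finset.range (x i + x i)).filter (DomW Q (p i) (x i) (∑ j ∈ Finset.range (m+1), σ j i))
      let B : ℕ → Finset ℕ := fun j => (Finset.range (x i + x i)).filter (fun v => ¬ GoodAt U (t j).1 (t j).2.1 (t j).2.2.2 (s j i) i ((t j).2.2.1 i) v)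
      have hcard : (A ∪ (Finset.range (m+1)).biUnion B).card < (Finset.range (x i + x i)).card := by
        calc _ ≤ A.card + ((Finset.range (m+1)).biUnion B).card := Finset.card_union_le _ _
          _ ≤ A.card + ∑ j ∈ Finset.range (m+1), (B j).card := Nat.add_le_add_left Finset.card_biUnion_le _
          _ < x i + x i := by
            rw [cnt_eq] at h1
            simp only [cnt_eq] at h3
            have : A.card ≤ x i := h1
            have : 2 * ∑ j ∈ Finset.range (m+1), (B j).card < x i + x i := h3
            omega
          _ = _ := by simp
      obtain ⟨v, hv, hv'⟩ := Finset.exists_mem_notMem_of_card_lt_card hcard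
      refine ⟨v, fun j hj => ⟨by simpa using hv, ?_, ?_⟩⟩
      · rintro ⟨v', hv'', w, hw, hq⟩
        refine hv' (Finset.mem_union_left _ (Finset.mem_filter.2 ⟨hv, v', hv'', w, lt_of_lt_of_le hw ?_, hq⟩))
        exact Finset.single_le_sum (f := fun j => σ j i) (fun _ _ => Nat.zero_le _) (Finset.mem_range.2 (by omega))
      · by_contra hg
        exact hv' (Finset.mem_union_right _ (Finset.mem_biUnion.2 ⟨j, Finset.mem_range.2 (by omega), Finset.mem_filter.2 ⟨hv, hg⟩⟩)))
    have hvX : ∀ᶠ i in UF, v i < x i + x i := (hv 0).mono fun i h => h.1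
    have hE := adj_ext S hX hvX
    refine ⟨adj S v, adj_good hS ?_, hE, fun _ => Or.inr ⟨v, adj_mem S v, hvX, fun s' hs' => ?_⟩⟩
    · intro F G hF hG a ha r
      obtain ⟨k, hk⟩ := ht' F G hF hG a ha r
      refine ⟨s k, hs k, (hv k).mono fun i hi => ?_⟩
      have := hi.2.2
      rw [hk] at this
      exact this
    · obtain ⟨s0, hs0, hle⟩ := hE.2 s' hs'
      rw [hσ] at hs0
      obtain ⟨j, rfl⟩ := hs0
      filter_upwards [hv j, hle] with i h1 h2
      rintro ⟨v', hv'', w, hw, hq⟩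
      exact h1.2.1 ⟨v', hv'', w, lt_of_lt_of_le hw h2, hq⟩

theorem wphp_of {S : Mod n} (h : ∀ Q, DD n Q → ∀ p x, S.SS p → S.SS x → HandW Q p x S) : WPHP (MM S) (n+1) := by
  intro x hx
  obtain ⟨x, hxS, rfl⟩ := S.exists_rep x
  rw [S.mk_zero, S.mk_lt (Mod.SS.const 0) hxS] at hx
  rw [S.mk_add hxS hxS]
  rintro ⟨F, hF, htot, hfun, hinj⟩
  obtain ⟨Q, hQ, p, hp, hrep⟩ := rep2' hF
  rcases h Q hQ p x hp hxS hx with ⟨y, hy, hviol⟩ | ⟨v, hv, hvX, hundef⟩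
  · have s1 : S.SS (fun i => (y i).1.1) := hy.app (f := fun y => y.1.1) (by fun_prop)
    have s2 : S.SS (fun i => (y i).1.2) := hy.app (f := fun y => y.1.2) (by fun_prop)
    have s3 : S.SS (fun i => (y i).2.1) := hy.app (f := fun y => y.2.1) (by fun_prop)
    have s4 : S.SS (fun i => (y i).2.2.1) := hy.app (f := fun y => y.2.2.1) (by fun_prop)
    have s5 : S.SS (fun i => (y i).2.2.2) := hy.app (f := fun y => y.2.2.2) (by fun_prop)
    have f1 : F (S.mk fun i => (y i).1.1) (S.mk fun i => (y i).2.1) := (hrep _ _ s1 s3).2 ⟨_, s4, hviol.mono fun i hi => hi.2.2.2.2.1⟩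
    have f2 : F (S.mk fun i => (y i).1.2) (S.mk fun i => (y i).2.1) := (hrep _ _ s2 s3).2 ⟨_, s5, hviol.mono fun i hi => hi.2.2.2.2.2⟩
    have hX := hxS.add hxS
    have l1 := (S.mk_lt s1 hX).2 (hviol.mono fun i hi => hi.1)
    have l2 := (S.mk_lt s2 hX).2 (hviol.mono fun i hi => hi.2.1)
    have e := hinj _ _ _ l1 l2 f1 f2
    rw [S.mk_eq s1 s2] at e
    obtain ⟨i, h1, h2⟩ := (e.and hviol).exists
    exact h2.2.2.1 h1
  · obtain ⟨v', hv'lt, hFv⟩ := htot (S.mk v) ((S.mk_lt hv (hxS.add hxS)).2 hvX)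
    obtain ⟨v', hv', rfl⟩ := S.exists_rep v'
    rw [hrep v v' hv hv'] at hFv
    obtain ⟨w, hw, hq⟩ := hFv
    rw [S.mk_lt hv' hxS] at hv'lt
    obtain ⟨i, ⟨h1, h2⟩, h3⟩ := ((hv'lt.and hq).and (hundef _ (hw.add (Mod.SS.const 1)))).exists
    exact h3 ⟨v' i, h1, w i, Nat.lt_succ_self _, h2⟩
end ArithFC

namespace ArithFC
variable {n : ℕ}

/-- Homogeneity. -/
def Hom {γ : Type} (χ : List ℕ → γ) (e : ℕ) (H : List ℕ) : Prop :=
  ∀ t t', t.Sublist H → t'.Sublist H → t.length = e → t'.length = e → χ t = χ t'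

theorem Hom.mono {γ : Type} {χ : List ℕ → γ} {e : ℕ} {H H' : List ℕ} (h : H'.Sublist H) (hh : Hom χ e H) : Hom χ e H' :=
  fun t t' a b => hh t t' (a.trans h) (b.trans h)

/-- Prehomogeneity. -/
def Pre (χ : List ℕ → ℕ) (e : ℕ) : List ℕ → Prop
  | [] => True
  | a :: l => Hom (fun t => χ (a :: t)) e l ∧ Pre χ e l

theorem Pre.colors {χ : List ℕ → ℕ} {e D : ℕ} (hD : 0 < D) (hχ : ∀ t, χ t < D) : ∀ L : List ℕ, Pre χ e L →
    ∃ f : ℕ → List ℕ, (∀ c, (f c).Sublist L ∧ ∀ t, t.Sublist (f c) → t.length = e + 1 → χ t = c) ∧ ∑ c ∈ Finset.range D, (f c).length = L.length := by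
  intro L
  induction L with
  | nil =>
    intro _
    refine ⟨fun _ => [], fun c => ⟨List.Sublist.refl _, ?_⟩, by simp⟩
    intro t ht hl
    have := ht.length_le
    simp at this; simp [this] at hl
  | cons a l ih =>
    rintro ⟨h1, h2⟩
    obtain ⟨f, hf, hs⟩ := ih h2
    obtain ⟨ca, hca, hca'⟩ : ∃ ca < D, ∀ t, t.Sublist l → t.length = e → χ (a :: t) = ca := by
      by_cases hex : ∃ t : List ℕ, t.Sublist l ∧ t.length = e
      · obtain ⟨t, ht, hl⟩ := hex
        exact ⟨χ (a :: t), hχ _, fun t' ht' hl' => h1 t' t ht' ht hl' hl⟩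
      · exact ⟨0, hD, fun t ht hl => absurd ⟨t, ht, hl⟩ hex⟩
    refine ⟨Function.update f ca (a :: f ca), fun c => ?_, ?_⟩
    · by_cases hc : c = ca
      · subst hc
        rw [Function.update_self]
        refine ⟨(hf c).1.cons_cons a, fun t ht hl => ?_⟩
        cases ht with
        | cons _ h => exact (hf c).2 t h hl
        | cons_cons _ h => exact hca' _ (h.trans (hf c).1) (by simpa using hl)
      · rw [Function.update_of_ne hc]
        exact ⟨(hf c).1.cons a, (hf c).2⟩
    · have hm : ca ∈ Finset.range D := Finset.mem_range.2 hca
      rw [← Finset.add_sum_erase _ _ hm] at hs ⊢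
      rw [Function.update_self]
      have : ∑ x ∈ (Finset.range D).erase ca, (Function.update f ca (a :: f ca) x).length = ∑ x ∈ (Finset.range D).erase ca, (f x).length :=
        Finset.sum_congr rfl fun x hx => by rw [Function.update_of_ne (Finset.ne_of_mem_erase hx)]
      rw [this]
      simp only [List.length_cons] at *
      omega

/-- `Y` is large enough for Ramsey. -/
def RamOK (e D z Y : ℕ) : Prop := ∀ H : List ℕ, Y ≤ H.length → ∀ χ : List ℕ → ℕ, (∀ t, χ t < D) →
  ∃ H' : List ℕ, H'.Sublist H ∧ H'.length = z ∧ Hom χ e H'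

theorem ramsey (D : ℕ) (hD : 0 < D) (e : ℕ) : ∀ z, ∃ Y, RamOK e D z Y := by
  induction e with
  | zero =>
    intro z
    refine ⟨z, fun H hH χ _ => ⟨H.take z, List.take_sublist _ _, by simpa using hH, ?_⟩⟩
    intro t t' _ _ h h'
    rw [List.length_eq_zero_iff.1 h, List.length_eq_zero_iff.1 h']
  | succ e ih =>
    have pre : ∀ m, ∃ Y, ∀ H : List ℕ, Y ≤ H.length → ∀ χ : List ℕ → ℕ, (∀ t, χ t < D) →
        ∃ H' : List ℕ, H'.Sublist H ∧ H'.length = m ∧ Pre χ e H' := by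
      intro m
      induction m with
      | zero => exact ⟨0, fun H _ χ _ => ⟨[], List.nil_sublist _, rfl, trivial⟩⟩
      | succ m ihm =>
        obtain ⟨G, hG⟩ := ihm
        obtain ⟨Y, hY⟩ := ih G
        refine ⟨Y + 1, fun H hH χ hχ => ?_⟩
        cases H with
        | nil => simp at hH
        | cons a T =>
          obtain ⟨T', hT', hl, hh⟩ := hY T (by simpa using hH) (fun t => χ (a :: t)) (fun t => hχ _)
          obtain ⟨L, hL, hl', hp⟩ := hG T' hl.ge χ hχ
          exact ⟨a :: L, (hL.trans hT').cons_cons a, by simp [hl'], hh.mono hL, hp⟩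
    intro z
    obtain ⟨Y, hY⟩ := pre (D * z)
    refine ⟨Y, fun H hH χ hχ => ?_⟩
    obtain ⟨L, hL, hl, hp⟩ := hY H hH χ hχ
    obtain ⟨f, hf, hs⟩ := Pre.colors hD hχ L hp
    obtain ⟨c, hc⟩ : ∃ c, z ≤ (f c).length := by
      by_contra hcon
      push Not at hcon
      have : ∑ c ∈ Finset.range D, (f c).length < ∑ c ∈ Finset.range D, z :=
        Finset.sum_lt_sum_of_nonempty ⟨0, by simpa using hD⟩ fun c _ => hcon c
      simp at this
      omega
    refine ⟨(f c).take z, (List.take_sublist _ _).trans ((hf c).1.trans hL), by simpa using hc, ?_⟩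
    intro t t' ht ht' h h'
    rw [(hf c).2 t (ht.trans (List.take_sublist _ _)) h, (hf c).2 t' (ht'.trans (List.take_sublist _ _)) h']

/-! computability of sublists -/
theorem AA.sublists0 : AA n (fun l : List ℕ => l.sublists') := by
  refine AA.ofP ?_
  have h : Primrec (fun l : List ℕ => l.foldr (fun a acc => acc ++ acc.map (fun t => a :: t)) [([] : List ℕ)]) := by
    refine Primrec.list_foldr (f := fun l : List ℕ => l) (g := fun _ => [([] : List ℕ)]) (h := fun _ (p : ℕ × List (List ℕ)) => p.2 ++ p.2.map (fun t => p.1 :: t)) Primrec.id (Primrec.const _) ?_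
    refine Primrec.list_append.comp (Primrec.snd.comp Primrec.snd) ?_
    refine Primrec.list_map (f := fun q : List ℕ × (ℕ × List (List ℕ)) => q.2.2) (g := fun q t => q.2.1 :: t) (Primrec.snd.comp Primrec.snd) ?_
    exact Primrec.list_cons.comp (Primrec.fst.comp (Primrec.snd.comp Primrec.fst)) Primrec.snd
  refine h.of_eq fun l => ?_
  induction l with
  | nil => simp
  | cons a l ih => rw [List.foldr_cons, ih, List.sublists'_cons]

variable {α : Type} [Primcodable α] [Inhabited α]
theorem DD.ball_sub {P : α × List ℕ → Prop} (hP : DD n P) {H : α → List ℕ} (hH : AA n H) :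
    DD n (fun a => ∀ t, t.Sublist (H a) → P (a, t)) :=
  (DD.ball_list hP (AA.sublists0.comp hH)).congr fun a => by simp [List.mem_sublists']
theorem DD.bex_sub {P : α × List ℕ → Prop} (hP : DD n P) {H : α → List ℕ} (hH : AA n H) :
    DD n (fun a => ∃ t, t.Sublist (H a) ∧ P (a, t)) :=
  (DD.bex_list hP (AA.sublists0.comp hH)).congr fun a => by simp [List.mem_sublists']
theorem DD.sub {H H' : α → List ℕ} (hH : AA n H) (hH' : AA n H') : DD n (fun a => (H a).Sublist (H' a)) :=
  (DD.bex_list (P := fun q : α × List ℕ => q.2 = H q.1) (DD.eq (by fun_prop) (hH.comp AA.fst)) (AA.sublists0.comp hH')).congr fun a => by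
    simp [List.mem_sublists']
theorem DD.hom {γ : Type} [Primcodable γ] [Inhabited γ] {χ : α × List ℕ → γ} (hχ : AA n χ) {e : α → ℕ} (he : AA n e) {H : α → List ℕ} (hH : AA n H) :
    DD n (fun a => Hom (fun t => χ (a, t)) (e a) (H a)) := by
  have : DD n (fun a => ∀ t, t.Sublist (H a) → ∀ t', t'.Sublist (H a) → t.length = e a → t'.length = e a → χ (a, t) = χ (a, t')) := by
    have he1 := he.comp (AA.comp (AA.fst (n := n) (α := α) (β := List ℕ)) (AA.fst (α := α × List ℕ) (β := List ℕ)))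
    refine DD.ball_sub (P := fun q : α × List ℕ => ∀ t', t'.Sublist (H q.1) → q.2.length = e q.1 → t'.length = e q.1 → χ (q.1, q.2) = χ (q.1, t')) ?_ hH
    refine DD.ball_sub (P := fun q : (α × List ℕ) × List ℕ => q.1.2.length = e q.1.1 → q.2.length = e q.1.1 → χ (q.1.1, q.1.2) = χ (q.1.1, q.2)) ?_ (hH.comp AA.fst)
    refine DD.imp (DD.eq (by fun_prop) he1) (DD.imp (DD.eq (by fun_prop) he1) (DD.eq (hχ.comp (by fun_prop)) (hχ.comp (by fun_prop))))
  refine this.congr fun a => ?_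
  unfold Hom
  constructor
  · intro h t t' a b; exact h t a t' b
  · intro h t a t' b; exact h t t' a b

/-- table version -/
def RamT (e D z Y : ℕ) : Prop := ∀ τ : List ℕ, ∃ H' : List ℕ, H'.Sublist (List.range Y) ∧ H'.length = z ∧
  Hom (fun t => τ.getD (Encodable.encode t) 0 % D) e H'

theorem RamT.ok {e D z Y : ℕ} (h : RamT e D z Y) : RamOK e D z Y := by
  intro H hH χ hχ
  let χ' : List ℕ → ℕ := fun t => χ (t.map fun k => H.getD k 0)
  let M : ℕ := ∑ t ∈ (List.range Y).sublists'.toFinset, (Encodable.encode t + 1)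
  let τ : List ℕ := (List.range M).map (fun k => χ' (dec (List ℕ) k))
  have hτ : ∀ t : List ℕ, t.Sublist (List.range Y) → τ.getD (Encodable.encode t) 0 % D = χ' t := by
    intro t ht
    have h1 : Encodable.encode t + 1 ≤ M := Finset.single_le_sum (f := fun t : List ℕ => Encodable.encode t + 1) (fun _ _ => Nat.zero_le _) (by simpa using ht)
    have h2 : τ.getD (Encodable.encode t) 0 = χ' t := by
      simp only [τ]
      rw [List.getD_eq_getElem _ _ (by simp; omega)]
      simp [dec_encode]
    rw [h2, Nat.mod_eq_of_lt (hχ _)]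
  obtain ⟨I, hI, hl, hh⟩ := h τ
  have hmap : (List.range Y).map (fun k => H.getD k 0) = H.take Y := by
    refine List.ext_getElem (by simp [hH]) fun k h1 h2 => ?_
    simp at h1 h2
    simp [List.getD_eq_getElem, h2.2]
  refine ⟨I.map fun k => H.getD k 0, ?_, by simpa using hl, ?_⟩
  · refine (hI.map _).trans ?_
    rw [hmap]; exact List.take_sublist _ _
  · intro t t' ht ht' h h'
    obtain ⟨s, hs, rfl⟩ := List.sublist_map_iff.1 ht
    obtain ⟨s', hs', rfl⟩ := List.sublist_map_iff.1 ht'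
    have := hh s s' hs hs' (by simpa using h) (by simpa using h')
    beta_reduce at this
    rwa [hτ s (hs.trans hI), hτ s' (hs'.trans hI)] at this

theorem RamOK.t {e D z Y : ℕ} (hD : 0 < D) (h : RamOK e D z Y) : RamT e D z Y :=
  fun τ => h _ (by simp) _ fun t => Nat.mod_lt _ hD

theorem DD.ramT (hn : 1 ≤ n) : DD n (fun q : (ℕ × ℕ × ℕ) × ℕ => RamT q.1.1 q.1.2.1 q.1.2.2 q.2) := by
  refine DD.of_nsg (m := 1) ?_ hn
  have h0 : DD 0 (fun q : ((ℕ × ℕ × ℕ) × ℕ) × List ℕ => ∃ H' : List ℕ, H'.Sublist (List.range q.1.2) ∧ H'.length = q.1.1.2.2 ∧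
      Hom (fun t => q.2.getD (Encodable.encode t) 0 % q.1.1.2.1) q.1.1.1 H') := by
    refine DD.bex_sub (P := fun r : (((ℕ × ℕ × ℕ) × ℕ) × List ℕ) × List ℕ => r.2.length = r.1.1.1.2.2 ∧ 
      Hom (fun t => r.1.2.getD (Encodable.encode t) 0 % r.1.1.1.2.1) r.1.1.1.1 r.2) ?_ (by fun_prop)
    refine DD.and (DD.eq (by fun_prop) (by fun_prop)) (DD.hom (χ := fun q : ((((ℕ × ℕ × ℕ) × ℕ) × List ℕ) × List ℕ) × List ℕ => q.1.1.2.getD (Encodable.encode q.2) 0 % q.1.1.1.1.2.1) ?_ (by fun_prop) (by fun_prop))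
    have he : AA 0 (Encodable.encode : List ℕ → ℕ) := AA.encode
    have he' : AA 0 (fun q : ((((ℕ × ℕ × ℕ) × ℕ) × List ℕ) × List ℕ) × List ℕ => Encodable.encode q.2) := he.comp AA.snd
    fun_prop
  refine (Sg.ex h0.2).congr fun q => ?_
  unfold RamT
  push Not
  rfl

theorem exists_ram (hn : 1 ≤ n) : ∃ ram : ℕ × ℕ × ℕ → ℕ, AA n ram ∧ ∀ e D z, 0 < D → RamOK e D z (ram (e, D, z)) := by
  obtain ⟨f, hf, hf'⟩ := AA.search (n := n) (P := fun p : ℕ × ℕ × ℕ => 0 < p.2.1) (Q := fun q : (ℕ × ℕ × ℕ) × ℕ => RamT q.1.1 q.1.2.1 q.1.2.2 q.2)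
    (DD.lt (by fun_prop) (by fun_prop)) (DD.ramT hn) (fun p hp => by
      obtain ⟨Y, hY⟩ := ramsey p.2.1 hp p.1 p.2.2
      exact ⟨Y, hY.t hp⟩)
  exact ⟨f, hf, fun e D z hD => (hf' (e, D, z) hD).ok⟩
end ArithFC

namespace ArithFC
variable {n : ℕ} {U : ℕ → ℕ → ℕ → Prop}

theorem cnt_fiber (U : ℕ → Prop) [DecidablePred U] (f : ℕ → ℕ) (G d : ℕ) (hU : ∀ u, U u → u < d) :
    cnt (fun j => U (f j)) G = ∑ u ∈ (Finset.range d).filter U, cnt (fun j => f j = u) G := by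
  classical
  rw [cnt_eq]
  rw [Finset.card_eq_sum_card_fiberwise (f := f) (t := (Finset.range d).filter U)]
  · refine Finset.sum_congr rfl fun u hu => ?_
    rw [cnt_eq]
    congr 1
    ext j
    simp only [Finset.mem_filter, Finset.mem_range] at hu ⊢
    constructor
    · rintro ⟨⟨a, b⟩, c⟩; exact ⟨a, c⟩
    · rintro ⟨a, c⟩; exact ⟨⟨a, by rw [c]; exact hu.2⟩, c⟩
  · intro j hj
    simp only [Finset.coe_filter, Finset.mem_range, Set.mem_setOf_eq] at hj ⊢
    exact ⟨hU _ hj.2, hj.2⟩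

theorem rounding {U : ℕ → Prop} {f0 f : ℕ → ℕ} {G0 G r c d : ℕ} (hc : 0 < c) (hd : 0 < d) (hr : 2 * r ≤ c) (hU : ∀ u, U u → u < d)
    (hdig : ∀ u < d, cnt (fun j => f0 j = u) G0 * (c * d) / G0 = cnt (fun j => f j = u) G * (c * d) / G)
    (h0 : 2 * r * cnt (fun j => U (f0 j)) G0 ≤ G0) : r * cnt (fun j => U (f j)) G ≤ G := by
  classical
  rcases Nat.eq_zero_or_pos G with rfl | hG
  · simp [cnt_rec]
  rw [cnt_fiber U f G d hU]
  rw [cnt_fiber U f0 G0 d hU] at h0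
  set A := (Finset.range d).filter U
  set D := ∑ u ∈ A, cnt (fun j => f j = u) G * (c * d) / G with hD
  have h1 : 2 * r * D ≤ c * d := by
    rcases Nat.eq_zero_or_pos G0 with rfl | hG0
    · have : D = 0 := by
        refine Finset.sum_eq_zero fun u hu => ?_
        rw [← hdig u (by simpa using (Finset.mem_filter.1 hu).1)]; simp
      rw [this]; simp
    · have e1 : D * G0 ≤ (∑ u ∈ A, cnt (fun j => f0 j = u) G0) * (c * d) := by
        rw [hD, Finset.sum_mul, Finset.sum_mul]
        refine Finset.sum_le_sum fun u hu => ?_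
        rw [← hdig u (by simpa using (Finset.mem_filter.1 hu).1)]
        exact Nat.div_mul_le_self _ _
      refine Nat.le_of_mul_le_mul_left (?_ : G0 * _ ≤ G0 * _) hG0
      calc G0 * (2 * r * D) = 2 * r * (D * G0) := by ring
        _ ≤ 2 * r * ((∑ u ∈ A, cnt (fun j => f0 j = u) G0) * (c * d)) := Nat.mul_le_mul_left _ e1
        _ = (2 * r * (∑ u ∈ A, cnt (fun j => f0 j = u) G0)) * (c * d) := by ring
        _ ≤ G0 * (c * d) := Nat.mul_le_mul_right _ h0
  have h2 : (∑ u ∈ A, cnt (fun j => f j = u) G) * (c * d) ≤ (D + d) * G := by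
    have : (∑ u ∈ A, cnt (fun j => f j = u) G) * (c * d) ≤ ∑ u ∈ A, (cnt (fun j => f j = u) G * (c * d) / G + 1) * G := by
      rw [Finset.sum_mul]
      refine Finset.sum_le_sum fun u hu => ?_
      have := Nat.lt_div_mul_add hG (a := cnt (fun j => f j = u) G * (c * d))
      rw [add_mul, one_mul]; exact this.le
    refine this.trans ?_
    rw [← Finset.sum_mul, Finset.sum_add_distrib]
    refine Nat.mul_le_mul_right _ ?_
    have : A.card ≤ d := by simpa using Finset.card_filter_le (Finset.range d) U
    simp only [Finset.sum_const, smul_eq_mul, mul_one]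
    omega
  refine Nat.le_of_mul_le_mul_left (?_ : 2 * (c * d) * _ ≤ 2 * (c * d) * _) (by positivity)
  calc 2 * (c * d) * (r * ∑ u ∈ A, cnt (fun j => f j = u) G) = 2 * r * ((∑ u ∈ A, cnt (fun j => f j = u) G) * (c * d)) := by ring
    _ ≤ 2 * r * ((D + d) * G) := Nat.mul_le_mul_left _ h2
    _ = (2 * r * D + 2 * r * d) * G := by ring
    _ ≤ (c * d + c * d) * G := Nat.mul_le_mul_right _ (add_le_add h1 (Nat.mul_le_mul_right _ hr))
    _ = _ := by ring

/-- rounded weight -/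
noncomputable def dig (F : (ℕ × ℕ) × ℕ → ℕ) (G : ℕ × ℕ → ℕ) (a c u : ℕ) (t : List ℕ) : ℕ :=
  cnt (fun j => F ((a, Encodable.encode t), j) = u) (G (a, Encodable.encode t)) * (c * c ^ c) / G (a, Encodable.encode t)

theorem cnt_le (P : ℕ → Prop) (b : ℕ) : cnt P b ≤ b := by
  classical
  rw [cnt_eq]; simpa using Finset.card_filter_le (Finset.range b) P

theorem dig_lt (F G a c u t) : dig F G a c u t < c * c ^ c + 1 := by
  unfold dig
  refine Nat.lt_succ_of_le ?_
  refine le_trans (Nat.div_le_div_right (Nat.mul_le_mul_right _ (cnt_le _ _))) ?_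
  rcases Nat.eq_zero_or_pos (G (a, Encodable.encode t)) with h | h
  · simp [h]
  · rw [Nat.mul_div_cancel_left _ h]
 
theorem AA_dig {F G} (hF : AA n F) (hG : AA n G) {α : Type} [Primcodable α] [Inhabited α] {a c u : α → ℕ} {t : α → List ℕ}
    (ha : AA n a) (hc : AA n c) (hu : AA n u) (ht : AA n t) : AA n (fun q => dig F G (a q) (c q) (u q) (t q)) := by
  have hG' : AA n (fun q => G (a q, Encodable.encode (t q))) := hG.comp (ha.pair (AA.encode.comp ht))
  have hc' : AA n (fun q => c q ^ c q) := AA.pow hc hc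
  have h1 : AA n (fun q => cnt (fun j => F ((a q, Encodable.encode (t q)), j) = u q) (G (a q, Encodable.encode (t q)))) :=
    AA.cnt (P := fun r : α × ℕ => F ((a r.1, Encodable.encode (t r.1)), r.2) = u r.1)
      (DD.eq (hF.comp (((ha.comp AA.fst).pair (AA.encode.comp (ht.comp AA.fst))).pair AA.snd)) (hu.comp AA.fst)) hG'
  exact (h1.mul (hc.mul hc')).div hG'

theorem thin {ram : ℕ × ℕ × ℕ → ℕ} (hram : AA n ram) (hram' : ∀ e D z, 0 < D → RamOK e D z (ram (e, D, z)))
    (hU' : ∀ {s c u}, U s c u → u < c ^ c) {S : Mod n} (hS : Inv U S) {F G} (hF : AA n F) (hG : AA n G) {a : ℕ → ℕ} (ha : S.SS a) (r : ℕ)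
    {e z : ℕ → ℕ} {H : ℕ → List ℕ} (he : S.SS e) (hz : S.SS z) (hH : S.SS H)
    (hl : ∀ᶠ i in UF, ram (e i, ((i * i ^ i + 1) ^ (i ^ i)), z i) ≤ (H i).length)
    (hne : ∀ H' : ℕ → List ℕ, S.SS H' → (∀ᶠ i in UF, (H' i).Sublist (H i) ∧ (H' i).length = z i) → ∀ᶠ i in UF, ∃ t : List ℕ, t.Sublist (H' i) ∧ t.length = e i) :
    ∃ (H' : ℕ → List ℕ) (s : ℕ → ℕ), S.SS H' ∧ S.SS s ∧ ∀ᶠ i in UF, ((H' i).Sublist (H i) ∧ (H' i).length = z i) ∧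
      ∀ t : List ℕ, t.Sublist (H' i) → t.length = e i → GoodAt U F G r (s i) i (a i) (Encodable.encode t) := by
  have hpw : AA n (fun q : (((ℕ × ℕ) × (ℕ × ℕ)) × List ℕ) => q.1.2.1 ^ q.1.2.1) := AA.pow (by fun_prop) (by fun_prop)
  obtain ⟨H', hH', h'⟩ := S.search (P := fun q : (((ℕ × ℕ) × (ℕ × ℕ)) × List ℕ) => ram (q.1.1.2, ((q.1.2.1 * q.1.2.1 ^ q.1.2.1 + 1) ^ (q.1.2.1 ^ q.1.2.1)), q.1.2.2) ≤ q.2.length)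
    (Q := fun w : (((ℕ × ℕ) × (ℕ × ℕ)) × List ℕ) × List ℕ => (w.2.Sublist w.1.2 ∧ w.2.length = w.1.1.2.2) ∧
      ∀ u < w.1.1.2.1 ^ w.1.1.2.1, Hom (fun t => dig F G w.1.1.1.1 w.1.1.2.1 u t) w.1.1.1.2 w.2)
    (by
      have hpp : AA n (fun q : (((ℕ × ℕ) × (ℕ × ℕ)) × List ℕ) => (q.1.2.1 * q.1.2.1 ^ q.1.2.1 + 1) ^ (q.1.2.1 ^ q.1.2.1)) :=
        AA.pow (by fun_prop) hpw
      exact DD.le (hram.comp (by fun_prop)) (by fun_prop))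
    (by
      refine DD.and (DD.and (DD.sub (by fun_prop) (by fun_prop)) (DD.eq (by fun_prop) (by fun_prop))) ?_
      refine DD.ball (P := fun w : ((((ℕ × ℕ) × (ℕ × ℕ)) × List ℕ) × List ℕ) × ℕ => Hom (fun t => dig F G w.1.1.1.1.1 w.1.1.1.2.1 w.2 t) w.1.1.1.1.2 w.1.2) ?_ (hpw.comp AA.fst)
      exact DD.hom (χ := fun w : (((((ℕ × ℕ) × (ℕ × ℕ)) × List ℕ) × List ℕ) × ℕ) × List ℕ => dig F G w.1.1.1.1.1.1 w.1.1.1.1.2.1 w.1.2 w.2)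
        (AA_dig hF hG (by fun_prop) (by fun_prop) (by fun_prop) (by fun_prop)) (by fun_prop) (by fun_prop))
    (by
      rintro ⟨⟨⟨a, e⟩, ⟨c, z⟩⟩, H⟩ hq
      replace hq : ram (e, ((c * c ^ c + 1) ^ (c ^ c)), z) ≤ H.length := hq
      have hdg := fun t : List ℕ => exists_digits (c * c ^ c + 1) (c ^ c) (by omega) (fun u => dig F G a c u t)
      choose χ hχ1 hχ2 using hdg
      obtain ⟨H', h1, h2, h3⟩ := hram' e ((c * c ^ c + 1) ^ (c ^ c)) z (by positivity) H hq χ hχ1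
      refine ⟨H', ⟨h1, h2⟩, fun u hu t t' ht ht' hl hl' => ?_⟩
      show dig F G a c u t = dig F G a c u t'
      have e1 := hχ2 t u hu
      have e2 := hχ2 t' u hu
      rw [Nat.mod_eq_of_lt (dig_lt _ _ _ _ _ _)] at e1 e2
      rw [← e1, ← e2, h3 t t' ht ht' hl hl'])
    ((Mod.SS.pair (Mod.SS.pair ha he) (Mod.SS.pair (Mod.SS.cid) hz)).pair hH) hl
  replace h' : ∀ᶠ i in UF, ((H' i).Sublist (H i) ∧ (H' i).length = z i) ∧ ∀ u < i ^ i, Hom (fun t => dig F G (a i) i u t) (e i) (H' i) := h'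
  obtain ⟨t0, ht0, ht0'⟩ := S.search (P := fun q : List ℕ × ℕ => ∃ t : List ℕ, t.Sublist q.1 ∧ t.length = q.2)
    (Q := fun w : (List ℕ × ℕ) × List ℕ => w.2.Sublist w.1.1 ∧ w.2.length = w.1.2)
    (DD.bex_sub (P := fun w : (List ℕ × ℕ) × List ℕ => w.2.length = w.1.2) (DD.eq (by fun_prop) (by fun_prop)) (by fun_prop))
    (DD.and (DD.sub (by fun_prop) (by fun_prop)) (DD.eq (by fun_prop) (by fun_prop)))
    (fun q hq => hq) (hH'.pair he) (hne H' hH' (h'.mono fun i hi => hi.1))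
  replace ht0' : ∀ᶠ i in UF, (t0 i).Sublist (H' i) ∧ (t0 i).length = e i := ht0'
  have hv : S.SS (fun i => Encodable.encode (t0 i)) := ht0.app AA.encode
  have hav : S.SS (fun i => Nat.pair (a i) (Encodable.encode (t0 i))) := S.pair ha hv
  obtain ⟨s, hs, hs'⟩ := hS (fun q => F ((q.1.unpair.1, q.1.unpair.2), q.2)) (hF.comp (by fun_prop)) _ (fun i => G (a i, Encodable.encode (t0 i))) hav
    ((ha.pair hv).app hG) (2 * r)
  refine ⟨H', s, hH', hs, ?_⟩
  filter_upwards [h', ht0', hs', ev_gt (2 * r)] with i h1 h2 h3 h4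
  refine ⟨h1.1, fun t ht hl => ?_⟩
  simp only [Nat.unpair_pair] at h3
  have hi : 0 < i := by omega
  refine rounding (U := U (s i) i) (f0 := fun j => F ((a i, Encodable.encode (t0 i)), j)) (G0 := G (a i, Encodable.encode (t0 i))) (c := i) (d := i ^ i) hi (by positivity) h4.le (fun u => hU') ?_ h3
  intro u hu
  exact h1.2 u hu (t0 i) t h2.1 ht h2.2 hl
end ArithFC

namespace ArithFC
variable {n : ℕ} {U : ℕ → ℕ → ℕ → Prop}

/-- the sequence of Ramsey bounds -/
noncomputable def rho (ram : ℕ × ℕ × ℕ → ℕ) (b : ℕ × ℕ × ℕ) (c : ℕ) : ℕ → ℕ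
  | 0 => ram b
  | j + 1 => ram (b.1, (c * c ^ c + 1) ^ (c ^ c), rho ram b c j) + rho ram b c j

theorem rho_ge (ram b c j) : ram b ≤ rho ram b c j := by
  induction j with
  | zero => exact le_rfl
  | succ j ih => exact ih.trans (Nat.le_add_left _ _)

theorem AA_rho {ram} (hram : AA n ram) : AA n (fun q : ((ℕ × ℕ × ℕ) × ℕ) × ℕ => rho ram q.1.1 q.1.2 q.2) := by
  have hpw : AA n (fun q : (((ℕ × ℕ × ℕ) × ℕ) × ℕ) × ℕ × ℕ => q.1.1.2 ^ q.1.1.2) := AA.pow (by fun_prop) (by fun_prop)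
  have hpp : AA n (fun q : (((ℕ × ℕ × ℕ) × ℕ) × ℕ) × ℕ × ℕ => (q.1.1.2 * q.1.1.2 ^ q.1.1.2 + 1) ^ (q.1.1.2 ^ q.1.1.2)) := AA.pow (by fun_prop) hpw
  refine AA.congr (AA.nat_rec (f := fun q : ((ℕ × ℕ × ℕ) × ℕ) × ℕ => q.2) (g := fun q => ram q.1.1)
    (h := fun q : (((ℕ × ℕ × ℕ) × ℕ) × ℕ) × ℕ × ℕ => ram (q.1.1.1.1, (q.1.1.2 * q.1.1.2 ^ q.1.1.2 + 1) ^ (q.1.1.2 ^ q.1.1.2), q.2.2) + q.2.2)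
    (by fun_prop) (hram.comp (by fun_prop)) (AA.add (hram.comp (by fun_prop)) (by fun_prop))) ?_
  rintro ⟨⟨b, c⟩, j⟩
  show Nat.rec (motive := fun _ => ℕ) (ram b) (fun i r => ram (b.1, (c * c ^ c + 1) ^ (c ^ c), r) + r) j = rho ram b c j
  induction j with
  | zero => rfl
  | succ j ih => simp only [rho, ih]

/-- The Ramsey task is handled. -/
def HandF (cd : List ℕ → ℕ) (Q : ((ℕ × ℕ) × ℕ) × ℕ → Prop) (p e k x y : ℕ → ℕ) (S : Mod n) : Prop :=
  (∀ᶠ i in UF, 0 < k i) →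
    (∃ (H : ℕ → List ℕ) (c s : ℕ → ℕ), S.SS H ∧ S.SS c ∧ S.SS s ∧ ∀ᶠ i in UF, ((H i).Sublist (List.range (y i)) ∧ (H i).length = x i) ∧ c i < k i ∧
      ∀ t : List ℕ, t.Sublist (H i) → t.length = e i → ∃ w < s i, Q (((cd t, c i), p i), w)) ∨
    ∃ t : ℕ → List ℕ, S.SS t ∧ (∀ᶠ i in UF, (t i).Sublist (List.range (y i)) ∧ (t i).length = e i) ∧ ∀ s, S.SS s → ∀ᶠ i in UF, ¬ DomW Q (p i) (k i) (s i) (cd (t i))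

theorem HandF.mono {cd Q} {p e k x y : ℕ → ℕ} {S S' : Mod n} (hE : Ext S S') (h : HandF cd Q p e k x y S) : HandF cd Q p e k x y S' := by
  intro hx
  rcases h hx with ⟨H, c, s, h1, h2, h3, h⟩ | ⟨v, hv, h1, h2⟩
  · exact Or.inl ⟨H, c, s, hE.ss h1, hE.ss h2, hE.ss h3, h⟩
  · refine Or.inr ⟨v, hE.ss hv, h1, fun s hs => ?_⟩
    obtain ⟨s', hs', hle⟩ := hE.2 s hs
    filter_upwards [hle, h2 s' hs'] with i a b
    rintro ⟨v, hv, w, hw, hQ⟩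
    exact b ⟨v, hv, w, lt_of_lt_of_le hw a, hQ⟩

theorem DomW.mono {Q} {p x s s' u : ℕ} (h : s ≤ s') (hd : DomW Q p x s u) : DomW Q p x s' u := by
  obtain ⟨v, hv, w, hw, hQ⟩ := hd
  exact ⟨v, hv, w, lt_of_lt_of_le hw h, hQ⟩

theorem dep_choice {β γ : Type} {I : ℕ → β → Prop} {R : ℕ → β → β → γ → Prop} (b0 : β) (h0 : I 0 b0)
    (h : ∀ j b, I j b → ∃ b' g, I (j+1) b' ∧ R j b b' g) :
    ∃ (b : ℕ → β) (g : ℕ → γ), (∀ j, I j (b j)) ∧ ∀ j, R j (b j) (b (j+1)) (g j) := by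
  choose f g hf using h
  let D : ∀ j, {b // I j b} := fun j => Nat.rec (motive := fun j => {b // I j b}) ⟨b0, h0⟩ (fun j T => ⟨f j T.1 T.2, (hf j T.1 T.2).1⟩) j
  exact ⟨fun j => (D j).1, fun j => g j (D j).1 (D j).2, fun j => (D j).2, fun j => (hf j (D j).1 (D j).2).2⟩

theorem stepF_beta {ram : ℕ × ℕ × ℕ → ℕ} (hram : AA n ram) (hram' : ∀ e D z, 0 < D → RamOK e D z (ram (e, D, z)))
    {cd : List ℕ → ℕ} (hcd : AA n cd) {Q} (hQ : DD n Q) {S : Mod n} {p e k x y : ℕ → ℕ} (hp : S.SS p) (he : S.SS e) (hk : S.SS k) (hx : S.SS x)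
    (hk0 : ∀ᶠ i in UF, 0 < k i)
    {H : ℕ → List ℕ} {s : ℕ → ℕ} (hH : S.SS H) (hs : S.SS s) (hHy : ∀ᶠ i in UF, (H i).Sublist (List.range (y i)) ∧ ram (e i, k i, x i) ≤ (H i).length)
    (hd : ∀ᶠ i in UF, ∀ t : List ℕ, t.Sublist (H i) → t.length = e i → DomW Q (p i) (k i) (s i) (cd t)) :
    ∃ (H : ℕ → List ℕ) (c s : ℕ → ℕ), S.SS H ∧ S.SS c ∧ S.SS s ∧ ∀ᶠ i in UF, ((H i).Sublist (List.range (y i)) ∧ (H i).length = x i) ∧ c i < k i ∧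
      ∀ t : List ℕ, t.Sublist (H i) → t.length = e i → ∃ w < s i, Q (((cd t, c i), p i), w) := by
  have hDom : DD n (fun q : ((((ℕ × ℕ) × (ℕ × ℕ)) × ℕ) × List ℕ) => ∀ t : List ℕ, t.Sublist q.2 → t.length = q.1.1.1.2 → DomW Q q.1.1.1.1 q.1.1.2.1 q.1.2 (cd t)) := by
    refine DD.ball_sub (P := fun w : ((((ℕ × ℕ) × (ℕ × ℕ)) × ℕ) × List ℕ) × List ℕ => w.2.length = w.1.1.1.1.2 → DomW Q w.1.1.1.1.1 w.1.1.1.2.1 w.1.1.2 (cd w.2)) ?_ (by fun_prop)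
    exact DD.imp (DD.eq (by fun_prop) (by fun_prop)) ((DD.domW hQ).comp (f := fun w : ((((ℕ × ℕ) × (ℕ × ℕ)) × ℕ) × List ℕ) × List ℕ => (((w.1.1.1.1.1, w.1.1.1.2.1), w.1.1.2), cd w.2)) (by fun_prop))
  obtain ⟨z, hz, hz'⟩ := S.search (P := fun q : ((((ℕ × ℕ) × (ℕ × ℕ)) × ℕ) × List ℕ) => 0 < q.1.1.2.1 ∧ ram (q.1.1.1.2, q.1.1.2.1, q.1.1.2.2) ≤ q.2.length ∧
      ∀ t : List ℕ, t.Sublist q.2 → t.length = q.1.1.1.2 → DomW Q q.1.1.1.1 q.1.1.2.1 q.1.2 (cd t))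
    (Q := fun w : ((((ℕ × ℕ) × (ℕ × ℕ)) × ℕ) × List ℕ) × (List ℕ × ℕ) => w.2.1.Sublist w.1.2 ∧ w.2.1.length = w.1.1.1.2.2 ∧ w.2.2 < w.1.1.1.2.1 ∧
      ∀ t : List ℕ, t.Sublist w.2.1 → t.length = w.1.1.1.1.2 → ∃ v < w.1.1.2, Q (((cd t, w.2.2), w.1.1.1.1.1), v))
    (DD.and (DD.lt (by fun_prop) (by fun_prop)) (DD.and (DD.le (hram.comp (by fun_prop)) (by fun_prop)) hDom))
    (by
      refine DD.and (DD.sub (by fun_prop) (by fun_prop)) (DD.and (DD.eq (by fun_prop) (by fun_prop)) (DD.and (DD.lt (by fun_prop) (by fun_prop)) ?_))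
      refine DD.ball_sub (P := fun w : (((((ℕ × ℕ) × (ℕ × ℕ)) × ℕ) × List ℕ) × (List ℕ × ℕ)) × List ℕ => w.2.length = w.1.1.1.1.1.2 → ∃ v < w.1.1.1.2, Q (((cd w.2, w.1.2.2), w.1.1.1.1.1.1), v)) ?_ (by fun_prop)
      refine DD.imp (DD.eq (by fun_prop) (by fun_prop)) (DD.bex (P := fun w : ((((((ℕ × ℕ) × (ℕ × ℕ)) × ℕ) × List ℕ) × (List ℕ × ℕ)) × List ℕ) × ℕ => Q (((cd w.1.2, w.1.1.2.2), w.1.1.1.1.1.1.1), w.2)) (hQ.comp (by fun_prop)) (by fun_prop)))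
    (by
      rintro ⟨⟨⟨⟨p, e⟩, ⟨k, x⟩⟩, s⟩, H⟩ hq
      obtain ⟨hk0, hr, hd⟩ := hq
      replace hk0 : 0 < k := hk0
      replace hr : ram (e, k, x) ≤ H.length := hr
      replace hd : ∀ t : List ℕ, t.Sublist H → t.length = e → DomW Q p k s (cd t) := hd
      classical
      let χ : List ℕ → ℕ := fun t => if h : DomW Q p k s (cd t) then h.choose else 0
      have hχ : ∀ t, χ t < k := by
        intro t
        simp only [χ]
        split_ifs with h
        · exact h.choose_spec.1
        · exact hk0
      obtain ⟨H', h1, h2, h3⟩ := hram' e k x hk0 H hr χ hχ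
      obtain ⟨c, hc, hc'⟩ : ∃ c < k, ∀ t, t.Sublist H' → t.length = e → χ t = c := by
        by_cases hex : ∃ t : List ℕ, t.Sublist H' ∧ t.length = e
        · obtain ⟨t, ht, hl⟩ := hex
          exact ⟨χ t, hχ _, fun t' ht' hl' => h3 t' t ht' ht hl' hl⟩
        · exact ⟨0, hk0, fun t ht hl => absurd ⟨t, ht, hl⟩ hex⟩
      refine ⟨(H', c), h1, h2, hc, fun t ht hl => ?_⟩
      have hdt := hd t (List.Sublist.trans ht h1) hl
      have hct := hc' t ht hl
      simp only [χ, dif_pos hdt] at hct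
      have := hdt.choose_spec.2
      rw [hct] at this
      exact this)
    ((((hp.pair he).pair (hk.pair hx)).pair hs).pair hH) (by
      filter_upwards [hk0, hHy, hd] with i a b c
      exact ⟨a, b.2, c⟩)
  refine ⟨fun i => (z i).1, fun i => (z i).2, s, hz.app AA.fst, hz.app AA.snd, hs, ?_⟩
  filter_upwards [hz', hHy] with i a b
  obtain ⟨a1, a2, a3, a4⟩ := a
  exact ⟨⟨List.Sublist.trans a1 b.1, a2⟩, a3, a4⟩

theorem stepF {ram : ℕ × ℕ × ℕ → ℕ} (hram : AA n ram) (hram' : ∀ e D z, 0 < D → RamOK e D z (ram (e, D, z)))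
    (hU' : ∀ {s c u}, U s c u → u < c ^ c)
    {cd : List ℕ → ℕ} (hcd : AA n cd) {Q} (hQ : DD n Q) {S : Mod n} (hS : Good U S) {p e k x : ℕ → ℕ} (hp : S.SS p) (he : S.SS e) (hk : S.SS k) (hx : S.SS x) :
    ∃ S', Good U S' ∧ Ext S S' ∧ HandF cd Q p e k x (fun i => rho ram (e i, k i, x i) i i) S' := by
  by_cases hk0 : ∀ᶠ i in UF, 0 < k i
  swap
  · exact ⟨S, hS, Ext.refl _, fun h => absurd h hk0⟩
  have hb : S.SS (fun i => (e i, k i, x i)) := he.pair (hk.pair hx)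
  set y : ℕ → ℕ := fun i => rho ram (e i, k i, x i) i i with hy
  have hyS : S.SS y := ((hb.pair Mod.SS.cid).pair Mod.SS.cid).app (AA_rho hram)
  by_cases hA : ∃ (H : ℕ → List ℕ) (s : ℕ → ℕ), S.SS H ∧ S.SS s ∧ (∀ᶠ i in UF, (H i).Sublist (List.range (y i)) ∧ ram (e i, k i, x i) ≤ (H i).length) ∧
    ∀ᶠ i in UF, ∀ t : List ℕ, t.Sublist (H i) → t.length = e i → DomW Q (p i) (k i) (s i) (cd t)
  · obtain ⟨H, s, hH, hs, h1, h2⟩ := hA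
    exact ⟨S, hS, Ext.refl _, fun _ => Or.inl (stepF_beta hram hram' hcd hQ hp he hk hx hk0 hH hs h1 h2)⟩
  have hB : ∀ (H : ℕ → List ℕ) (s : ℕ → ℕ), S.SS H → S.SS s → (∀ᶠ i in UF, (H i).Sublist (List.range (y i)) ∧ ram (e i, k i, x i) ≤ (H i).length) →
      ∀ᶠ i in UF, ∃ t : List ℕ, t.Sublist (H i) ∧ t.length = e i ∧ ¬ DomW Q (p i) (k i) (s i) (cd t) := by
    intro H s hH hs h1
    by_contra hcon
    refine hA ⟨H, s, hH, hs, h1, ?_⟩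
    rw [← Ultrafilter.eventually_not] at hcon
    filter_upwards [hcon] with i hi t ht hl
    by_contra hd
    exact hi ⟨t, ht, hl, hd⟩
  obtain ⟨τ, hτ, hτ'⟩ := tasks_countable hS.1
  obtain ⟨σ, hσ⟩ := hS.1.exists_eq_range ⟨_, S.id⟩
  have hσS : ∀ j, S.SS (σ j) := fun j => by
    have : σ j ∈ S.S := by rw [hσ]; exact ⟨j, rfl⟩
    exact this
  obtain ⟨H, s, hI, hR⟩ := dep_choice (β := ℕ → List ℕ) (γ := ℕ → ℕ)
    (I := fun j H => S.SS H ∧ ∀ᶠ i in UF, (H i).Sublist (List.range (y i)) ∧ rho ram (e i, k i, x i) i (i - j) ≤ (H i).length)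
    (R := fun j H H' s => S.SS s ∧ ∀ᶠ i in UF, (H' i).Sublist (H i) ∧ ∀ t : List ℕ, t.Sublist (H' i) → t.length = e i → GoodAt U (τ j).1 (τ j).2.1 (τ j).2.2.2 (s i) i ((τ j).2.2.1 i) (Encodable.encode t))
    (fun i => List.range (y i)) ⟨hyS.app (by fun_prop), Filter.Eventually.of_forall fun i => ⟨List.Sublist.refl _, by simp [hy]⟩⟩ (by
      rintro j H ⟨hH, hH'⟩
      have hz : S.SS (fun i => rho ram (e i, k i, x i) i (i - (j+1))) :=
        ((hb.pair Mod.SS.cid).pair (Mod.SS.cid.app (f := fun i : ℕ => i - (j+1)) (by fun_prop))).app (AA_rho hram)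
      obtain ⟨H', s, h1, h2, h3⟩ := thin hram hram' hU' hS.2 (hτ j).1 (hτ j).2.1 (hτ j).2.2 (τ j).2.2.2 he hz hH (by
          filter_upwards [hH', ev_gt j] with i hi hj
          refine le_trans ?_ hi.2
          have : i - j = (i - (j+1)) + 1 := by omega
          rw [this]
          exact Nat.le_add_right _ _) (by
          intro H' hHs hh
          have := hB H' (fun _ => 0) hHs (Mod.SS.const 0) (by
            filter_upwards [hh, hH'] with i a b
            refine ⟨a.1.trans b.1, ?_⟩
            rw [a.2]; exact rho_ge _ _ _ _)
          exact this.mono fun i ⟨t, a, b, _⟩ => ⟨t, a, b⟩)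
      refine ⟨H', s, ⟨h1, ?_⟩, h2, ?_⟩
      · filter_upwards [h3, hH'] with i a b
        exact ⟨a.1.1.trans b.1, a.1.2.ge⟩
      · exact h3.mono fun i a => ⟨a.1.1, a.2⟩)
  have hch : ∀ j l, j ≤ l → ∀ᶠ i in UF, (H l i).Sublist (H j i) := by
    intro j l hl
    induction hl with
    | refl => exact Filter.Eventually.of_forall fun i => List.Sublist.refl _
    | step _ ih =>
      filter_upwards [ih, (hR _).2] with i a b
      exact b.1.trans a
  obtain ⟨v, hv⟩ := exists_sat (β := List ℕ) (W := fun j i t => t.Sublist (H (j+1) i) ∧ t.length = e i ∧ ¬ DomW Q (p i) (k i) (σ j i) (cd t)) (by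
    intro m
    have h1 := hB (H (m+1)) (fun i => ∑ j ∈ Finset.range (m+1), σ j i) (hI _).1 (SS_sum hσS _) (by
      filter_upwards [(hI (m+1)).2] with i a
      exact ⟨a.1, (rho_ge _ _ _ _).trans a.2⟩)
    have h2 : ∀ᶠ i in UF, ∀ j ∈ Finset.range (m+1), (H (m+1) i).Sublist (H (j+1) i) := by
      rw [Filter.eventually_all_finset]
      intro j hj
      exact hch _ _ (by simp at hj; omega)
    filter_upwards [h1, h2] with i a b
    obtain ⟨t, ht, hl, hd⟩ := a
    refine ⟨t, fun j hj => ⟨ht.trans (b j (by simp; omega)), hl, fun hd' => hd (hd'.mono ?_)⟩⟩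
    exact Finset.single_le_sum (f := fun j => σ j i) (fun _ _ => Nat.zero_le _) (by simp; omega))
  have hvy : ∀ᶠ i in UF, (v i).Sublist (List.range (y i)) := by
    filter_upwards [hv 0, (hI 1).2] with i a b
    exact a.1.trans b.1
  obtain ⟨X, hX, hX'⟩ := S.search' (Q := fun q : ℕ × ℕ => ∀ t : List ℕ, t.Sublist (List.range q.1) → Encodable.encode t < q.2)
    (DD.ball_sub (P := fun w : (ℕ × ℕ) × List ℕ => Encodable.encode w.2 < w.1.2) (DD.lt (by fun_prop) (by fun_prop)) (by fun_prop))
    (fun y => ⟨∑ t ∈ (List.range y).sublists'.toFinset, (Encodable.encode t + 1), fun t ht =>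
      Nat.lt_of_succ_le (Finset.single_le_sum (s := (List.range y).sublists'.toFinset) (f := fun t : List ℕ => Encodable.encode t + 1) (fun _ _ => Nat.zero_le _) (by simpa using ht))⟩) hyS
  have hE : Ext S (adj S fun i => Encodable.encode (v i)) := adj_ext S hX (hvy.mono fun i hi => hX' i _ hi)
  refine ⟨adj S fun i => Encodable.encode (v i), adj_good hS ?_, hE, fun _ => Or.inr ⟨v, adj_mem S _, ?_, ?_⟩⟩
  · intro F G hF hG a ha r
    obtain ⟨j, hj⟩ := hτ' F G hF hG a ha r
    refine ⟨s j, (hR j).1, ?_⟩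
    filter_upwards [(hR j).2, hv j] with i h1 h2
    have := h1.2 (v i) h2.1 h2.2.1
    rw [hj] at this
    exact this
  · filter_upwards [hvy, hv 0] with i a b
    exact ⟨a, b.2.1⟩
  · intro s' hs'
    obtain ⟨s'', hs'', hle⟩ := hE.2 s' hs'
    rw [hσ] at hs''
    obtain ⟨j, rfl⟩ := hs''
    filter_upwards [hle, hv j] with i a b
    exact fun hd => b.2.2 (hd.mono a)
end ArithFC

namespace ArithFC
variable {n : ℕ}

/-- decoded list -/
noncomputable def dl (d : ℕ) : List ℕ := (List.range (cunp d).1).map (nSeq (cunp d).2)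

theorem dl_length (d : ℕ) : (dl d).length = (cunp d).1 := by simp [dl]
theorem dl_getD (d j : ℕ) (h : j < (cunp d).1) : (dl d).getD j 0 = nSeq (cunp d).2 j := by
  rw [List.getD_eq_getElem _ _ (by simpa [dl] using h)]; simp [dl]

theorem AA_dl : AA n dl := by
  obtain ⟨f, hf, h⟩ := AA.searchT (n := n) (Q := fun q : ℕ × List ℕ => q.2.length = (cunp q.1).1 ∧ ∀ j < (cunp q.1).1, q.2.getD j 0 = nSeq (cunp q.1).2 j)
    (DD.and (DD.eq (by fun_prop) (by fun_prop)) (DD.ball (P := fun w : (ℕ × List ℕ) × ℕ => w.1.2.getD w.2 0 = nSeq (cunp w.1.1).2 w.2) (DD.eq (by fun_prop) (by fun_prop)) (by fun_prop)))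
    (fun d => ⟨dl d, dl_length d, dl_getD d⟩)
  refine AA.congr hf fun d => ?_
  obtain ⟨h1, h2⟩ := h d
  replace h1 : (f d).length = (cunp d).1 := h1
  replace h2 : ∀ j < (cunp d).1, (f d).getD j 0 = nSeq (cunp d).2 j := h2
  refine List.ext_getElem (by rw [h1, dl_length]) fun j hj hj' => ?_
  rw [← List.getD_eq_getElem _ 0 hj, ← List.getD_eq_getElem _ 0 hj', h2 j (by omega), dl_getD d j (by omega)]

theorem dl_surj (l : List ℕ) : ∃ d, dl d = l := by
  obtain ⟨s, hs⟩ := exists_nSeq l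
  obtain ⟨d, hd⟩ := IsPairN.exists' l.length s
  have e := cunp_eq hd
  refine ⟨d, List.ext_getElem (by rw [dl_length, e]) fun j hj hj' => ?_⟩
  rw [← List.getD_eq_getElem _ 0 hj, ← List.getD_eq_getElem _ 0 hj', dl_getD d j (by rw [e]; exact hj'), e, hs j hj']

theorem exists_cd : ∃ cd : List ℕ → ℕ, AA n cd ∧ ∀ l, dl (cd l) = l := by
  obtain ⟨f, hf, h⟩ := AA.searchT (n := n) (Q := fun q : List ℕ × ℕ => dl q.2 = q.1) (DD.eq (AA_dl.comp AA.snd) (by fun_prop)) dl_surj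
  exact ⟨f, hf, h⟩

/-- strictly increasing -/
def Srt (l : List ℕ) : Prop := ∀ j < l.length, ∀ i < j, l.getD i 0 < l.getD j 0
theorem srt_iff (l : List ℕ) : Srt l ↔ l.Pairwise (· < ·) := by
  rw [List.pairwise_iff_getElem]
  constructor
  · intro h i j hi hj hij
    have := h j hj i hij
    rwa [List.getD_eq_getElem _ 0 hi, List.getD_eq_getElem _ 0 hj] at this
  · intro h j hj i hij
    rw [List.getD_eq_getElem _ 0 (hij.trans hj), List.getD_eq_getElem _ 0 hj]
    exact h i j _ _ hij

theorem srt_sub {l l' : List ℕ} (h : l.Sublist l') (h' : Srt l') : Srt l := by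
  rw [srt_iff] at *; exact h'.sublist h
theorem srt_range (y : ℕ) : Srt (List.range y) := by
  rw [srt_iff]; exact List.pairwise_lt_range
theorem sub_of_srt {l l' : List ℕ} (h : Srt l) (h' : Srt l') (hs : ∀ x ∈ l, x ∈ l') : l.Sublist l' := by
  rw [srt_iff] at *
  refine List.sublist_of_subperm_of_pairwise (r := (· < ·)) ?_ h h'
  exact List.subperm_of_subset (h.imp fun hab => ne_of_lt hab) hs

theorem AA_mem {α : Type} [Primcodable α] [Inhabited α] {l : α → List ℕ} {x : α → ℕ} (hl : AA n l) (hx : AA n x) : DD n (fun a => x a ∈ l a) := by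
  refine (DD.bex_list (P := fun q : α × ℕ => q.2 = x q.1) (DD.eq (by fun_prop) (hx.comp AA.fst)) hl).congr fun a => ?_
  simp

theorem mem_dl (d z : ℕ) : z ∈ dl d ↔ ∃ j < (cunp d).1, nSeq (cunp d).2 j = z := by simp [dl]

variable {S : Mod n}
theorem codes_iff {d e : ℕ → ℕ} (hd : S.SS d) (he : S.SS e) (D : Set (MM S)) :
    CodesFinset (S.mk d) D (S.mk e) ↔ (∀ᶠ i in UF, Srt (dl (d i)) ∧ (dl (d i)).length = e i) ∧ ∀ z, S.SS z → (S.mk z ∈ D ↔ ∀ᶠ i in UF, z i ∈ dl (d i)) := by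
  have hs : S.SS (fun i => (cunp (d i)).2) := hd.app (f := fun s => (cunp s).2) (by fun_prop)
  have hc1 : S.SS (fun i => (cunp (d i)).1) := hd.app (f := fun s => (cunp s).1) (by fun_prop)
  have hnj : ∀ j, S.SS j → S.SS (fun i => nSeq (cunp (d i)).2 (j i)) := fun j hj => (hs.pair hj).app (f := fun p : ℕ × ℕ => nSeq p.1 p.2) (by fun_prop)
  -- membership
  have hmem : (∀ᶠ i in UF, (cunp (d i)).1 = e i) → ∀ z, S.SS z → ((∃ i, i < S.mk e ∧ SeqAt (S.mk fun i => (cunp (d i)).2) i (S.mk z)) ↔ ∀ᶠ i in UF, z i ∈ dl (d i)) := by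
    intro h1 z hz
    constructor
    · rintro ⟨j, hj, hsq⟩
      obtain ⟨j, hjS, rfl⟩ := S.exists_rep j
      rw [S.mk_lt hjS he] at hj
      rw [seqAt_mk hs hjS hz] at hsq
      filter_upwards [h1, hj, hsq] with i a b c
      exact (mem_dl _ _).2 ⟨j i, by omega, c⟩
    · intro hz'
      obtain ⟨j, hj, hj'⟩ := S.search (P := fun q : ℕ × ℕ => q.2 ∈ dl q.1) (Q := fun w : (ℕ × ℕ) × ℕ => w.2 < (cunp w.1.1).1 ∧ nSeq (cunp w.1.1).2 w.2 = w.1.2)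
        (AA_mem (AA_dl.comp AA.fst) AA.snd) (DD.and (DD.lt (by fun_prop) (by fun_prop)) (DD.eq (by fun_prop) (by fun_prop)))
        (fun q hq => (mem_dl _ _).1 hq) (hd.pair hz) hz'
      refine ⟨S.mk j, (S.mk_lt hj he).2 ?_, (seqAt_mk hs hj hz).2 (hj'.mono fun i hi => hi.2)⟩
      filter_upwards [hj', h1] with i a b
      rw [← b]; exact a.1
  constructor
  · rintro ⟨s, hp, hex, hinc, hD⟩
    obtain ⟨s', hs', rfl⟩ := S.exists_rep s
    rw [isPairC_mk hd he hs'] at hp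
    have h1 : ∀ᶠ i in UF, (cunp (d i)).1 = e i := hp.mono fun i hi => by rw [cunp_eq hi]
    have h2 : S.mk s' = S.mk (fun i => (cunp (d i)).2) := (S.mk_eq hs' hs).2 (hp.mono fun i hi => by rw [cunp_eq hi])
    rw [h2] at hex hinc hD
    refine ⟨?_, fun z hz => ?_⟩
    · refine Filter.Eventually.and ?_ (h1.mono fun i hi => by rw [dl_length, hi])
      by_contra hcon
      rw [← Ultrafilter.eventually_not] at hcon
      obtain ⟨y, hy, hy'⟩ := S.search (P := fun d : ℕ => ¬ Srt (dl d)) (Q := fun w : ℕ × (ℕ × ℕ) => w.2.1 < w.2.2 ∧ w.2.2 < (cunp w.1).1 ∧ ¬ nSeq (cunp w.1).2 w.2.1 < nSeq (cunp w.1).2 w.2.2)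
        (DD.not (by
          unfold Srt
          have hdl1 : AA n (fun w : (ℕ × ℕ) × ℕ => dl w.1.1) := AA_dl.comp (by fun_prop)
          have hdl0 : AA n (fun w : ℕ => dl w) := AA_dl
          refine DD.ball (P := fun w : ℕ × ℕ => ∀ i < w.2, (dl w.1).getD i 0 < (dl w.1).getD w.2 0) ?_ (by fun_prop)
          refine DD.ball (P := fun w : (ℕ × ℕ) × ℕ => (dl w.1.1).getD w.2 0 < (dl w.1.1).getD w.1.2 0) ?_ (by fun_prop)
          exact DD.lt (by fun_prop) (by fun_prop)))
        (DD.and (DD.lt (by fun_prop) (by fun_prop)) (DD.and (DD.lt (by fun_prop) (by fun_prop)) (DD.not (DD.lt (by fun_prop) (by fun_prop)))))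
        (by
          intro d hd
          unfold Srt at hd
          push Not at hd
          obtain ⟨j, hj, i, hi, hle⟩ := hd
          rw [dl_length] at hj
          rw [dl_getD _ _ hj, dl_getD _ _ (hi.trans hj)] at hle
          exact ⟨(i, j), hi, hj, not_lt.2 hle⟩) hd hcon
      have y1 : S.SS (fun i => (y i).1) := hy.app AA.fst
      have y2 : S.SS (fun i => (y i).2) := hy.app AA.snd
      have := hinc _ _ _ _ ((S.mk_lt y1 y2).2 (hy'.mono fun i hi => hi.1)) ((S.mk_lt y2 he).2 (by
          filter_upwards [hy', h1] with i a b
          rw [← b]; exact a.2.1))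
        ((seqAt_mk hs y1 (hnj _ y1)).2 (Filter.Eventually.of_forall fun _ => rfl)) ((seqAt_mk hs y2 (hnj _ y2)).2 (Filter.Eventually.of_forall fun _ => rfl))
      rw [S.mk_lt (hnj _ y1) (hnj _ y2)] at this
      obtain ⟨i, a, b⟩ := (this.and hy').exists
      exact b.2.2 a
    · rw [hD, hmem h1 z hz]
  · rintro ⟨hsl, hD⟩
    have h1 : ∀ᶠ i in UF, (cunp (d i)).1 = e i := hsl.mono fun i hi => by rw [← dl_length, hi.2]
    refine ⟨S.mk fun i => (cunp (d i)).2, ?_, ?_, ?_, ?_⟩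
    · rw [isPairC_mk hd he hs]
      filter_upwards [h1] with i hi
      rw [← hi]; exact cunp_spec _
    · intro j hj
      obtain ⟨j, hjS, rfl⟩ := S.exists_rep j
      rw [S.mk_lt hjS he] at hj
      refine ⟨S.mk fun i => nSeq (cunp (d i)).2 (j i), (hD _ (hnj j hjS)).2 ?_, (seqAt_mk hs hjS (hnj j hjS)).2 (Filter.Eventually.of_forall fun _ => rfl)⟩
      filter_upwards [h1, hj] with i a b
      exact (mem_dl _ _).2 ⟨j i, by omega, rfl⟩
    · intro j j' x x' hlt hj' hx hx'
      obtain ⟨j, hjS, rfl⟩ := S.exists_rep j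
      obtain ⟨j', hjS', rfl⟩ := S.exists_rep j'
      obtain ⟨x, hxS, rfl⟩ := S.exists_rep x
      obtain ⟨x', hxS', rfl⟩ := S.exists_rep x'
      rw [S.mk_lt hjS hjS'] at hlt
      rw [S.mk_lt hjS' he] at hj'
      rw [seqAt_mk hs hjS hxS] at hx
      rw [seqAt_mk hs hjS' hxS'] at hx'
      rw [S.mk_lt hxS hxS']
      filter_upwards [hlt, hj', hx, hx', hsl, h1] with i a b c d f g
      have := f.1 (j' i) (by omega) (j i) a
      rw [dl_getD _ _ (by omega), dl_getD _ _ (by omega), c, d] at this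
      exact this
    · intro z
      obtain ⟨z, hz, rfl⟩ := S.exists_rep z
      rw [hD z hz, hmem h1 z hz]

theorem frt_of {cd : List ℕ → ℕ} (hcd : AA n cd) (hcd' : ∀ l, dl (cd l) = l) {Y : (ℕ → ℕ) → (ℕ → ℕ) → (ℕ → ℕ) → ℕ → ℕ}
    (hY : ∀ e k x, S.SS e → S.SS k → S.SS x → S.SS (Y e k x))
    (h : ∀ Q, DD n Q → ∀ p e k x, S.SS p → S.SS e → S.SS k → S.SS x → HandF cd Q p e k x (Y e k x) S) (e k : MM S) (hk : 1 ≤ k) : FRT (MM S) (n+1) e k := by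
  obtain ⟨e, he, rfl⟩ := S.exists_rep e
  obtain ⟨k, hkS, rfl⟩ := S.exists_rep k
  rw [S.mk_one, S.mk_le (Mod.SS.const 1) hkS] at hk
  intro x
  obtain ⟨x, hx, rfl⟩ := S.exists_rep x
  have hy := hY e k x he hkS hx
  refine ⟨S.mk (Y e k x), fun C hC => ?_⟩
  obtain ⟨hdef, htot, hfun⟩ := hC
  obtain ⟨Q, hQ, p, hp, hrep⟩ := rep2' hdef
  -- tuples
  have htup : ∀ t : ℕ → List ℕ, S.SS t → (∀ᶠ i in UF, (t i).Sublist (List.range (Y e k x i)) ∧ (t i).length = e i) → ∀ D : Set (MM S),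
      (∀ z, S.SS z → (S.mk z ∈ D ↔ ∀ᶠ i in UF, z i ∈ t i)) → CodesTupleIn (S.mk fun i => cd (t i)) (S.mk e) (S.mk (Y e k x)) D := by
    intro t ht ht' D hD
    refine ⟨(codes_iff (ht.app hcd) he D).2 ⟨?_, ?_⟩, ?_⟩
    · filter_upwards [ht'] with i hi
      rw [hcd']; exact ⟨srt_sub hi.1 (srt_range _), hi.2⟩
    · simpa only [hcd'] using hD
    · intro z hz
      obtain ⟨z, hzS, rfl⟩ := S.exists_rep z
      rw [hD z hzS] at hz
      rw [S.mk_lt hzS hy]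
      filter_upwards [hz, ht'] with i a b
      simpa using b.1.subset a
  have setOf : ∀ t : ℕ → List ℕ, S.SS t → ∃ D : Set (MM S), ∀ z, S.SS z → (S.mk z ∈ D ↔ ∀ᶠ i in UF, z i ∈ t i) := by
    intro t ht
    refine ⟨{m | ∃ z, S.SS z ∧ S.mk z = m ∧ ∀ᶠ i in UF, z i ∈ t i}, fun z hz => ⟨?_, fun h => ⟨z, hz, rfl, h⟩⟩⟩
    rintro ⟨z', hz', he, hm⟩
    rw [S.mk_eq hz' hz] at he
    filter_upwards [he, hm] with i a b
    rwa [← a]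
  rcases h Q hQ p e k x hp he hkS hx hk with ⟨H, c, s, hH, hc, hs, hh⟩ | ⟨t, ht, ht', hund⟩
  · obtain ⟨D0, hD0⟩ := setOf H hH
    refine ⟨S.mk fun i => cd (H i), D0, (codes_iff (hH.app hcd) hx D0).2 ⟨?_, ?_⟩, ?_, S.mk c, ?_⟩
    · filter_upwards [hh] with i hi
      rw [hcd']; exact ⟨srt_sub hi.1.1 (srt_range _), hi.1.2⟩
    · simpa only [hcd'] using hD0
    · intro z hz
      obtain ⟨z, hzS, rfl⟩ := S.exists_rep z
      rw [hD0 z hzS] at hz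
      rw [S.mk_lt hzS hy]
      filter_upwards [hz, hh] with i a b
      simpa using b.1.1.subset a
    · intro d D hcod hsub
      obtain ⟨d, hd, rfl⟩ := S.exists_rep d
      have hcod' := (codes_iff hd he D).1 hcod
      obtain ⟨hsl, hD⟩ := hcod'
      have hdlS : S.SS (fun i => dl (d i)) := hd.app AA_dl
      have hsubl : ∀ᶠ i in UF, ∀ x ∈ dl (d i), x ∈ H i := by
        by_contra hcon
        rw [← Ultrafilter.eventually_not] at hcon
        obtain ⟨z, hz, hz'⟩ := S.search (P := fun q : List ℕ × List ℕ => ¬ ∀ x ∈ q.1, x ∈ q.2) (Q := fun w : (List ℕ × List ℕ) × ℕ => w.2 ∈ w.1.1 ∧ ¬ w.2 ∈ w.1.2)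
          (DD.not (DD.ball_list (P := fun w : (List ℕ × List ℕ) × ℕ => w.2 ∈ w.1.2) (AA_mem (by fun_prop) (by fun_prop)) AA.fst))
          (DD.and (AA_mem (by fun_prop) (by fun_prop)) (DD.not (AA_mem (by fun_prop) (by fun_prop))))
          (fun q hq => by push Not at hq; exact hq) (hdlS.pair hH) hcon
        have h1 := hsub ((hD z hz).2 (hz'.mono fun i hi => hi.1))
        rw [hD0 z hz] at h1
        obtain ⟨i, a, b⟩ := (h1.and hz').exists
        exact b.2 a
      have hdH : ∀ᶠ i in UF, (dl (d i)).Sublist (H i) := by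
        filter_upwards [hsubl, hsl, hh] with i a b c
        exact sub_of_srt b.1 (srt_sub c.1.1 (srt_range _)) a
      have hdy : ∀ᶠ i in UF, (dl (d i)).Sublist (List.range (Y e k x i)) ∧ (dl (d i)).length = e i := by
        filter_upwards [hdH, hsl, hh] with i a b c
        exact ⟨a.trans c.1.1, b.2⟩
      have hT := htup _ hdlS hdy D hD
      have hT' : CodesTupleIn (S.mk d) (S.mk e) (S.mk (Y e k x)) D := ⟨hcod, hT.2⟩
      have hcdS : S.SS (fun i => cd (dl (d i))) := hdlS.app hcd
      obtain ⟨w, hw, hw'⟩ := S.search (P := fun q : ((ℕ × ℕ) × ℕ) × ℕ => ∃ w < q.2, Q (q.1, w)) (Q := fun r : (((ℕ × ℕ) × ℕ) × ℕ) × ℕ => Q (r.1.1, r.2))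
        (DD.bex (P := fun r : (((ℕ × ℕ) × ℕ) × ℕ) × ℕ => Q (r.1.1, r.2)) (hQ.comp (by fun_prop)) AA.snd) (hQ.comp (by fun_prop))
        (fun q ⟨w, _, hq⟩ => ⟨w, hq⟩) (((hcdS.pair hc).pair hp).pair hs) (by
          filter_upwards [hh, hdH, hsl] with i a b c
          exact a.2.2 _ b c.2)
      have hC1 : C (S.mk fun i => cd (dl (d i))) (S.mk c) := (hrep _ _ hcdS hc).2 ⟨w, hw, hw'⟩
      obtain ⟨i', _, hC2⟩ := htot _ _ hT'
      rw [hfun _ _ _ _ _ hT' hT hC2 hC1] at hC2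
      exact hC2
  · exfalso
    obtain ⟨D0, hD0⟩ := setOf t ht
    obtain ⟨v, hvk, hC⟩ := htot _ _ (htup t ht ht' D0 hD0)
    obtain ⟨v, hv, rfl⟩ := S.exists_rep v
    rw [hrep _ v (ht.app hcd) hv] at hC
    obtain ⟨w, hw, hq⟩ := hC
    rw [S.mk_lt hv hkS] at hvk
    obtain ⟨i, ⟨h1, h2⟩, h3⟩ := ((hvk.and hq).and (hund _ (hw.add (Mod.SS.const 1)))).exists
    exact h3 ⟨v i, h1, w i, Nat.lt_succ_self _, h2⟩
end ArithFC

namespace ArithFC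


theorem exists_model (m : ℕ) {ram : ℕ × ℕ × ℕ → ℕ} (hram : AA (m+1) ram)
    (hram' : ∀ e D z, 0 < D → RamOK e D z (ram (e, D, z))) {cd : List ℕ → ℕ} (hcd : AA (m+1) cd) :
    ∃ S : Mod (m+1), Good (UU m) S ∧
      (∀ Q, DD (m+1) Q → ∀ p x, S.SS p → S.SS x → HandW Q p x S) ∧
      (∀ Q, DD (m+1) Q → ∀ p e k x, S.SS p → S.SS e → S.SS k → S.SS x →
        HandF cd Q p e k x (fun i => rho ram (e i, k i, x i) i i) S) := by
  haveI : Countable {Q : ((ℕ × ℕ) × ℕ) × ℕ → Prop // DD (m+1) Q} :=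
    (DD.countable (α := ((ℕ × ℕ) × ℕ) × ℕ) (m+1)).to_subtype
  obtain ⟨S, hS, -, h⟩ := exists_closed (U := UU m) (n := m+1)
    (ι := {Q : ((ℕ × ℕ) × ℕ) × ℕ → Prop // DD (m+1) Q})
    (fun t q S => HandW t.1 (fun i => (q i).unpair.1) (fun i => (q i).unpair.2) S ∧
      HandF cd t.1 (fun i => (q i).unpair.1) (fun i => (q i).unpair.2.unpair.1)
        (fun i => (q i).unpair.2.unpair.2.unpair.1) (fun i => (q i).unpair.2.unpair.2.unpair.2)
        (fun i => rho ram ((q i).unpair.2.unpair.1, (q i).unpair.2.unpair.2.unpair.1,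
          (q i).unpair.2.unpair.2.unpair.2) i i) S)
    (by
      intro S hS t q hq
      have key : ∀ S' : Mod (m+1), S.S ⊆ S'.S → ∀ f : ℕ → ℕ, AA (m+1) f → S'.SS (fun i => f (q i)) :=
        by
        intro S' h f hf
        have hq' : S'.SS q := h hq
        exact hq'.app hf
      obtain ⟨S1, h1, e1, w1⟩ := stepW (U := UU m) (fun h h1 => UU.anti h h1) t.2 hS (p := fun i => (q i).unpair.1) (x := fun i => (q i).unpair.2)
        (key S subset_rfl (fun a => a.unpair.1) (by fun_prop)) (key S subset_rfl (fun a => a.unpair.2) (by fun_prop))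
      obtain ⟨S2, h2, e2, w2⟩ := stepF (U := UU m) hram hram' (fun h => h.1) hcd t.2 h1
        (key S1 e1.1 (fun a => a.unpair.1) (by fun_prop))
        (key S1 e1.1 (fun a => a.unpair.2.unpair.1) (by fun_prop))
        (key S1 e1.1 (fun a => a.unpair.2.unpair.2.unpair.1) (by fun_prop))
        (key S1 e1.1 (fun a => a.unpair.2.unpair.2.unpair.2) (by fun_prop))
      exact ⟨S2, h2, e1.trans e2, w1.mono e2, w2⟩)
    (fun S S' hE t q _ hh => ⟨hh.1.mono hE, hh.2.mono hE⟩) (S0 (m+1)) ⟨S0_countable _, inv_S0 m⟩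
  refine ⟨S, hS, fun Q hQ p x hp hx => ?_, fun Q hQ p e k x hp he hk hx => ?_⟩
  · have hp' : p ∈ S.S := hp
    have hx' : x ∈ S.S := hx
    have := (h ⟨Q, hQ⟩ _ (S.pair hp' hx')).1
    simp only [Nat.unpair_pair] at this
    exact this
  · have hp' : p ∈ S.S := hp
    have hx' : x ∈ S.S := hx
    have he' : e ∈ S.S := he
    have hk' : k ∈ S.S := hk
    have := (h ⟨Q, hQ⟩ _ (S.pair hp' (S.pair he' (S.pair hk' hx')))).2
    simp only [Nat.unpair_pair] at this
    exact this

theorem final (n : ℕ) (hn : 1 ≤ n) :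
    ∃ (M : Type) (_ : lang.Structure M), PAm M ∧ ISig n M ∧ PSig n M ∧
      WPHP M (n + 1) ∧
      (∀ e k : M, (1 : M) ≤ e → (1 : M) ≤ k → FRT M (n + 1) e k) ∧
      ¬BSig (n + 1) M := by
  obtain ⟨m, rfl⟩ : ∃ m, n = m + 1 := ⟨n - 1, by omega⟩
  obtain ⟨ram, hram, hram'⟩ := exists_ram hn
  obtain ⟨cd, hcd, hcd'⟩ := exists_cd (n := m+1)
  obtain ⟨S, hS, hW, hF⟩ := exists_model m hram hram' hcd
  refine ⟨MM S, inferInstance, pam, isig, psig hn, wphp_of hW, fun e k _ hk => ?_, not_bsig S hS.2⟩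
  refine frt_of hcd hcd' (Y := fun e k x i => rho ram (e i, k i, x i) i i) (fun e k x he hk hx => ?_) hF e k hk
  exact (((he.pair (hk.pair hx)).pair Mod.SS.cid).pair Mod.SS.cid).app (AA_rho hram)

end ArithFC


namespace ArithFC

/-- For every `n ≥ 1`,
PA⁻ + IΣn + PΣn + WPHP(Σ_{n+1}) + FRT(Σ_{n+1}) does not prove BΣ_{n+1}. -/
theorem statement_17 (n : ℕ) (hn : 1 ≤ n) :
    ∃ (M : Type) (_ : lang.Structure M), PAm M ∧ ISig n M ∧ PSig n M ∧
      WPHP M (n + 1) ∧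
      (∀ e k : M, (1 : M) ≤ e → (1 : M) ≤ k → FRT M (n + 1) e k) ∧
      ¬BSig (n + 1) M := by
  exact final n hn

end ArithFC
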